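/- Let K = K1 ∩ K2, where K1 and K2 are ideals primary to two distinct linear primes of height 2 and e(R/K1) = e(R/K2) = 2. If either K = I^un or K = L, then pd(R/I) ≤ 5. -/

import Mathlib

open MvPolynomial Filter CategoryTheory

noncomputable section

/-- The height of an ideal `J`: the infimum of the heights of the prime ideals containing it. -/
def idealHeight {R : Type} [CommRing R] (J : Ideal R) : ℕ∞ :=
  ⨅ p ∈ {p : {q : Ideal R // q.IsPrime} | J ≤ p.1}, Order.height p

/-- `pdQuotLE J n` holds iff `R ⧸ J` admits a projective resolution of length at most `n`,
i.e. the projective dimension of `R ⧸ J` as an `R`-module is at most `n`. -/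
def pdQuotLE {R : Type} [CommRing R] (J : Ideal R) (n : ℕ) : Prop :=
  ∃ P : ProjectiveResolution (ModuleCat.of R (R ⧸ J)),
    ∀ i, n < i → Limits.IsZero (P.complex.X i)

/-- The `p`-primary component of `J` for `p` a minimal prime of `J`:
the saturation of `J` at `p`. -/
def primaryComponent {R : Type} [CommRing R] (J p : Ideal R) : Ideal R :=
  ⨆ (s : R) (_ : s ∉ p), Submodule.colon J (Ideal.span {s})

/-- The unmixed part `J^un` of `J`: the intersection of the primary components of `J`
corresponding to the minimal primes of `J` of minimal height. -/
def unmixedPart {R : Type} [CommRing R] (J : Ideal R) : Ideal R :=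
  ⨅ p ∈ {p : Ideal R | p.IsPrime ∧ J ≤ p ∧ idealHeight p = idealHeight J},
    primaryComponent J p

/-- A linear prime: a prime ideal generated by forms of degree one. -/
def IsLinearPrime {k : Type} [CommSemiring k] {N : ℕ} (p : Ideal (MvPolynomial (Fin N) k)) : Prop :=
  p.IsPrime ∧ ∃ S : Set (MvPolynomial (Fin N) k), (∀ ℓ ∈ S, ℓ.IsHomogeneous 1) ∧ p = Ideal.span S

/-- A homogeneous ideal: an ideal generated by homogeneous elements. -/
def IsHomogeneousIdeal {k : Type} [CommSemiring k] {N : ℕ}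
    (J : Ideal (MvPolynomial (Fin N) k)) : Prop :=
  ∃ S : Set (MvPolynomial (Fin N) k), (∀ g ∈ S, ∃ d, g.IsHomogeneous d) ∧ J = Ideal.span S

/-- `[B]_n`: the ideal generated by all forms of degree `n` belonging to `B`. -/
def degreePart {k : Type} [CommSemiring k] {N : ℕ} (B : Ideal (MvPolynomial (Fin N) k)) (n : ℕ) :
    Ideal (MvPolynomial (Fin N) k) :=
  Ideal.span {f | f ∈ B ∧ f.IsHomogeneous n}

/-- The Hilbert–Samuel function of `R/J` with respect to the irrelevant maximal ideal:
`n ↦ length (R / (J + 𝔪^n)) = dim_k (R / (J + 𝔪^n))`. -/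
def hilbertSamuelFn {k : Type} [Field k] {N : ℕ} (J : Ideal (MvPolynomial (Fin N) k))
    (n : ℕ) : ℕ :=
  Module.finrank k
    (MvPolynomial (Fin N) k ⧸
      (J ⊔ (Ideal.span (Set.range (MvPolynomial.X : Fin N → MvPolynomial (Fin N) k))) ^ n))

/-- `HasMultiplicity J d e`: the quotient `R/J` has Krull dimension `d` and Hilbert–Samuel
multiplicity `e`, expressed through the asymptotics `d! · HS_J(n) / n^d → e` of the
Hilbert–Samuel function. -/
def HasMultiplicity {k : Type} [Field k] {N : ℕ} (J : Ideal (MvPolynomial (Fin N) k))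
    (d e : ℕ) : Prop :=
  Tendsto (fun n : ℕ => (Nat.factorial d : ℝ) * (hilbertSamuelFn J n : ℝ) / (n : ℝ) ^ d)
    atTop (nhds (e : ℝ))

/-- An ideal of `R` is extended from a subalgebra `A` if it is generated by elements of `A`. -/
def extendedFrom {k R : Type} [CommRing k] [CommRing R] [Algebra k R]
    (K : Ideal R) (A : Subalgebra k R) : Prop :=
  ∃ S : Set R, S ⊆ (A : Set R) ∧ K = Ideal.span S

section

/-- projective dimension at most `n` -/
abbrev PD (R : Type) [CommRing R] (n : ℕ) (M : Type) [AddCommGroup M] [Module R M] : Prop :=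
  HasProjectiveDimensionLE (ModuleCat.of R M) n

section
variable {R : Type} [CommRing R] {M N P : Type} [AddCommGroup M] [Module R M]
  [AddCommGroup N] [Module R N] [AddCommGroup P] [Module R P]

lemma ses_of (f : M →ₗ[R] N) (g : N →ₗ[R] P) (hf : Function.Injective f)
    (hg : Function.Surjective g) (h : Function.Exact f g) :
    (ShortComplex.mk (ModuleCat.ofHom f) (ModuleCat.ofHom g)
      (by ext x; exact (h.apply_apply_eq_zero x))).ShortExact := by
  refine ShortComplex.ShortExact.mk' ?_ ?_ ?_
  · rw [ShortComplex.ShortExact.moduleCat_exact_iff_function_exact]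
    exact h
  · exact (ModuleCat.mono_iff_injective _).2 hf
  · exact (ModuleCat.epi_iff_surjective _).2 hg

lemma PD.mono {m n : ℕ} (h : PD R m M) (hmn : m ≤ n) : PD R n M :=
  hasProjectiveDimensionLT_of_ge _ (m+1) (n+1) (by omega)

lemma PD.congr {n : ℕ} (h : PD R n M) (e : M ≃ₗ[R] N) : PD R n N :=
  ModuleCat.hasProjectiveDimensionLE_of_linearEquiv (M := ModuleCat.of R M) (N := ModuleCat.of R N) e n

lemma PD.mid {n : ℕ} (f : M →ₗ[R] N) (g : N →ₗ[R] P) (hf : Function.Injective f)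
    (hg : Function.Surjective g) (h : Function.Exact f g) (h1 : PD R n M) (h3 : PD R n P) :
    PD R n N :=
  (ses_of f g hf hg h).hasProjectiveDimensionLT_X₂ (n+1) h1 h3

lemma PD.right {n : ℕ} (f : M →ₗ[R] N) (g : N →ₗ[R] P) (hf : Function.Injective f)
    (hg : Function.Surjective g) (h : Function.Exact f g) (h1 : PD R n M) (h2 : PD R (n+1) N) :
    PD R (n+1) P :=
  (ses_of f g hf hg h).hasProjectiveDimensionLT_X₃ (n+1) h1 h2

lemma PD.left {n : ℕ} (f : M →ₗ[R] N) (g : N →ₗ[R] P) (hf : Function.Injective f)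
    (hg : Function.Surjective g) (h : Function.Exact f g) (h2 : PD R n N) (h3 : PD R (n+1) P) :
    PD R n M :=
  (ses_of f g hf hg h).hasProjectiveDimensionLT_X₁ (n+1) h2 h3

lemma PD.of_projective [Module.Projective R M] (n : ℕ) : PD R n M := by
  have : Projective (ModuleCat.of R M) := (IsProjective.iff_projective (R := R) M).1 inferInstance
  have h0 : PD R 0 M := projective_iff_hasProjectiveDimensionLT_one.1 this
  exact h0.mono (Nat.zero_le _)

lemma PD.of_subsingleton [Subsingleton M] (n : ℕ) : PD R n M := by
  exact PD.of_projective n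

lemma PD.prod {n : ℕ} (h1 : PD R n M) (h2 : PD R n N) : PD R n (M × N) :=
  PD.mid (LinearMap.inl R M N) (LinearMap.snd R M N) LinearMap.inl_injective
    LinearMap.snd_surjective Function.Exact.inl_snd h1 h2

/-- quotient by a submodule -/
lemma PD.quot {n : ℕ} (H : Submodule R M) (h1 : PD R n H) (h2 : PD R (n+1) M) :
    PD R (n+1) (M ⧸ H) :=
  PD.right H.subtype H.mkQ H.subtype_injective H.mkQ_surjective
    (LinearMap.exact_subtype_mkQ H) h1 h2

lemma PD.sub {n : ℕ} (H : Submodule R M) (h2 : PD R n M) (h3 : PD R (n+1) (M ⧸ H)) :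
    PD R n H :=
  PD.left H.subtype H.mkQ H.subtype_injective H.mkQ_surjective
    (LinearMap.exact_subtype_mkQ H) h2 h3

lemma tower_exact (H H' : Submodule R M) (g : N →ₗ[R] M) (hle : H ≤ H')
    (hg : H ⊔ LinearMap.range g = H') :
    Function.Injective (Submodule.mapQ (H.comap g) H g le_rfl) ∧
    Function.Exact (Submodule.mapQ (H.comap g) H g le_rfl) (Submodule.factor hle) := by
  constructor
  · rw [← LinearMap.ker_eq_bot, Submodule.ker_mapQ, Submodule.mkQ_map_self]
  · rw [LinearMap.exact_iff]
    ext x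
    obtain ⟨x, rfl⟩ := H.mkQ_surjective x
    have h1 : Submodule.factor hle (H.mkQ x) = 0 ↔ x ∈ H' := Submodule.Quotient.mk_eq_zero _
    rw [LinearMap.mem_ker, h1, ← hg, Submodule.mem_sup]
    constructor
    · rintro ⟨u, hu, v, ⟨w, rfl⟩, rfl⟩
      refine ⟨Submodule.Quotient.mk w, ?_⟩
      simp only [Submodule.mapQ_apply, Submodule.mkQ_apply]
      rw [Submodule.Quotient.eq]
      simpa using H.neg_mem hu
    · rintro ⟨w, hw⟩
      obtain ⟨w, rfl⟩ := (H.comap g).mkQ_surjective w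
      simp only [Submodule.mkQ_apply, Submodule.mapQ_apply] at hw
      rw [Submodule.Quotient.eq] at hw
      exact ⟨x - g w, by simpa using H.neg_mem hw, g w, ⟨w, rfl⟩, by abel⟩

/-- tower `H ≤ H'` : `0 → N/g⁻¹H → M/H → M/H' → 0` where `H' = H + g(N)`. -/
lemma PD.tower {n : ℕ} (H H' : Submodule R M) (g : N →ₗ[R] M)
    (hg : H ⊔ LinearMap.range g = H')
    (h1 : PD R n (N ⧸ H.comap g)) (h2 : PD R n (M ⧸ H')) : PD R n (M ⧸ H) := by
  have hle : H ≤ H' := hg ▸ le_sup_left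
  exact PD.mid _ _ (tower_exact H H' g hle hg).1 (Submodule.factor_surjective hle)
    (tower_exact H H' g hle hg).2 h1 h2

lemma PD.tower' {n : ℕ} (H H' : Submodule R M) (g : N →ₗ[R] M)
    (hg : H ⊔ LinearMap.range g = H')
    (h1 : PD R n (N ⧸ H.comap g)) (h2 : PD R (n+1) (M ⧸ H)) : PD R (n+1) (M ⧸ H') := by
  have hle : H ≤ H' := hg ▸ le_sup_left
  exact PD.right _ _ (tower_exact H H' g hle hg).1 (Submodule.factor_surjective hle)
    (tower_exact H H' g hle hg).2 h1 h2

lemma mv_exact (H₁ H₂ : Submodule R M) :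
    ∃ (f : (M ⧸ (H₁ ⊓ H₂)) →ₗ[R] (M ⧸ H₁) × (M ⧸ H₂))
      (g : (M ⧸ H₁) × (M ⧸ H₂) →ₗ[R] (M ⧸ (H₁ ⊔ H₂))),
      Function.Injective f ∧ Function.Surjective g ∧ Function.Exact f g := by
  refine ⟨(Submodule.factor inf_le_left).prod (Submodule.factor inf_le_right),
    (Submodule.factor le_sup_left).coprod (- Submodule.factor le_sup_right), ?_, ?_, ?_⟩
  · rw [← LinearMap.ker_eq_bot, eq_bot_iff]
    intro x hx
    obtain ⟨x, rfl⟩ := Submodule.mkQ_surjective _ x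
    have h1 : Submodule.factor (inf_le_left : H₁ ⊓ H₂ ≤ H₁) (Submodule.mkQ _ x) = 0 ∧
      Submodule.factor (inf_le_right : H₁ ⊓ H₂ ≤ H₂) (Submodule.mkQ _ x) = 0 := by
      simpa using hx
    have a1 : x ∈ H₁ := (Submodule.Quotient.mk_eq_zero _).1 h1.1
    have a2 : x ∈ H₂ := (Submodule.Quotient.mk_eq_zero _).1 h1.2
    exact (Submodule.Quotient.mk_eq_zero _).2 ⟨a1, a2⟩
  · intro x
    obtain ⟨x, rfl⟩ := Submodule.mkQ_surjective _ x
    exact ⟨(Submodule.Quotient.mk x, 0), by simp⟩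
  · rintro ⟨x, y⟩
    obtain ⟨x, rfl⟩ := Submodule.mkQ_surjective _ x
    obtain ⟨y, rfl⟩ := Submodule.mkQ_surjective _ y
    constructor
    · intro h
      have h' : (Submodule.Quotient.mk (x - y) : M ⧸ (H₁ ⊔ H₂)) = 0 := by
        simpa [sub_eq_add_neg] using h
      rw [Submodule.Quotient.mk_eq_zero, Submodule.mem_sup] at h'
      obtain ⟨u, hu, v, hv, e⟩ := h'
      refine ⟨Submodule.Quotient.mk (x - u), ?_⟩
      refine Prod.ext ?_ ?_
      · refine (Submodule.Quotient.eq _).2 ?_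
        simpa using hu
      · refine (Submodule.Quotient.eq _).2 ?_
        have : x - u - y = v := by rw [sub_right_comm, ← e]; abel
        change x - u - y ∈ H₂
        rwa [this]
    · rintro ⟨w, hw⟩
      obtain ⟨w, rfl⟩ := Submodule.mkQ_surjective _ w
      rw [← hw]
      simp

lemma PD.inf {n : ℕ} (H₁ H₂ : Submodule R M) (h1 : PD R n (M ⧸ H₁)) (h2 : PD R n (M ⧸ H₂))
    (h3 : PD R (n+1) (M ⧸ (H₁ ⊔ H₂))) : PD R n (M ⧸ (H₁ ⊓ H₂)) := by
  obtain ⟨f, g, hf, hg, h⟩ := mv_exact H₁ H₂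
  exact PD.left f g hf hg h (h1.prod h2) h3

lemma PD.sup {n : ℕ} (H₁ H₂ : Submodule R M) (h1 : PD R (n+1) (M ⧸ H₁))
    (h2 : PD R (n+1) (M ⧸ H₂))
    (h3 : PD R n (M ⧸ (H₁ ⊓ H₂))) : PD R (n+1) (M ⧸ (H₁ ⊔ H₂)) := by
  obtain ⟨f, g, hf, hg, h⟩ := mv_exact H₁ H₂
  exact PD.right f g hf hg h h3 (h1.prod h2)

end

section
variable {R : Type} [CommRing R]

lemma comap_toSpan (J : Ideal R) (u : R) :
    Submodule.comap (LinearMap.toSpanSingleton R R u) J = J.colon (Ideal.span {u}) := by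
  ext r
  simp [Submodule.mem_colon_singleton]

/-- colon sequence -/
lemma PD.colon {n : ℕ} (J : Ideal R) (u : R)
    (h1 : PD R n (R ⧸ (J.colon (Ideal.span {u}) : Ideal R))) (h2 : PD R n (R ⧸ (J ⊔ Ideal.span {u}))) :
    PD R n (R ⧸ J) := by
  refine PD.tower (R := R) (M := R) (N := R) J (J ⊔ Ideal.span {u})
    (LinearMap.toSpanSingleton R R u) ?_ ?_ h2
  · rw [LinearMap.range_toSpanSingleton]
  · rw [comap_toSpan]; exact h1

lemma PD.colon' {n : ℕ} (J : Ideal R) (u : R)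
    (h1 : PD R n (R ⧸ (J.colon (Ideal.span {u}) : Ideal R))) (h2 : PD R (n+1) (R ⧸ J)) :
    PD R (n+1) (R ⧸ (J ⊔ Ideal.span {u})) := by
  refine PD.tower' (R := R) (M := R) (N := R) J (J ⊔ Ideal.span {u})
    (LinearMap.toSpanSingleton R R u) ?_ ?_ h2
  · rw [LinearMap.range_toSpanSingleton]
  · rw [comap_toSpan]; exact h1

lemma PD.nzd {n : ℕ} (J : Ideal R) (u : R) (hu : ∀ r, r * u ∈ J → r ∈ J)
    (h2 : PD R n (R ⧸ J)) : PD R (n+1) (R ⧸ (J ⊔ Ideal.span {u})) := by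
  have : J.colon (Ideal.span {u}) = J := by
    ext r; rw [← comap_toSpan]
    simp only [Submodule.mem_comap, LinearMap.toSpanSingleton_apply, smul_eq_mul]
    exact ⟨hu r, fun h => J.mul_mem_right _ h⟩
  exact PD.colon' J u (by rw [this]; exact h2) (h2.mono (by omega))

lemma PD.bot : PD R 0 (R ⧸ (⊥ : Ideal R)) :=
  (PD.of_projective (R := R) (M := R) 0).congr (Submodule.quotEquivOfEqBot ⊥ rfl).symm

lemma PD.top (n : ℕ) : PD R n (R ⧸ (⊤ : Ideal R)) :=
  have : Subsingleton (R ⧸ (⊤ : Ideal R)) := Ideal.Quotient.subsingleton_iff.2 rfl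
  PD.of_subsingleton n
end

end

section

section resol
universe u v
variable {C : Type u} [Category.{v} C] [Abelian C]

lemma exists_res_of_ses (S : ShortComplex C) (hS : S.ShortExact) [Projective S.X₂]
    (Q : ProjectiveResolution S.X₁) (n : ℕ) (hQ : ∀ i, n < i → Limits.IsZero (Q.complex.X i)) :
    ∃ P : ProjectiveResolution S.X₃, ∀ i, n + 1 < i → Limits.IsZero (P.complex.X i) := by
  have := hS.epi_g
  have := hS.mono_f
  let q : Q.complex.X 0 ⟶ S.X₁ := Q.π.f 0
  have hq : Epi q := inferInstanceAs (Epi (Q.π.f 0))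
  have hw0 : Q.complex.d 1 0 ≫ q = 0 := Q.complex_d_comp_π_f_zero
  let g : Q.complex.X 0 ⟶ S.X₂ := q ≫ S.f
  have hw : Q.complex.d 1 0 ≫ g = 0 := by
    simp only [g, ← Category.assoc, hw0, Limits.zero_comp]
  let D := Q.complex.augment g hw
  have hproj : ∀ n, Projective (D.X n) := by
    intro n
    cases n with
    | zero => exact inferInstanceAs (Projective S.X₂)
    | succ n => exact inferInstanceAs (Projective (Q.complex.X n))
  have hd10 : D.d 1 0 = g := rfl
  have hgg : g ≫ S.g = 0 := by simp [g]
  have hex0 : (ShortComplex.mk (Q.complex.d 1 0) q hw0).Exact := Q.exact₀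
  have hexact : ∀ n, D.ExactAt (n+1) := by
    intro n
    rw [HomologicalComplex.exactAt_iff' _ (n+2) (n+1) n (by simp) (by simp)]
    cases n with
    | zero =>
      have : (ShortComplex.mk (Q.complex.d 1 0) g hw).Exact := by
        rw [ShortComplex.exact_iff_of_epi_of_isIso_of_mono (S₂ := ShortComplex.mk (Q.complex.d 1 0) g hw) (S₁ := ShortComplex.mk (Q.complex.d 1 0) q hw0)
          { τ₁ := 𝟙 _, τ₂ := 𝟙 _, τ₃ := S.f}] at hex0
        exact hex0
      exact this
    | succ n =>
      have := Q.complex_exactAt_succ n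
      rw [HomologicalComplex.exactAt_iff' _ (n+2) (n+1) n (by simp) (by simp)] at this
      exact this
  refine ⟨{ complex := D, projective := hproj,
            π := (ChainComplex.toSingle₀Equiv _ _).symm ⟨S.g, by
              exact hgg⟩
            quasiIso := ⟨fun n => ?_⟩ }, ?_⟩
  · cases n
    · rw [ChainComplex.quasiIsoAt₀_iff, ShortComplex.quasiIso_iff_of_zeros']
      · have h1 : (ShortComplex.mk g S.g (by simp [g])).Exact := by
          refine (ShortComplex.exact_iff_of_epi_of_isIso_of_mono (S₁ := ShortComplex.mk g S.g (by simp [g])) (S₂ := S)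
            { τ₁ := q, τ₂ := 𝟙 _, τ₃ := 𝟙 _}).2 hS.exact
        refine (ShortComplex.exact_and_epi_g_iff_of_iso ?_).2
          ⟨h1, by dsimp; infer_instance⟩
        exact ShortComplex.isoMk (Iso.refl _) (Iso.refl _) (Iso.refl _)
          ((Category.id_comp g).trans (Category.comp_id g).symm)
          ((Category.id_comp S.g).trans (((ChainComplex.toSingle₀Equiv_symm_apply_f_zero (C := D) (X := S.X₃) S.g hgg).symm).trans (Category.comp_id _).symm))
      all_goals rfl
    · rw [quasiIsoAt_iff_exactAt']
      · apply hexact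
      · apply ChainComplex.exactAt_succ_single_obj
  · intro i hi
    cases i with
    | zero => omega
    | succ i => exact hQ i (by omega)

end resol

lemma exists_res {R : Type} [CommRing R] (n : ℕ) : ∀ (Z : ModuleCat.{0} R),
    HasProjectiveDimensionLE Z n →
    ∃ P : ProjectiveResolution Z, ∀ i, n < i → Limits.IsZero (P.complex.X i) := by
  induction n with
  | zero =>
    intro Z hZ
    have : Projective Z := projective_iff_hasProjectiveDimensionLT_one.2 hZ
    refine ⟨ProjectiveResolution.self Z, fun i hi => ?_⟩
    exact HomologicalComplex.isZero_single_obj_X _ _ _ _ (by omega)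
  | succ n ih =>
    intro Z hZ
    have hS := Z.shortExact_projectiveShortComplex
    have : Projective Z.projectiveShortComplex.X₂ := by
      exact ModuleCat.projective_of_free (Module.Free.chooseBasis R _)
    obtain ⟨Q, hQ⟩ := ih Z.projectiveShortComplex.X₁
      (hS.hasProjectiveDimensionLT_X₁ (n+1) inferInstance hZ)
    exact exists_res_of_ses _ hS Q n hQ

lemma pdQuotLE_of_PD {R : Type} [CommRing R] (J : Ideal R) (n : ℕ) (h : PD R n (R ⧸ J)) :
    pdQuotLE J n := exists_res n _ h

end

section

section
variable {R : Type} [CommRing R]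

lemma ufd_prim {A : Type*} [CommRing A] [IsDomain A] [UniqueFactorizationMonoid A] (a b : A)
    (h : a ≠ 0 ∨ b ≠ 0) : ∃ a' b' g, IsRelPrime a' b' ∧ g ≠ 0 ∧ g * a' = a ∧ g * b' = b ∧
      (a' ≠ 0 ∨ b' ≠ 0) ∧
      ∀ u v, u * b = v * a → ∃ t, u = t * a' ∧ v = t * b' := by
  have key : ∃ a' b' g, IsRelPrime a' b' ∧ g * a' = a ∧ g * b' = b := by
    rcases h with h | h
    · obtain ⟨a', b', c', h1, h2, h3⟩ := UniqueFactorizationMonoid.exists_reduced_factors a h b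
      exact ⟨a', b', c', h1, h2, h3⟩
    · obtain ⟨a', b', c', h1, h2, h3⟩ := UniqueFactorizationMonoid.exists_reduced_factors b h a
      exact ⟨b', a', c', h1.symm, h3, h2⟩
  obtain ⟨a', b', g, h1, h2, h3⟩ := key
  have hg : g ≠ 0 := by
    rintro rfl
    rcases h with h | h
    · exact h (by simpa using h2.symm)
    · exact h (by simpa using h3.symm)
  have hab : a' ≠ 0 ∨ b' ≠ 0 := by
    rcases h with h | h
    · left; rintro rfl; exact h (by simpa using h2.symm)
    · right; rintro rfl; exact h (by simpa using h3.symm)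
  refine ⟨a', b', g, h1, hg, h2, h3, hab, ?_⟩
  intro u v huv
  have huv' : u * b' = v * a' := by
    apply mul_left_cancel₀ hg
    calc g * (u * b') = u * (g * b') := by ring
      _ = v * (g * a') := by rw [h3, huv, h2]
      _ = g * (v * a') := by ring
  rcases hab with ha | hb
  · obtain ⟨t, ht⟩ : a' ∣ u := h1.dvd_of_dvd_mul_right ⟨v, by rw [huv']; ring⟩
    refine ⟨t, by rw [ht]; ring, ?_⟩
    apply mul_right_cancel₀ ha
    rw [← huv', ht]; ring
  · obtain ⟨t, ht⟩ : b' ∣ v := h1.symm.dvd_of_dvd_mul_right ⟨u, by rw [← huv']; ring⟩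
    refine ⟨t, ?_, by rw [ht]; ring⟩
    apply mul_right_cancel₀ hb
    rw [huv', ht]; ring

/-- `{(u,v) | u b - v a ∈ p}` -/
def HH (p : Ideal R) (a b : R) : Submodule R (R × R) where
  carrier := {w | w.1 * b - w.2 * a ∈ p}
  add_mem' := by
    intro w w' h h'
    have := p.add_mem h h'
    simp only [Set.mem_ofPred_eq, Prod.fst_add, Prod.snd_add]
    convert this using 1; ring
  zero_mem' := by simp
  smul_mem' := by
    intro c w h
    have := p.mul_mem_left c h
    simp only [Set.mem_ofPred_eq, Prod.smul_fst, Prod.smul_snd, smul_eq_mul]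
    convert this using 1; ring

lemma mem_HH {p : Ideal R} {a b : R} {w : R × R} : w ∈ HH p a b ↔ w.1 * b - w.2 * a ∈ p := Iff.rfl

/-- `(s,t) ↦ s v₁ + t v₂` -/
def lin2 {M : Type} [AddCommGroup M] [Module R M] (v₁ v₂ : M) : (R × R) →ₗ[R] M :=
  (LinearMap.toSpanSingleton R M v₁).coprod (LinearMap.toSpanSingleton R M v₂)

@[simp] lemma lin2_apply {M : Type} [AddCommGroup M] [Module R M] (v₁ v₂ : M) (w : R × R) :
    lin2 v₁ v₂ w = w.1 • v₁ + w.2 • v₂ := by simp [lin2]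

lemma range_lin2 (x y : R) : LinearMap.range (lin2 x y) = Ideal.span {x, y} := by
  ext r
  rw [Ideal.mem_span_pair]
  simp [LinearMap.mem_range]

lemma PD_prod_quot {n : ℕ} (p : Ideal R) (h : PD R n (R ⧸ p)) :
    PD R n ((R × R) ⧸ (Submodule.prod p p : Submodule R (R × R))) := by
  let φ : (R × R) →ₗ[R] (R ⧸ p) × (R ⧸ p) := LinearMap.prodMap p.mkQ p.mkQ
  have hk : LinearMap.ker φ = Submodule.prod p p := by
    rw [LinearMap.ker_prodMap, Submodule.ker_mkQ]
  have hs : Function.Surjective φ :=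
    Function.Surjective.prodMap p.mkQ_surjective p.mkQ_surjective
  rw [← hk]
  exact (h.prod h).congr (φ.quotKerEquivOfSurjective hs).symm

lemma HH_struct (p : Ideal R) [p.IsPrime] [UniqueFactorizationMonoid (R ⧸ p)] (a b : R)
    (hab : a ∉ p ∨ b ∉ p) : ∃ v : R × R, (v.1 ∉ p ∨ v.2 ∉ p) ∧
      HH p a b = (Submodule.prod p p : Submodule R (R × R)) ⊔
        LinearMap.range (LinearMap.toSpanSingleton R (R × R) v) := by
  have h : (Ideal.Quotient.mk p a) ≠ 0 ∨ (Ideal.Quotient.mk p b) ≠ 0 := by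
    simpa [Ideal.Quotient.eq_zero_iff_mem, Ne] using hab
  obtain ⟨a', b', g, h1, hg, h2, h3, h4, h5⟩ := ufd_prim _ _ h
  obtain ⟨a', rfl⟩ := Ideal.Quotient.mk_surjective a'
  obtain ⟨b', rfl⟩ := Ideal.Quotient.mk_surjective b'
  refine ⟨(a', b'), ?_, ?_⟩
  · simpa [Ideal.Quotient.eq_zero_iff_mem, Ne] using h4
  · apply le_antisymm
    · intro w hw
      rw [mem_HH, ← Ideal.Quotient.eq_zero_iff_mem, map_sub, sub_eq_zero, map_mul, map_mul] at hw
      obtain ⟨t, ht1, ht2⟩ := h5 _ _ hw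
      obtain ⟨t, rfl⟩ := Ideal.Quotient.mk_surjective t
      rw [← map_mul, Ideal.Quotient.eq] at ht1 ht2
      rw [Submodule.mem_sup]
      refine ⟨w - t • (a', b'), ?_, t • (a', b'), ⟨t, by simp⟩, by simp⟩
      exact ⟨ht1, ht2⟩
    · refine sup_le ?_ ?_
      · rintro w ⟨hw1, hw2⟩
        exact p.sub_mem (p.mul_mem_right _ hw1) (p.mul_mem_right _ hw2)
      · rintro _ ⟨t, rfl⟩
        rw [mem_HH, ← Ideal.Quotient.eq_zero_iff_mem]
        simp only [LinearMap.toSpanSingleton_apply, Prod.smul_mk, smul_eq_mul, map_sub, map_mul,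
          ← h2, ← h3]
        ring

lemma PD_HH {n : ℕ} (p : Ideal R) [hp : p.IsPrime] [UniqueFactorizationMonoid (R ⧸ p)] (a b : R)
    (hab : a ∉ p ∨ b ∉ p) (h : PD R n (R ⧸ p)) : PD R (n+1) ((R × R) ⧸ HH p a b) := by
  obtain ⟨v, hv, hv2⟩ := HH_struct p a b hab
  refine PD.tower' (Submodule.prod p p) _ (LinearMap.toSpanSingleton R (R × R) v) hv2.symm ?_
    ((PD_prod_quot p h).mono (by omega))
  have : Submodule.comap (LinearMap.toSpanSingleton R (R × R) v) (Submodule.prod p p) = p := by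
    ext t
    simp only [Submodule.mem_comap, LinearMap.toSpanSingleton_apply, Submodule.mem_prod,
      Prod.smul_fst, Prod.smul_snd, smul_eq_mul]
    constructor
    · rintro ⟨h1, h2⟩
      rcases hv with hv | hv
      · exact (hp.mem_or_mem h1).resolve_right hv
      · exact (hp.mem_or_mem h2).resolve_right hv
    · intro h
      exact ⟨p.mul_mem_right _ h, p.mul_mem_right _ h⟩
  rw [this]; exact h

lemma PD_two_vec {n : ℕ} (P : Ideal R) [hP : P.IsPrime] [UniqueFactorizationMonoid (R ⧸ P)]
    (v₁ v₂ : R × R) (h : PD R n (R ⧸ P)) :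
    PD R (n+2) ((R × R) ⧸ ((Submodule.prod P P : Submodule R (R × R)) ⊔
      LinearMap.range (lin2 (R := R) v₁ v₂))) := by
  refine PD.tower' (n := n+1) (Submodule.prod P P) _ (lin2 (R := R) v₁ v₂) rfl ?_
    ((PD_prod_quot P h).mono (by omega))
  have hmem : ∀ w : R × R, w ∈ Submodule.comap (lin2 (R := R) v₁ v₂) (Submodule.prod P P) ↔
      (w.1 * v₁.1 + w.2 * v₂.1 ∈ P) ∧ (w.1 * v₁.2 + w.2 * v₂.2 ∈ P) := by
    intro w; simp [Submodule.mem_prod]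
  by_cases hdet : v₁.1 * v₂.2 - v₁.2 * v₂.1 ∈ P
  · by_cases hr0 : v₁.1 ∈ P ∧ v₂.1 ∈ P
    · by_cases hr1 : v₁.2 ∈ P ∧ v₂.2 ∈ P
      · have : Submodule.comap (lin2 (R := R) v₁ v₂) (Submodule.prod P P) = ⊤ := by
          rw [eq_top_iff]; intro w _
          rw [hmem]
          exact ⟨P.add_mem (P.mul_mem_left _ hr0.1) (P.mul_mem_left _ hr0.2),
            P.add_mem (P.mul_mem_left _ hr1.1) (P.mul_mem_left _ hr1.2)⟩
        rw [this]
        have : Subsingleton ((R × R) ⧸ (⊤ : Submodule R (R × R))) :=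
          Submodule.Quotient.subsingleton_iff.2 rfl
        exact PD.of_subsingleton _
      · have : Submodule.comap (lin2 (R := R) v₁ v₂) (Submodule.prod P P)
          = HH P (- v₂.2) v₁.2 := by
          ext w
          rw [hmem, mem_HH]
          have e : w.1 * v₁.2 - w.2 * (-v₂.2) = w.1 * v₁.2 + w.2 * v₂.2 := by ring
          rw [e]
          exact ⟨fun h => h.2, fun h => ⟨P.add_mem (P.mul_mem_left _ hr0.1) (P.mul_mem_left _ hr0.2), h⟩⟩
        rw [this]
        refine PD_HH P _ _ ?_ h
        rw [neg_mem_iff]; tauto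
    · have : Submodule.comap (lin2 (R := R) v₁ v₂) (Submodule.prod P P)
          = HH P (- v₂.1) v₁.1 := by
        ext w
        rw [hmem, mem_HH]
        have e : w.1 * v₁.1 - w.2 * (-v₂.1) = w.1 * v₁.1 + w.2 * v₂.1 := by ring
        rw [e]
        refine ⟨fun h => h.1, fun h => ⟨h, ?_⟩⟩
        have h1 : v₁.1 * (w.1 * v₁.2 + w.2 * v₂.2) ∈ P := by
          have := P.add_mem (P.mul_mem_left v₁.2 h) (P.mul_mem_left w.2 hdet)
          convert this using 1; ring
        have h2 : v₂.1 * (w.1 * v₁.2 + w.2 * v₂.2) ∈ P := by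
          have := P.sub_mem (P.mul_mem_left v₂.2 h) (P.mul_mem_left w.1 hdet)
          convert this using 1; ring
        by_contra hc
        exact hr0 ⟨(hP.mem_or_mem h1).resolve_right hc, (hP.mem_or_mem h2).resolve_right hc⟩
      rw [this]
      refine PD_HH P _ _ ?_ h
      rw [neg_mem_iff]; tauto
  · have : Submodule.comap (lin2 (R := R) v₁ v₂) (Submodule.prod P P) = Submodule.prod P P := by
      ext w
      rw [hmem, Submodule.mem_prod]
      refine ⟨fun ⟨h1, h2⟩ => ⟨?_, ?_⟩, fun ⟨h1, h2⟩ => ⟨P.add_mem (P.mul_mem_right _ h1) (P.mul_mem_right _ h2), P.add_mem (P.mul_mem_right _ h1) (P.mul_mem_right _ h2)⟩⟩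
      · have : w.1 * (v₁.1 * v₂.2 - v₁.2 * v₂.1) ∈ P := by
          have := P.sub_mem (P.mul_mem_left v₂.2 h1) (P.mul_mem_left v₂.1 h2)
          convert this using 1; ring
        exact (hP.mem_or_mem this).resolve_right hdet
      · have : w.2 * (v₁.1 * v₂.2 - v₁.2 * v₂.1) ∈ P := by
          have := P.sub_mem (P.mul_mem_left v₁.1 h2) (P.mul_mem_left v₁.2 h1)
          convert this using 1; ring
        exact (hP.mem_or_mem this).resolve_right hdet
    rw [this]
    exact (PD_prod_quot P h).mono (by omega)

/-- key lemma, height three case -/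
lemma PD_HH_inf {n : ℕ} (p₁ p₂ : Ideal R) [p₁.IsPrime] [p₂.IsPrime] [(p₁ ⊔ p₂).IsPrime]
    [UniqueFactorizationMonoid (R ⧸ p₁)] [UniqueFactorizationMonoid (R ⧸ p₂)]
    [UniqueFactorizationMonoid (R ⧸ (p₁ ⊔ p₂))] (a b c d : R)
    (hab : a ∉ p₁ ∨ b ∉ p₁) (hcd : c ∉ p₂ ∨ d ∉ p₂)
    (h1 : PD R n (R ⧸ p₁)) (h2 : PD R n (R ⧸ p₂)) (h3 : PD R (n+1) (R ⧸ (p₁ ⊔ p₂))) :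
    PD R (n+2) ((R × R) ⧸ (HH p₁ a b ⊓ HH p₂ c d)) := by
  refine PD.inf _ _ ((PD_HH p₁ a b hab h1).mono (by omega))
    ((PD_HH p₂ c d hcd h2).mono (by omega)) ?_
  obtain ⟨v, -, hv⟩ := HH_struct p₁ a b hab
  obtain ⟨w, -, hw⟩ := HH_struct p₂ c d hcd
  have := PD_two_vec (p₁ ⊔ p₂) v w h3
  have e : LinearMap.range (lin2 (R := R) v w) =
      LinearMap.range (LinearMap.toSpanSingleton R (R × R) v) ⊔
        LinearMap.range (LinearMap.toSpanSingleton R (R × R) w) := by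
    rw [lin2, LinearMap.range_coprod]
  have eq : HH p₁ a b ⊔ HH p₂ c d = (Submodule.prod (p₁ ⊔ p₂) (p₁ ⊔ p₂) :
      Submodule R (R × R)) ⊔ LinearMap.range (lin2 (R := R) v w) := by
    rw [e, hv, hw, ← Submodule.prod_sup_prod]
    exact sup_sup_sup_comm _ _ _ _
  rw [eq]; exact this

/-- structure of a primary ideal of multiplicity two -/
structure KS (p K : Ideal R) (x y a b : R) : Prop where
  hp : p = Ideal.span {x, y}
  le : K ≤ p
  sq : p * p ≤ K
  ab : a ∉ p ∨ b ∉ p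
  iff : ∀ u v, u * x + v * y ∈ K ↔ u * b - v * a ∈ p

lemma KS_of_primary (p K : Ideal R) (x y : R) (hp : p = Ideal.span {x, y})
    (hK : K.IsPrimary) (hrad : K.radical = p) (hsq : p * p ≤ K) (hne : K ≠ p)
    (hnle : ¬ K ≤ p * p) : ∃ a b, KS p K x y a b := by
  have hle : K ≤ p := hrad ▸ Ideal.le_radical
  have hx : x ∈ p := by rw [hp]; exact Ideal.subset_span (by simp)
  have hy : y ∈ p := by rw [hp]; exact Ideal.subset_span (by simp)
  obtain ⟨q, hq, hq2⟩ := Set.not_subset.1 hnle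
  have hqp := hle hq
  rw [hp, Ideal.mem_span_pair] at hqp
  obtain ⟨a, b, rfl⟩ := hqp
  have hab : a ∉ p ∨ b ∉ p := by
    by_contra hc
    push Not at hc
    exact hq2 (Ideal.add_mem _ (Ideal.mul_mem_mul hc.1 hx) (Ideal.mul_mem_mul hc.2 hy))
  have hprim : ∀ r s, r * s ∈ K → r ∉ p → s ∈ K := by
    intro r s hrs hr
    rcases (Ideal.isPrimary_iff.1 hK).2 (x := s) (y := r) (by rwa [mul_comm]) with h | h
    · exact h
    · exact absurd (hrad ▸ h) hr
  refine ⟨a, b, hp, hle, hsq, hab, ?_⟩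
  intro u v
  constructor
  · intro huv
    by_contra hc
    have h1 : (u * b - v * a) * y ∈ K := by
      have := K.sub_mem (K.mul_mem_left u hq) (K.mul_mem_left a huv)
      convert this using 1; ring
    have h2 : (u * b - v * a) * x ∈ K := by
      have := K.sub_mem (K.mul_mem_left b huv) (K.mul_mem_left v hq)
      convert this using 1; ring
    have h1' := hprim _ _ h1 hc
    have h2' := hprim _ _ h2 hc
    apply hne
    apply le_antisymm hle
    rw [hp, Ideal.span_le]
    rintro t (rfl | rfl)
    · exact h2'
    · exact h1'
  · intro h
    have h1 : a * (u * x + v * y) ∈ K := by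
      have := K.sub_mem (K.mul_mem_left u hq) (hsq (Ideal.mul_mem_mul h hy))
      convert this using 1; ring
    have h2 : b * (u * x + v * y) ∈ K := by
      have := K.add_mem (K.mul_mem_left v hq) (hsq (Ideal.mul_mem_mul h hx))
      convert this using 1; ring
    rcases hab with hc | hc
    · exact hprim _ _ h1 hc
    · exact hprim _ _ h2 hc

namespace KS
variable {p K : Ideal R} {x y a b : R}

lemma hx (h : KS p K x y a b) : x ∈ p := by rw [h.hp]; exact Ideal.subset_span (by simp)
lemma hy (h : KS p K x y a b) : y ∈ p := by rw [h.hp]; exact Ideal.subset_span (by simp)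

lemma q_mem (h : KS p K x y a b) : a * x + b * y ∈ K :=
  (h.iff a b).2 (by rw [mul_comm, sub_self]; exact p.zero_mem)

lemma comap_eq (h : KS p K x y a b) : Submodule.comap (lin2 (R := R) x y) K = HH p a b := by
  ext w
  rw [mem_HH, ← h.iff]
  simp

lemma pd (h : KS p K x y a b) [p.IsPrime] [UniqueFactorizationMonoid (R ⧸ p)] {n : ℕ}
    (hn : PD R n (R ⧸ p)) : PD R (n+1) (R ⧸ K) := by
  refine PD.tower (R := R) (M := R) K p (lin2 (R := R) x y) ?_ ?_ (hn.mono (by omega))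
  · rw [range_lin2, ← h.hp]; exact sup_eq_right.2 h.le
  · rw [h.comap_eq]; exact PD_HH p a b h.ab hn
end KS

lemma inf_eq_D0 (x y z : R) (hp : (Ideal.span {x, z} : Ideal R).IsPrime)
    (hy : y ∉ (Ideal.span {x, z} : Ideal R)) :
    (Ideal.span {x, y} ⊓ Ideal.span {x, z} : Ideal R) = Ideal.span {x, y * z} := by
  apply le_antisymm
  · rintro r ⟨h1, h2⟩
    obtain ⟨u, v, rfl⟩ := Ideal.mem_span_pair.1 h1
    have h3 : v * y ∈ (Ideal.span {x, z} : Ideal R) := by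
      have := Ideal.sub_mem _ h2 (Ideal.mul_mem_left _ u (Ideal.subset_span (show x ∈ ({x, z} : Set R) by simp)))
      simpa using this
    obtain ⟨s, t, hst⟩ := Ideal.mem_span_pair.1 ((hp.mem_or_mem h3).resolve_right hy)
    exact Ideal.mem_span_pair.2 ⟨u + s * y, t, by rw [← hst]; ring⟩
  · rw [Ideal.span_le]
    rintro t (rfl | rfl)
    · exact ⟨Ideal.subset_span (by simp), Ideal.subset_span (by simp)⟩
    · exact ⟨Ideal.mul_mem_right _ _ (Ideal.subset_span (by simp)),
        Ideal.mul_mem_left _ _ (Ideal.subset_span (by simp))⟩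

/-- case A, height three -/
lemma caseA3 (p₁ p₂ K₁ K₂ : Ideal R) [p₁.IsPrime] [hp2 : p₂.IsPrime] [(p₁ ⊔ p₂).IsPrime]
    [UniqueFactorizationMonoid (R ⧸ p₁)] [UniqueFactorizationMonoid (R ⧸ p₂)]
    [UniqueFactorizationMonoid (R ⧸ (p₁ ⊔ p₂))] (x y z a b c d : R)
    (h1 : PD R 2 (R ⧸ p₁)) (h2 : PD R 2 (R ⧸ p₂)) (h3 : PD R 3 (R ⧸ (p₁ ⊔ p₂)))
    (hD : PD R 2 (R ⧸ (Ideal.span {x, y * z} : Ideal R)))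
    (k1 : KS p₁ K₁ x y a b) (k2 : KS p₂ K₂ x z c d) (hz : z ∉ p₁) (hy : y ∉ p₂) :
    PD R 4 (R ⧸ (K₁ ⊓ K₂)) := by
  have hD0 : p₁ ⊓ p₂ = Ideal.span {x, y * z} := by
    rw [k1.hp, k2.hp]; apply inf_eq_D0
    · rw [← k2.hp]; exact hp2
    · rw [← k2.hp]; exact hy
  refine PD.tower (R := R) (M := R) (K₁ ⊓ K₂) (Ideal.span {x, y * z}) (lin2 (R := R) x (y * z)) ?_ ?_
    (hD.mono (by omega))
  · rw [range_lin2, ← hD0]; exact sup_eq_right.2 (inf_le_inf k1.le k2.le)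
  · have : Submodule.comap (lin2 (R := R) x (y * z)) (K₁ ⊓ K₂) =
        HH p₁ (z * a) b ⊓ HH p₂ (y * c) d := by
      ext w
      rw [Submodule.mem_comap, Submodule.mem_inf, Submodule.mem_inf, mem_HH, mem_HH, lin2_apply]
      have e1 : w.1 • x + w.2 • (y * z) = w.1 * x + (w.2 * z) * y := by
        simp only [smul_eq_mul]; ring
      have e2 : w.1 • x + w.2 • (y * z) = w.1 * x + (w.2 * y) * z := by
        simp only [smul_eq_mul]; ring
      nth_rw 1 [e1]
      rw [e2, k1.iff, k2.iff, mul_assoc, mul_assoc]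
    rw [this]
    refine PD_HH_inf p₁ p₂ _ _ _ _ ?_ ?_ h1 h2 h3
    · rcases k1.ab with h | h
      · left; exact fun hc => (Ideal.IsPrime.mem_or_mem ‹_› hc).elim hz h
      · right; exact h
    · rcases k2.ab with h | h
      · left; exact fun hc => (Ideal.IsPrime.mem_or_mem ‹_› hc).elim hy h
      · right; exact h

end

end

section

section
variable {R : Type} [CommRing R]

lemma mem_colon' {C K : Ideal R} {g : R} : g ∈ C.colon (K : Set R) ↔ ∀ k ∈ K, g * k ∈ C := by
  simp [Submodule.mem_colon]

lemma PD_map {M N : Type} [AddCommGroup M] [Module R M] [AddCommGroup N] [Module R N] {n : ℕ}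
    (φ : M →ₗ[R] N) (S T : Submodule R M) (hT : LinearMap.ker φ = T) :
    PD R n (S.map φ) ↔ PD R n (S ⧸ T.comap S.subtype) := by
  have e := (φ.domRestrict S).quotKerEquivRange
  have h1 : LinearMap.range (φ.domRestrict S) = S.map φ := LinearMap.range_domRestrict S φ
  have h2 : LinearMap.ker (φ.domRestrict S) = T.comap S.subtype := by
    rw [← hT]; exact LinearMap.ker_domRestrict S φ
  rw [h1, h2] at e
  exact ⟨fun h => h.congr e.symm, fun h => h.congr e⟩

/-- dual of `K/D₀²` -/
def HD (D₀ K : Ideal R) (x w : R) : Submodule R (R × R) where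
  carrier := {st | ∀ α β, α * x + β * w ∈ K → α * st.1 + β * st.2 ∈ D₀}
  add_mem' := by
    intro s t hs ht α β h
    have := D₀.add_mem (hs α β h) (ht α β h)
    simp only [Prod.fst_add, Prod.snd_add]
    convert this using 1; ring
  zero_mem' := by intro α β _; simp
  smul_mem' := by
    intro c s hs α β h
    have := D₀.mul_mem_left c (hs α β h)
    simp only [Prod.smul_fst, Prod.smul_snd, smul_eq_mul]
    convert this using 1; ring

lemma mem_HD {D₀ K : Ideal R} {x w : R} {st : R × R} : st ∈ HD D₀ K x w ↔
    ∀ α β, α * x + β * w ∈ K → α * st.1 + β * st.2 ∈ D₀ := Iff.rfl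

lemma linkage [IsDomain R] {n : ℕ} (hn : 2 ≤ n) (x w f₁ f₂ : R) (hx : Prime x) (hw : ¬ x ∣ w)
    (hf : ∀ u v, u * f₁ = v * f₂ → ∃ t, u = t * f₂ ∧ v = t * f₁)
    (hfx : ¬ (x ∣ f₁ ∧ x ∣ f₂)) (K : Ideal R)
    (hsq : (Ideal.span {x, w} : Ideal R) * Ideal.span {x, w} ≤ K) (hle : K ≤ Ideal.span {x, w})
    (h1K : f₁ ∈ K) (h2K : f₂ ∈ K)
    (hC : PD R 2 (R ⧸ (Ideal.span {f₁, f₂} : Ideal R)))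
    (hD : PD R 2 (R ⧸ (Ideal.span {x, w} : Ideal R)))
    (hH : PD R (n+1) ((R × R) ⧸ HD (Ideal.span {x, w}) K x w)) :
    PD R (n+1) (R ⧸ ((Ideal.span {f₁, f₂} : Ideal R).colon (K : Set R) : Ideal R)) := by
  set C : Ideal R := Ideal.span {f₁, f₂} with hCdef
  set D₀ : Ideal R := Ideal.span {x, w} with hDdef
  have hx0 : x ≠ 0 := hx.ne_zero
  have hxD : x ∈ D₀ := Ideal.subset_span (by simp)
  have hwD : w ∈ D₀ := Ideal.subset_span (by simp)
  have hxw : ∀ u v, u * w = v * x → ∃ t, u = t * x ∧ v = t * w := by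
    intro u v h
    have : x ∣ u * w := ⟨v, by rw [h]; ring⟩
    obtain ⟨t, ht⟩ := (hx.dvd_or_dvd this).resolve_right hw
    refine ⟨t, by rw [ht]; ring, ?_⟩
    apply mul_right_cancel₀ hx0
    rw [← h, ht]; ring
  obtain ⟨a11, a12, ha1⟩ := Ideal.mem_span_pair.1 (hle h1K)
  obtain ⟨a21, a22, ha2⟩ := Ideal.mem_span_pair.1 (hle h2K)
  set δ := a11 * a22 - a12 * a21 with hδ
  have hCm : ∀ u v, u * f₁ + v * f₂ ∈ C := fun u v => Ideal.mem_span_pair.2 ⟨u, v, rfl⟩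
  -- F1
  have F1 : ∀ g, g * δ ∈ C ↔ g ∈ D₀ := by
    intro g
    constructor
    · intro h
      obtain ⟨r1, r2, hr⟩ := Ideal.mem_span_pair.1 h
      have e1 : (g * a22 - r1 * x) * f₁ = (g * a12 + r2 * x) * f₂ := by
        have : g * δ * x = g * (a22 * f₁ - a12 * f₂) := by rw [← ha1, ← ha2, hδ]; ring
        rw [← hr] at this
        linear_combination (-1 : R) * this
      obtain ⟨s, hs1, hs2⟩ := hf _ _ e1
      have e2 : (g - s * w) * a22 = (r1 + s * a21) * x := by
        rw [← ha2] at hs1; linear_combination hs1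
      have e3 : (g - s * w) * a12 = (s * a11 - r2) * x := by
        rw [← ha1] at hs2; linear_combination hs2
      have : x ∣ g - s * w := by
        by_contra hc
        apply hfx
        have d1 := (hx.dvd_or_dvd (show x ∣ (g - s * w) * a22 from ⟨r1 + s * a21, by rw [e2]; ring⟩)).resolve_left hc
        have d2 := (hx.dvd_or_dvd (show x ∣ (g - s * w) * a12 from ⟨s * a11 - r2, by rw [e3]; ring⟩)).resolve_left hc
        rw [← ha1, ← ha2]
        exact ⟨dvd_add (dvd_mul_left _ _) (d2.mul_right _), dvd_add (dvd_mul_left _ _) (d1.mul_right _)⟩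
      obtain ⟨t, ht⟩ := this
      exact Ideal.mem_span_pair.2 ⟨t, s, by linear_combination (-1 : R) * ht⟩
    · intro h
      obtain ⟨u, v, rfl⟩ := Ideal.mem_span_pair.1 h
      have := hCm (u * a22 - v * a21) (v * a11 - u * a12)
      convert this using 1
      rw [← ha1, ← ha2, hδ]; ring
  -- F2
  have F2 : ∀ g, g * x ∈ C → g * w ∈ C → ∃ t, g - t * δ ∈ C := by
    intro g hg1 hg2
    obtain ⟨r1, r2, hr⟩ := Ideal.mem_span_pair.1 hg1
    obtain ⟨s1, s2, hs⟩ := Ideal.mem_span_pair.1 hg2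
    have e1 : (r1 * w - s1 * x) * f₁ = (s2 * x - r2 * w) * f₂ := by
      linear_combination w * hr - x * hs
    obtain ⟨t, ht1, ht2⟩ := hf _ _ e1
    obtain ⟨e, he, -⟩ := hxw (r1 - t * a22) (s1 + t * a21) (by
      rw [← ha2] at ht1; linear_combination ht1)
    obtain ⟨e', he', -⟩ := hxw (r2 + t * a12) (s2 - t * a11) (by
      rw [← ha1] at ht2; linear_combination - ht2)
    refine ⟨t, ?_⟩
    convert hCm e e' using 1
    apply mul_right_cancel₀ hx0
    have e1 : r1 = e * x + t * a22 := by linear_combination he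
    have e2 : r2 = e' * x - t * a12 := by linear_combination he'
    have e3 : g * x = r1 * f₁ + r2 * f₂ := hr.symm
    rw [sub_mul, e3, e1, e2, hδ]
    rw [← ha1, ← ha2]; ring
  have hcolδ : C.colon (Ideal.span {δ} : Set R) = D₀ := by
    ext g; rw [← comap_toSpan]; simp [F1]
  have hcolD : (C.colon (D₀ : Set R) : Ideal R) = C ⊔ Ideal.span {δ} := by
    ext g
    rw [mem_colon', Submodule.mem_sup]
    constructor
    · intro h
      obtain ⟨t, ht⟩ := F2 g (h x hxD) (h w hwD)
      exact ⟨_, ht, t * δ, Ideal.mem_span_singleton'.2 ⟨t, rfl⟩, by ring⟩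
    · rintro ⟨c, hc, d, hd, rfl⟩ k hk
      obtain ⟨t, rfl⟩ := Ideal.mem_span_singleton'.1 hd
      rw [add_mul]
      refine C.add_mem (C.mul_mem_right _ hc) ?_
      rw [mul_comm t, mul_assoc, mul_comm]
      exact (F1 _).2 (D₀.mul_mem_left _ hk)
  have hPD1 : PD R 3 (R ⧸ (C.colon (D₀ : Set R) : Ideal R)) := by
    rw [hcolD]
    exact PD.colon' C δ (by rw [hcolδ]; exact hD) (hC.mono (by omega))
  set L : Ideal R := C.colon (K : Set R) with hL
  have hLle : (C.colon (D₀ : Set R) : Ideal R) ≤ L := by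
    intro g hg; rw [hL, mem_colon']; rw [mem_colon'] at hg
    exact fun k hk => hg k (hle hk)
  refine PD.tower' (R := R) (M := R) (N := L) (C.colon (D₀ : Set R)) L L.subtype
    (by rw [Submodule.range_subtype]; exact sup_eq_right.2 hLle) ?_ (hPD1.mono (by omega))
  let φ : R →ₗ[R] (R ⧸ C) × (R ⧸ C) :=
    (C.mkQ.comp (LinearMap.toSpanSingleton R R x)).prod (C.mkQ.comp (LinearMap.toSpanSingleton R R w))
  let χ : R × R →ₗ[R] (R ⧸ C) × (R ⧸ C) :=
    LinearMap.prodMap (C.mkQ.comp (LinearMap.toSpanSingleton R R δ))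
      (C.mkQ.comp (LinearMap.toSpanSingleton R R δ))
  have hφ : ∀ g, φ g = (C.mkQ (g * x), C.mkQ (g * w)) := fun g => rfl
  have hχ : ∀ s, χ s = (C.mkQ (s.1 * δ), C.mkQ (s.2 * δ)) := fun g => rfl
  have hmk : ∀ g, C.mkQ g = 0 ↔ g ∈ C := fun g => Submodule.Quotient.mk_eq_zero _
  have kφ : LinearMap.ker φ = C.colon (D₀ : Set R) := by
    ext g
    rw [LinearMap.mem_ker, hφ, Prod.mk_eq_zero, hmk, hmk, mem_colon']
    constructor
    · rintro ⟨h1, h2⟩ k hk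
      obtain ⟨u, v, rfl⟩ := Ideal.mem_span_pair.1 hk
      have := C.add_mem (C.mul_mem_left u h1) (C.mul_mem_left v h2)
      convert this using 1; ring
    · intro h; exact ⟨h x hxD, h w hwD⟩
  have kχ : LinearMap.ker χ = Submodule.prod D₀ D₀ := by
    ext s
    rw [LinearMap.mem_ker, hχ, Prod.mk_eq_zero, hmk, hmk, F1, F1, Submodule.mem_prod]
  have himg : Submodule.map φ L = Submodule.map χ (HD D₀ K x w) := by
    apply le_antisymm
    · rintro _ ⟨g, hg, rfl⟩
      have hg' := mem_colon'.1 hg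
      obtain ⟨s, hs⟩ := F2 (g * x) (by rw [mul_assoc]; exact hg' _ (hsq (Ideal.mul_mem_mul hxD hxD)))
        (by rw [mul_assoc]; exact hg' _ (hsq (Ideal.mul_mem_mul hxD hwD)))
      obtain ⟨t, ht⟩ := F2 (g * w) (by rw [mul_assoc]; exact hg' _ (hsq (Ideal.mul_mem_mul hwD hxD)))
        (by rw [mul_assoc]; exact hg' _ (hsq (Ideal.mul_mem_mul hwD hwD)))
      refine ⟨(s, t), ?_, ?_⟩
      · intro α β h
        rw [← F1]
        have h3 := C.sub_mem (hg' _ h) (C.add_mem (C.mul_mem_left α hs) (C.mul_mem_left β ht))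
        convert h3 using 1; ring
      · rw [hφ, hχ]
        refine Prod.ext ?_ ?_
        · symm; rw [← sub_eq_zero, ← map_sub, hmk]; exact hs
        · symm; rw [← sub_eq_zero, ← map_sub, hmk]; exact ht
    · rintro _ ⟨⟨s, t⟩, hst, rfl⟩
      have hr2 : a11 * s + a12 * t ∈ D₀ := hst a11 a12 (by rw [ha1]; exact h1K)
      have hr1 : a21 * s + a22 * t ∈ D₀ := hst a21 a22 (by rw [ha2]; exact h2K)
      obtain ⟨r11, r12, h1⟩ := Ideal.mem_span_pair.1 hr1
      obtain ⟨r21, r22, h2⟩ := Ideal.mem_span_pair.1 hr2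
      obtain ⟨g, hg1, hg2⟩ := hxw (s * δ + r12 * f₁ - r22 * f₂) (t * δ - r11 * f₁ + r21 * f₂) (by
        have : w * (s * δ) - x * (t * δ) = - (a21 * s + a22 * t) * f₁ + (a11 * s + a12 * t) * f₂ := by
          rw [← ha1, ← ha2, hδ]; ring
        rw [← h1, ← h2] at this
        linear_combination this)
      have c1 : g * x - s * δ ∈ C := by
        rw [← hg1]; convert hCm r12 (-r22) using 1; ring
      have c2 : g * w - t * δ ∈ C := by
        rw [← hg2]; convert hCm (-r11) r21 using 1; ring
      refine ⟨g, ?_, ?_⟩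
      · rw [SetLike.mem_coe, hL, mem_colon']
        intro k hk
        obtain ⟨α, β, rfl⟩ := Ideal.mem_span_pair.1 (hle hk)
        have h3 := (F1 _).2 (hst α β hk)
        have := C.add_mem h3 (C.add_mem (C.mul_mem_left α c1) (C.mul_mem_left β c2))
        convert this using 1; simp only; ring
      · rw [hφ, hχ]
        refine Prod.ext ?_ ?_
        · rw [← sub_eq_zero, ← map_sub, hmk]; exact c1
        · rw [← sub_eq_zero, ← map_sub, hmk]; exact c2
  rw [← PD_map φ L _ kφ, himg, PD_map χ _ _ kχ]
  have hDH : (Submodule.prod D₀ D₀ : Submodule R (R × R)) ≤ HD D₀ K x w := by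
    rintro s ⟨h1, h2⟩ α β _
    exact D₀.add_mem (D₀.mul_mem_left _ h1) (D₀.mul_mem_left _ h2)
  have hsup : (Submodule.prod D₀ D₀ : Submodule R (R × R)) ⊔ LinearMap.range (HD D₀ K x w).subtype =
      HD D₀ K x w := by rw [Submodule.range_subtype]; exact sup_eq_right.2 hDH
  have hex := tower_exact _ _ (HD D₀ K x w).subtype hDH hsup
  exact PD.left _ _ hex.1 (Submodule.factor_surjective hDH) hex.2
    ((PD_prod_quot D₀ hD).mono hn) hH


lemma HD_eq_HH {p K : Ideal R} [hp : p.IsPrime] {x y a b : R} (k : KS p K x y a b) :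
    HD p K x y = HH p (-b) a := by
  ext ⟨s, t⟩
  rw [mem_HD, mem_HH]
  simp only
  constructor
  · intro h
    have := h a b k.q_mem
    convert this using 1; ring
  · intro h α β hαβ
    rw [k.iff] at hαβ
    have h1 : b * (α * s + β * t) ∈ p := by
      have := p.add_mem (p.mul_mem_left s hαβ) (p.mul_mem_left β h)
      convert this using 1; ring
    have h2 : a * (α * s + β * t) ∈ p := by
      have := p.sub_mem (p.mul_mem_left α h) (p.mul_mem_left t hαβ)
      convert this using 1; ring
    rcases k.ab with hc | hc
    · exact (hp.mem_or_mem h2).resolve_left hc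
    · exact (hp.mem_or_mem h1).resolve_left hc

/-- projective dimension of `C : K₁` -/
lemma linkage_one [IsDomain R] (x y f₁ f₂ : R) (hx : Prime x) (hy : ¬ x ∣ y)
    (hf : ∀ u v, u * f₁ = v * f₂ → ∃ t, u = t * f₂ ∧ v = t * f₁)
    (hfx : ¬ (x ∣ f₁ ∧ x ∣ f₂)) (p K : Ideal R) [p.IsPrime] [UniqueFactorizationMonoid (R ⧸ p)]
    (a b : R) (k : KS p K x y a b) (h1K : f₁ ∈ K) (h2K : f₂ ∈ K)
    (hC : PD R 2 (R ⧸ (Ideal.span {f₁, f₂} : Ideal R))) (hp : PD R 2 (R ⧸ p)) :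
    PD R 3 (R ⧸ ((Ideal.span {f₁, f₂} : Ideal R).colon (K : Set R) : Ideal R)) := by
  refine linkage (n := 2) le_rfl x y f₁ f₂ hx hy hf hfx K ?_ ?_ h1K h2K hC ?_ ?_
  · rw [← k.hp]; exact k.sq
  · rw [← k.hp]; exact k.le
  · rw [← k.hp]; exact hp
  · rw [← k.hp, HD_eq_HH k]
    refine PD_HH p _ _ ?_ hp
    rw [neg_mem_iff]; exact k.ab.symm

/-- case B, height three -/
lemma caseB3 [IsDomain R] (p₁ p₂ K₁ K₂ : Ideal R) [hp1 : p₁.IsPrime] [hp2 : p₂.IsPrime] [(p₁ ⊔ p₂).IsPrime]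
    [UniqueFactorizationMonoid (R ⧸ p₁)] [UniqueFactorizationMonoid (R ⧸ p₂)]
    [UniqueFactorizationMonoid (R ⧸ (p₁ ⊔ p₂))] (x y z a b c d f₁ f₂ : R)
    (h1 : PD R 2 (R ⧸ p₁)) (h2 : PD R 2 (R ⧸ p₂)) (h3 : PD R 3 (R ⧸ (p₁ ⊔ p₂)))
    (hD : PD R 2 (R ⧸ (Ideal.span {x, y * z} : Ideal R)))
    (k1 : KS p₁ K₁ x y a b) (k2 : KS p₂ K₂ x z c d) (hz : z ∉ p₁) (hy : y ∉ p₂)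
    (hx : Prime x) (hxy : ¬ x ∣ y * z)
    (hf : ∀ u v, u * f₁ = v * f₂ → ∃ t, u = t * f₂ ∧ v = t * f₁)
    (hfx : ¬ (x ∣ f₁ ∧ x ∣ f₂)) (h1K : f₁ ∈ K₁ ⊓ K₂) (h2K : f₂ ∈ K₁ ⊓ K₂)
    (hC : PD R 2 (R ⧸ (Ideal.span {f₁, f₂} : Ideal R))) :
    PD R 4 (R ⧸ ((Ideal.span {f₁, f₂} : Ideal R).colon ((K₁ ⊓ K₂ : Ideal R) : Set R) : Ideal R)) := by
  have hD0 : p₁ ⊓ p₂ = Ideal.span {x, y * z} := by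
    rw [k1.hp, k2.hp]; apply inf_eq_D0
    · rw [← k2.hp]; exact hp2
    · rw [← k2.hp]; exact hy
  have hmemK : ∀ α β, α * x + β * (y * z) ∈ K₁ ⊓ K₂ ↔
      (α * b - β * z * a ∈ p₁ ∧ α * d - β * y * c ∈ p₂) := by
    intro α β
    rw [← k1.iff, ← k2.iff, Submodule.mem_inf]
    have e1 : α * x + β * (y * z) = α * x + β * z * y := by ring
    have e2 : α * x + β * (y * z) = α * x + β * y * z := by ring
    nth_rw 1 [e1]; rw [e2]
  refine linkage (n := 3) (by omega) x (y * z) f₁ f₂ hx hxy hf hfx (K₁ ⊓ K₂) ?_ ?_ h1K h2K hC hD ?_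
  · rw [← hD0]
    exact le_inf ((Ideal.mul_mono inf_le_left inf_le_left).trans k1.sq)
      ((Ideal.mul_mono inf_le_right inf_le_right).trans k2.sq)
  · rw [← hD0]; exact inf_le_inf k1.le k2.le
  · have : HD (Ideal.span {x, y * z}) (K₁ ⊓ K₂) x (y * z) =
        HH p₁ (-b) (z * a) ⊓ HH p₂ (-d) (y * c) := by
      have hz2 : z ∈ p₂ := k2.hy
      have hy1 : y ∈ p₁ := k1.hy
      ext ⟨s, t⟩
      rw [mem_HD, Submodule.mem_inf, mem_HH, mem_HH, ← hD0]
      simp only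
      constructor
      · intro h
        constructor
        · have : z * (z * a) * s + z * b * t ∈ p₁ := (h (z * (z * a)) (z * b) ((hmemK _ _).2 ⟨by
            convert p₁.zero_mem using 1; ring, by
            convert p₂.mul_mem_left (z * a * d - b * y * c) hz2 using 1; ring⟩)).1
          have h' : z * (s * (z * a) - t * (-b)) ∈ p₁ := by convert this using 1; ring
          exact (hp1.mem_or_mem h').resolve_left hz
        · have : y * (y * c) * s + y * d * t ∈ p₂ := (h (y * (y * c)) (y * d) ((hmemK _ _).2 ⟨by
            convert p₁.mul_mem_left (y * c * b - d * z * a) hy1 using 1; ring, by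
            convert p₂.zero_mem using 1; ring⟩)).2
          have h' : y * (s * (y * c) - t * (-d)) ∈ p₂ := by convert this using 1; ring
          exact (hp2.mem_or_mem h').resolve_left hy
      · rintro ⟨e1, e2⟩ α β hαβ
        obtain ⟨g1, g2⟩ := (hmemK _ _).1 hαβ
        constructor
        · have h1 : b * (α * s + β * t) ∈ p₁ := by
            have := p₁.add_mem (p₁.mul_mem_left s g1) (p₁.mul_mem_left β e1)
            convert this using 1; ring
          have h2 : a * (z * (α * s + β * t)) ∈ p₁ := by
            have := p₁.sub_mem (p₁.mul_mem_left α e1) (p₁.mul_mem_left t g1)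
            convert this using 1; ring
          rcases k1.ab with hc | hc
          · exact (hp1.mem_or_mem ((hp1.mem_or_mem h2).resolve_left hc)).resolve_left hz
          · exact (hp1.mem_or_mem h1).resolve_left hc
        · have h1 : d * (α * s + β * t) ∈ p₂ := by
            have := p₂.add_mem (p₂.mul_mem_left s g2) (p₂.mul_mem_left β e2)
            convert this using 1; ring
          have h2 : c * (y * (α * s + β * t)) ∈ p₂ := by
            have := p₂.sub_mem (p₂.mul_mem_left α e2) (p₂.mul_mem_left t g2)
            convert this using 1; ring
          rcases k2.ab with hc | hc
          · exact (hp2.mem_or_mem ((hp2.mem_or_mem h2).resolve_left hc)).resolve_left hy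
          · exact (hp2.mem_or_mem h1).resolve_left hc
    rw [this]
    refine PD_HH_inf p₁ p₂ _ _ _ _ ?_ ?_ h1 h2 h3
    · rw [neg_mem_iff]
      rcases k1.ab with h | h
      · right; exact fun hc => (hp1.mem_or_mem hc).elim hz h
      · left; exact h
    · rw [neg_mem_iff]
      rcases k2.ab with h | h
      · right; exact fun hc => (hp2.mem_or_mem hc).elim hy h
      · left; exact h

end

end

section

section
variable {R : Type} [CommRing R]
open RingTheory.Sequence CategoryTheory.Abelian
open scoped Pointwise

lemma isSMulRegular_ideal_iff (I : Ideal R) (l : List R) (hl : Ideal.ofList l = I) (r : R) :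
    IsSMulRegular (R ⧸ (Ideal.ofList l • ⊤ : Submodule R R)) r ↔ ∀ s, s * r ∈ I → s ∈ I := by
  have e : (Ideal.ofList l • ⊤ : Submodule R R) = I := by rw [hl]; simp
  rw [e]
  rw [isSMulRegular_iff_right_eq_zero_of_smul]
  have key : ∀ s : R, r • (Submodule.Quotient.mk s : R ⧸ I) = 0 ↔ s * r ∈ I := by
    intro s
    rw [← Submodule.Quotient.mk_smul, Submodule.Quotient.mk_eq_zero, smul_eq_mul, mul_comm]
  constructor
  · intro h s hs
    exact (Submodule.Quotient.mk_eq_zero _).1 (h _ ((key s).2 hs))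
  · intro h m hm
    obtain ⟨s, rfl⟩ := Submodule.Quotient.mk_surjective I m
    exact (Submodule.Quotient.mk_eq_zero _).2 (h s ((key s).1 hm))

lemma ext_quot_vanish (N M : ModuleCat.{0} R) (f : R) (hf : IsSMulRegular M f) (n : ℕ)
    (h : ∀ i < n + 1, Subsingleton (Ext N M i)) :
    ∀ i < n, Subsingleton (Ext N (ModuleCat.of R (QuotSMulTop f M)) i) := by
  intro i hi
  have zero1 := AddCommGrpCat.isZero_of_iff_subsingleton.mpr (h i (by omega))
  have zero2 := AddCommGrpCat.isZero_of_iff_subsingleton.mpr (h (i + 1) (by omega))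
  exact AddCommGrpCat.subsingleton_of_isZero <| ShortComplex.Exact.isZero_of_both_zeros
    ((Ext.covariant_sequence_exact₃' N hf.smulShortComplex_shortExact) i (i + 1) rfl)
    (zero1.eq_zero_of_src _) (zero2.eq_zero_of_tgt _)

lemma ofList_two (a b : R) : Ideal.ofList [a, b] = Ideal.span {a, b} := by
  rw [Ideal.ofList]
  congr 1; ext; simp

lemma exists_reg_two [IsNoetherianRing R] (f₁ f₂ x y z w : R) (J : Ideal R) (hJ : J ≠ ⊤)
    (hf₁ : ∀ s, s * f₁ = 0 → s = 0)
    (hf₂ : ∀ s, s * f₂ ∈ Ideal.span {f₁} → s ∈ Ideal.span {f₁})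
    (h₁J : f₁ ∈ J) (h₂J : f₂ ∈ J)
    (hx : ∀ s, s * x = 0 → s = 0)
    (hy : ∀ s, s * y ∈ Ideal.ofList [x] → s ∈ Ideal.ofList [x])
    (hz : ∀ s, s * z ∈ Ideal.ofList [x, y] → s ∈ Ideal.ofList [x, y])
    (hw : ∀ s, s * w ∈ Ideal.ofList [x, y, z] → s ∈ Ideal.ofList [x, y, z])
    (hr : ∀ r ∈ [x, y, z, w], r ∈ J.radical) :
    ∃ h₁ ∈ J, ∃ h₂ ∈ J, (∀ s, s * h₁ ∈ Ideal.span {f₁, f₂} → s ∈ Ideal.span {f₁, f₂}) ∧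
      (∀ s, s * h₂ ∈ Ideal.span {f₁, f₂} ⊔ Ideal.span {h₁} →
        s ∈ Ideal.span {f₁, f₂} ⊔ Ideal.span {h₁}) := by
  have hsm : ∀ (I : Ideal R), I ≠ ⊤ → (I • (⊤ : Submodule R R)) < ⊤ := by
    intro I hI; rw [smul_eq_mul, Ideal.mul_top]; exact lt_top_iff_ne_top.2 hI
  have hrJ : J.radical ≠ ⊤ := by rwa [Ne, Ideal.radical_eq_top]
  have wreg : IsWeaklyRegular R [x, y, z, w] := by
    constructor
    intro i hi
    simp at hi
    interval_cases i
    · exact (isSMulRegular_ideal_iff ⊥ _ (by simp) _).2 (by simpa using hx)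
    · exact (isSMulRegular_ideal_iff _ _ rfl _).2 hy
    · exact (isSMulRegular_ideal_iff _ _ rfl _).2 hz
    · exact (isSMulRegular_ideal_iff _ _ rfl _).2 hw
  have reg : IsRegular R [x, y, z, w] := by
    refine ⟨wreg, ?_⟩
    refine ne_of_gt (hsm _ ?_)
    intro h
    apply hrJ
    rw [eq_top_iff, ← h]
    exact Ideal.span_le.2 hr
  have suppJ : Module.support R (R ⧸ J) = PrimeSpectrum.zeroLocus J := by
    rw [Module.support_eq_zeroLocus, Ideal.annihilator_quotient]
  have ext4 := ModuleCat.subsingleton_ext_of_exists_isRegular J.radical (ModuleCat.of R (R ⧸ J))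
    (by change Module.support R (R ⧸ J) ⊆ _
        rw [suppJ, PrimeSpectrum.zeroLocus_radical]) (ModuleCat.of R R) (hsm _ hrJ)
    [x, y, z, w] hr reg
  have r1 : IsSMulRegular R f₁ := by
    rw [isSMulRegular_iff_right_eq_zero_of_smul]
    intro m hm; apply hf₁; rw [mul_comm]; exact hm
  have r12 : IsWeaklyRegular R [f₁, f₂] := by
    constructor
    intro i hi
    simp at hi
    interval_cases i
    · exact (isSMulRegular_ideal_iff ⊥ _ (by simp) _).2 (by simpa using hf₁)
    · exact (isSMulRegular_ideal_iff _ _ (by simp [Ideal.ofList]) _).2 hf₂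
  rw [isWeaklyRegular_cons_iff, isWeaklyRegular_cons_iff] at r12
  have ext3 := ext_quot_vanish _ _ f₁ r12.1 3 ext4
  have ext2 := ext_quot_vanish _ _ f₂ r12.2.1 2 ext3
  have q1 : J • (⊤ : Submodule R (QuotSMulTop f₂ (QuotSMulTop f₁ R))) < ⊤ := by
    rw [lt_top_iff_ne_top]
    intro h
    let g : R →ₗ[R] (R ⧸ J) := J.mkQ
    have k1 : f₁ • (⊤ : Submodule R R) ≤ LinearMap.ker g := by
      intro t ht
      obtain ⟨s, -, rfl⟩ := (Submodule.mem_smul_pointwise_iff_exists _ _ _).1 ht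
      simp only [g, Submodule.ker_mkQ, smul_eq_mul]
      exact J.mul_mem_right _ h₁J
    let g1 : QuotSMulTop f₁ R →ₗ[R] (R ⧸ J) := Submodule.liftQ _ g k1
    have k2 : f₂ • (⊤ : Submodule R (QuotSMulTop f₁ R)) ≤ LinearMap.ker g1 := by
      intro t ht
      obtain ⟨s, -, rfl⟩ := (Submodule.mem_smul_pointwise_iff_exists _ _ _).1 ht
      obtain ⟨s, rfl⟩ := Submodule.mkQ_surjective _ s
      rw [LinearMap.mem_ker, map_smul]
      simp only [g1, Submodule.mkQ_apply, Submodule.liftQ_apply, g]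
      rw [← Submodule.Quotient.mk_smul, Submodule.Quotient.mk_eq_zero]
      exact J.mul_mem_right _ h₂J
    let g2 : QuotSMulTop f₂ (QuotSMulTop f₁ R) →ₗ[R] (R ⧸ J) := Submodule.liftQ _ g1 k2
    have hs : Function.Surjective g2 := by
      intro t
      obtain ⟨s, rfl⟩ := Submodule.mkQ_surjective _ t
      exact ⟨Submodule.mkQ _ (Submodule.mkQ _ s), rfl⟩
    have hm := congrArg (Submodule.map g2) h
    rw [Submodule.map_smul'', Submodule.map_top, LinearMap.range_eq_top.2 hs] at hm
    have h0 : J • (⊤ : Submodule R (R ⧸ J)) = ⊥ := by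
      rw [eq_bot_iff, Submodule.smul_le]
      intro r hr n _
      obtain ⟨s, rfl⟩ := Submodule.mkQ_surjective _ n
      rw [← map_smul]
      exact (Submodule.Quotient.mk_eq_zero _).2 (J.mul_mem_right _ hr)
    rw [h0] at hm
    have : Subsingleton (R ⧸ J) := (Submodule.subsingleton_iff R).1 (subsingleton_of_bot_eq_top hm)
    exact hJ (Ideal.Quotient.subsingleton_iff.1 this)
  obtain ⟨rs, hlen, hmem, hreg⟩ := ModuleCat.exists_isRegular_of_exists_subsingleton_ext J 2
    (ModuleCat.of R (QuotSMulTop f₂ (QuotSMulTop f₁ R))) q1 (ModuleCat.of R (R ⧸ J)) suppJ ext2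
  obtain ⟨h₁, h₂, rfl⟩ := List.length_eq_two.1 hlen
  have fin : IsWeaklyRegular R [f₁, f₂, h₁, h₂] := by
    rw [isWeaklyRegular_cons_iff, isWeaklyRegular_cons_iff]
    exact ⟨r12.1, r12.2.1, hreg.1⟩
  refine ⟨h₁, hmem _ (by simp), h₂, hmem _ (by simp), ?_, ?_⟩
  · exact (isSMulRegular_ideal_iff _ _ (ofList_two f₁ f₂) _).1 (fin.1 2 (by simp))
  · refine (isSMulRegular_ideal_iff _ [f₁, f₂, h₁] ?_ _).1 (fin.1 3 (by simp))
    have : [f₁, f₂, h₁] = [f₁, f₂] ++ [h₁] := rfl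
    rw [this, Ideal.ofList_append, ofList_two, Ideal.ofList_singleton]

lemma colon_decomp (C K₁ K₂ : Ideal R) (h₁ h₂ : R) (m₁ : h₁ ∈ K₁ ⊔ K₂) (m₂ : h₂ ∈ K₁ ⊔ K₂)
    (r₁ : ∀ s, s * h₁ ∈ C → s ∈ C)
    (r₂ : ∀ s, s * h₂ ∈ C ⊔ Ideal.span {h₁} → s ∈ C ⊔ Ideal.span {h₁}) :
    C.colon ((K₁ ⊓ K₂ : Ideal R) : Set R) = C.colon (K₁ : Set R) ⊔ C.colon (K₂ : Set R) ∧
    C.colon (K₁ : Set R) ⊓ C.colon (K₂ : Set R) = C := by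
  obtain ⟨a₁, ha₁, b₁, hb₁, e1⟩ := Submodule.mem_sup.1 m₁
  obtain ⟨a₂, ha₂, b₂, hb₂, e2⟩ := Submodule.mem_sup.1 m₂
  constructor
  · apply le_antisymm
    · intro g hg
      rw [mem_colon'] at hg
      have hab : ∀ α ∈ K₁, ∀ β ∈ K₂, g * (α * β) ∈ C := fun α hα β hβ =>
        hg _ ⟨K₁.mul_mem_right _ hα, K₂.mul_mem_left _ hβ⟩
      have : g * a₁ ∈ C ⊔ Ideal.span {h₁} := by
        apply r₂
        have h3 : g * a₁ * h₂ = g * a₂ * h₁ + (g * (a₁ * b₂) - g * (a₂ * b₁)) := by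
          rw [← e1, ← e2]; ring
        rw [h3]
        refine Ideal.add_mem _ (Ideal.mul_mem_left _ _ (Ideal.mem_sup_right
          (Ideal.mem_span_singleton_self _))) (Ideal.mem_sup_left ?_)
        exact C.sub_mem (hab _ ha₁ _ hb₂) (hab _ ha₂ _ hb₁)
      obtain ⟨c, hc, t, ht, e3⟩ := Submodule.mem_sup.1 this
      obtain ⟨g₁, rfl⟩ := Ideal.mem_span_singleton'.1 ht
      have key : ∀ α ∈ K₁, ∀ β ∈ K₂, g * α - (α + β) * g₁ ∈ C := by
        intro α hα β hβ
        apply r₁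
        have : (g * α - (α + β) * g₁) * h₁ =
            (g * (α * b₁) - g * (a₁ * β)) + (α + β) * c := by
          have e4 : g₁ * h₁ = g * a₁ - c := by rw [← e3]; ring
          calc _ = g * α * h₁ - (α + β) * (g₁ * h₁) := by ring
            _ = _ := by rw [e4, ← e1]; ring
        rw [this]
        exact C.add_mem (C.sub_mem (hab _ hα _ hb₁) (hab _ ha₁ _ hβ)) (C.mul_mem_left _ hc)
      refine Submodule.mem_sup.2 ⟨g - g₁, ?_, g₁, ?_, by ring⟩
      · rw [mem_colon']
        intro α hα
        have := key α hα 0 K₂.zero_mem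
        convert this using 1; ring
      · rw [mem_colon']
        intro β hβ
        have := C.neg_mem (key 0 K₁.zero_mem β hβ)
        convert this using 1; ring
    · refine sup_le ?_ ?_ <;> intro g hg <;> rw [mem_colon'] at hg ⊢
      · exact fun k hk => hg k hk.1
      · exact fun k hk => hg k hk.2
  · apply le_antisymm
    · rintro g ⟨h, h'⟩
      have h : g ∈ C.colon (K₁ : Set R) := h
      have h' : g ∈ C.colon (K₂ : Set R) := h'
      rw [mem_colon'] at h h'
      apply r₁
      rw [← e1, mul_add]
      exact C.add_mem (h _ ha₁) (h' _ hb₁)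
    · intro g hg
      refine ⟨?_, ?_⟩ <;> change g ∈ C.colon _ <;> rw [mem_colon'] <;>
        exact fun k _ => C.mul_mem_right _ hg

lemma caseB4 [IsNoetherianRing R] (f₁ f₂ x y z w : R) (K₁ K₂ : Ideal R) (hJ : K₁ ⊔ K₂ ≠ ⊤)
    (hf₁ : ∀ s, s * f₁ = 0 → s = 0)
    (hf₂ : ∀ s, s * f₂ ∈ Ideal.span {f₁} → s ∈ Ideal.span {f₁})
    (h₁J : f₁ ∈ K₁ ⊔ K₂) (h₂J : f₂ ∈ K₁ ⊔ K₂)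
    (hx : ∀ s, s * x = 0 → s = 0)
    (hy : ∀ s, s * y ∈ Ideal.ofList [x] → s ∈ Ideal.ofList [x])
    (hz : ∀ s, s * z ∈ Ideal.ofList [x, y] → s ∈ Ideal.ofList [x, y])
    (hw : ∀ s, s * w ∈ Ideal.ofList [x, y, z] → s ∈ Ideal.ofList [x, y, z])
    (hr : ∀ r ∈ [x, y, z, w], r ∈ (K₁ ⊔ K₂).radical)
    (hC : PD R 2 (R ⧸ (Ideal.span {f₁, f₂} : Ideal R)))
    (hL₁ : PD R 3 (R ⧸ ((Ideal.span {f₁, f₂} : Ideal R).colon (K₁ : Set R) : Ideal R)))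
    (hL₂ : PD R 3 (R ⧸ ((Ideal.span {f₁, f₂} : Ideal R).colon (K₂ : Set R) : Ideal R))) :
    PD R 3 (R ⧸ ((Ideal.span {f₁, f₂} : Ideal R).colon ((K₁ ⊓ K₂ : Ideal R) : Set R) : Ideal R)) := by
  obtain ⟨h₁, m₁, h₂, m₂, r₁, r₂⟩ := exists_reg_two f₁ f₂ x y z w (K₁ ⊔ K₂) hJ hf₁ hf₂ h₁J h₂J
    hx hy hz hw hr
  obtain ⟨e1, e2⟩ := colon_decomp (Ideal.span {f₁, f₂}) K₁ K₂ h₁ h₂ m₁ m₂ r₁ r₂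
  rw [e1]
  refine PD.sup _ _ hL₁ hL₂ ?_
  rw [e2]; exact hC
end

end

section

section
open Polynomial

lemma dvd_of_basis {A S : Type} [CommRing A] [CommRing S] [Algebra A S] {ι : Type}
    (b : Module.Basis ι A S) (a : A) (w : S) (h : ∀ i, a ∣ b.repr w i) : ∃ w', w = a • w' := by
  classical
  choose c hc using h
  refine ⟨b.repr.symm ((b.repr w).mapRange (fun t => if t = 0 then 0 else
    Classical.epsilon (fun u => t = a * u)) (by simp)), ?_⟩
  apply b.repr.injective
  ext i
  rw [map_smul]
  simp only [LinearEquiv.apply_symm_apply, Finsupp.smul_apply, Finsupp.mapRange_apply, smul_eq_mul]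
  split_ifs with h0
  · simp [h0]
  · exact Classical.epsilon_spec (p := fun u => b.repr w i = a * u) ⟨c i, hc i⟩

lemma unmixed_core {A : Type} [CommRing A] [IsDomain A] [IsNoetherianRing A]
    [UniqueFactorizationMonoid A] (F G : A[X]) (hF : F.Monic)
    (hFG : ∀ s, s * G ∈ Ideal.span {F} → s ∈ Ideal.span {F})
    (T : Ideal A[X]) (hFT : F ∈ T)
    (hT : ∀ P : Ideal A[X], P.IsPrime → T ≤ P → ¬ P.height ≤ 2) :
    ∃ h ∈ T, ∀ s, s * h ∈ Ideal.span {F, G} → s ∈ Ideal.span {F, G} := by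
  have := hF.free_adjoinRoot
  have := hF.finite_adjoinRoot
  let S := AdjoinRoot F
  let mk : A[X] →+* S := AdjoinRoot.mk F
  have hmk : ∀ p, mk p = 0 ↔ p ∈ Ideal.span {F} := fun p => by
    rw [Ideal.mem_span_singleton]; exact AdjoinRoot.mk_eq_zero
  have hsurj : Function.Surjective mk := AdjoinRoot.mk_surjective
  have halg : ∀ a : A, mk (Polynomial.C a) = algebraMap A S a := fun a => by
    rw [AdjoinRoot.algebraMap_eq]; rfl
  have hGnzd : ∀ {s : S}, s * mk G = 0 → s = 0 := by
    intro s hs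
    obtain ⟨p, rfl⟩ := hsurj s
    rw [← map_mul, hmk] at hs
    exact (hmk _).2 (hFG _ hs)
  have : Algebra.IsIntegral A S := Algebra.IsIntegral.of_finite A S
  -- Δ
  obtain ⟨q, hq, hq0⟩ := Algebra.IsIntegral.isIntegral (R := A) (mk G)
  obtain ⟨i, hi, hi'⟩ := Ideal.exists_coeff_ne_zero_mem_comap_of_non_zero_divisor_root_mem
    (f := algebraMap A S) (I := Ideal.span {mk G}) hGnzd (Ideal.mem_span_singleton_self _)
    hq.ne_zero hq0
  set Δ := q.coeff i with hΔ
  obtain ⟨e, he⟩ := Ideal.mem_span_singleton'.1 (Ideal.mem_comap.1 hi')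
  -- avoidance
  have key : ∀ π : A, Prime π → ¬ T.comap (Polynomial.C : A →+* A[X]) ≤ Ideal.span {π} := by
    intro π hπ hle
    have : (Ideal.span {π}).IsPrime := (Ideal.span_singleton_prime hπ.ne_zero).2 hπ
    have hc : (T.map mk).comap mk = T := by
      rw [Ideal.comap_map_of_surjective _ hsurj]
      apply sup_eq_left.2
      intro p hp
      rw [Ideal.mem_comap, Ideal.mem_bot, hmk] at hp
      exact (Ideal.span_singleton_le_iff_mem _).2 hFT hp
    obtain ⟨Q, hQT, hQp, hQc⟩ := Ideal.exists_ideal_over_prime_of_isIntegral (Ideal.span {π})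
      (T.map mk) (by
        intro a ha
        apply hle
        rw [Ideal.mem_comap, ← hc, Ideal.mem_comap, halg]
        exact ha)
    have hTP : T ≤ Q.comap mk := by rw [← hc]; exact Ideal.comap_mono hQT
    refine hT (Q.comap mk) inferInstance hTP ?_
    classical
    refine (Ideal.height_le_card_of_mem_minimalPrimes_span_finset (s := {Polynomial.C π, F}) ?_).trans ?_
    · refine ⟨⟨inferInstance, ?_⟩, ?_⟩
      · rw [Ideal.span_le]
        intro t ht
        simp only [Finset.coe_insert, Finset.coe_singleton, Set.mem_insert_iff,
          Set.mem_singleton_iff] at ht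
        rcases ht with rfl | rfl
        · change mk (Polynomial.C π) ∈ Q
          rw [halg]
          change π ∈ Q.comap (algebraMap A S)
          rw [hQc]; exact Ideal.mem_span_singleton_self _
        · exact hTP hFT
      · rintro P ⟨hPp, hP⟩ hPQ
        have hπP : Polynomial.C π ∈ P := hP (Ideal.subset_span (by simp))
        have hFP : F ∈ P := hP (Ideal.subset_span (by simp))
        have hPc : (P.map mk).comap mk = P := by
          rw [Ideal.comap_map_of_surjective _ hsurj]
          apply sup_eq_left.2
          intro p hp
          rw [Ideal.mem_comap, Ideal.mem_bot, hmk] at hp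
          exact (Ideal.span_singleton_le_iff_mem _).2 hFP hp
        have : (P.map mk).IsPrime := by
          refine Ideal.map_isPrime_of_surjective hsurj ?_
          intro p hp
          rw [RingHom.mem_ker, hmk] at hp
          exact (Ideal.span_singleton_le_iff_mem _).2 hFP hp
        have hle' : P.map mk ≤ Q := Ideal.map_le_iff_le_comap.2 hPQ
        rcases hle'.lt_or_eq with hlt | heq
        · exfalso
          have := Ideal.IsIntegral.comap_lt_comap (R := A) hlt
          rw [hQc] at this
          refine this.not_ge ?_
          rw [Ideal.span_singleton_le_iff_mem, Ideal.mem_comap, ← halg]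
          exact Ideal.mem_map_of_mem _ hπP
        · rw [← heq, hPc]
    · have := Finset.card_le_two (a := Polynomial.C π) (b := F)
      exact_mod_cast this
  classical
  have hav : ∃ h ∈ T.comap (Polynomial.C : A →+* A[X]), ∀ π, Prime π → π ∣ Δ → ¬ π ∣ h := by
    let s : Finset A := (UniqueFactorizationMonoid.factors Δ).toFinset
    have hs : ∀ π ∈ s, Prime π := fun π hπ =>
      UniqueFactorizationMonoid.prime_of_factor _ (Multiset.mem_toFinset.1 hπ)
    by_contra hcon
    push Not at hcon
    have := (Ideal.subset_union_prime (s := s) (f := fun π : A => Ideal.span {π}) 0 0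
      (fun π hπ _ _ => (Ideal.span_singleton_prime (hs π hπ).ne_zero).2 (hs π hπ))
      (I := T.comap (Polynomial.C : A →+* A[X]))).1 (by
        intro h hh
        obtain ⟨π, hπ, hπΔ, hπh⟩ := hcon h hh
        obtain ⟨π', hπ', ha⟩ := UniqueFactorizationMonoid.exists_mem_factors_of_dvd hi
          hπ.irreducible hπΔ
        simp only [Set.mem_iUnion]
        refine ⟨π', Multiset.mem_toFinset.2 hπ', ?_⟩
        exact Ideal.mem_span_singleton.2 (ha.symm.dvd.trans hπh))
    obtain ⟨π, hπ, hle⟩ := this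
    exact key π (hs π hπ) hle
  obtain ⟨h, hhT, hh⟩ := hav
  refine ⟨Polynomial.C h, hhT, ?_⟩
  have hmem : ∀ s, s ∈ Ideal.span {F, G} ↔ ∃ w, mk s = w * mk G := by
    intro s
    rw [Ideal.mem_span_pair]
    constructor
    · rintro ⟨a, b, rfl⟩
      refine ⟨mk b, ?_⟩
      have : mk F = 0 := (hmk F).2 (Ideal.mem_span_singleton_self _)
      simp [this]
    · rintro ⟨w, hw⟩
      obtain ⟨b, rfl⟩ := hsurj w
      rw [← map_mul, ← sub_eq_zero, ← map_sub, hmk] at hw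
      obtain ⟨a, ha⟩ := Ideal.mem_span_singleton'.1 hw
      exact ⟨a, b, by rw [ha]; ring⟩
  intro s hs
  by_cases hu : IsUnit Δ
  · rw [hmem]
    obtain ⟨v, hv⟩ := hu.exists_left_inv
    refine ⟨mk s * algebraMap A S v * e, ?_⟩
    rw [mul_assoc, he, mul_assoc, ← map_mul, hv, map_one, mul_one]
  have hh0 : h ≠ 0 := by
    rintro rfl
    obtain ⟨π, hπ, hd⟩ := WfDvdMonoid.exists_irreducible_factor hu hi
    exact hh π hπ.prime hd (dvd_zero _)
  rw [hmem] at hs ⊢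
  obtain ⟨w, hw⟩ := hs
  rw [map_mul, halg] at hw
  have e1 : h • (mk s * e) = Δ • w := by
    rw [Algebra.smul_def, Algebra.smul_def, ← he]
    calc _ = (mk s * algebraMap A S h) * e := by ring
      _ = _ := by rw [hw]; ring
  let b := Module.Free.chooseBasis A S
  have hd : ∀ i, h ∣ b.repr w i := by
    intro i
    have := congrArg (fun t => b.repr t i) e1
    simp only [map_smul, Finsupp.smul_apply, smul_eq_mul] at this
    refine UniqueFactorizationMonoid.dvd_of_dvd_mul_left_of_no_prime_factors (b := b.repr w i) (c := Δ) hh0 ?_ ?_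
    · intro d hd1 hd2 hd3
      exact hh d hd3 hd2 hd1
    · rw [mul_comm, ← this]; exact dvd_mul_right _ _
  obtain ⟨w', rfl⟩ := dvd_of_basis b h w hd
  refine ⟨w', ?_⟩
  have e2 : h • (mk s - w' * mk G) = 0 := by
    rw [smul_sub, sub_eq_zero, Algebra.smul_def, mul_comm, hw, Algebra.smul_def, Algebra.smul_def]; ring
  have e3 : mk s - w' * mk G = 0 := by
    apply b.repr.injective
    ext i
    have := congrArg (fun t => b.repr t i) e2
    simp only [map_smul, Finsupp.smul_apply, smul_eq_mul, map_zero, Finsupp.zero_apply] at this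
    simpa using (mul_eq_zero.1 this).resolve_left hh0
  exact sub_eq_zero.1 e3
end
section
open Polynomial MvPolynomial Ideal Nat RingHom List
variable {k : Type*} [Field k] {n : ℕ} (f : MvPolynomial (Fin (n + 1)) k)
variable (v w : Fin (n + 1) →₀ ℕ)

namespace MyNN

section equivT


variable {f v} in
lemma lt_up (vlt : ∀ i, v i < (2 + f.totalDegree)) : ∀ l ∈ ofFn v, l < (2 + f.totalDegree) := by
  grind


/-- We construct an algebra map `T1 f c` which maps `X_i` into `X_i + c • X_0 ^ r_i` when `i ≠ 0`
and `X_0` to `X_0`. -/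
noncomputable abbrev T1 (c : k) :
    MvPolynomial (Fin (n + 1)) k →ₐ[k] MvPolynomial (Fin (n + 1)) k :=
  aeval fun i ↦ if i = 0 then X 0 else X i + c • X 0 ^ ((2 + f.totalDegree) ^ i.1)

lemma t1_comp_t1_neg (c : k) : (T1 f c).comp (T1 f (-c)) = AlgHom.id _ _ := by
  rw [comp_aeval, ← MvPolynomial.aeval_X_left]
  ext i v
  cases i using Fin.cases <;> simp

/-- `T1 f 1` leads to an algebra equiv `T f`. -/
noncomputable abbrev T := AlgEquiv.ofAlgHom (T1 f 1) (T1 f (-1))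
  (t1_comp_t1_neg f 1) (by simpa using t1_comp_t1_neg f (-1))

lemma sum_r_mul_ne (vlt : ∀ i, v i < (2 + f.totalDegree)) (wlt : ∀ i, w i < (2 + f.totalDegree)) (ne : v ≠ w) :
    ∑ x : Fin (n + 1), (2 + f.totalDegree) ^ x.1 * v x ≠ ∑ x : Fin (n + 1), (2 + f.totalDegree) ^ x.1 * w x := by
  intro h
  refine ne <| Finsupp.ext <| congrFun <| ofFn_inj.mp ?_
  apply ofDigits_inj_of_len_eq (Nat.lt_add_right f.totalDegree one_lt_two)
    (by simp) (lt_up vlt) (lt_up wlt)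
  simpa only [ofDigits_eq_sum_mapIdx, mapIdx_eq_ofFn, get_ofFn, length_ofFn,
    Fin.val_cast, mul_comm, sum_ofFn] using! h

lemma degreeOf_zero_t {a : k} (ha : a ≠ 0) : ((T f) (monomial v a)).degreeOf 0 =
    ∑ i : Fin (n + 1), ((2 + f.totalDegree) ^ i.1) * v i := by
  rw [← natDegree_finSuccEquiv, monomial_eq, Finsupp.prod_pow v fun a ↦ X a]
  simp only [Fin.prod_univ_succ, Fin.sum_univ_succ, map_mul, map_prod, map_pow,
    AlgEquiv.ofAlgHom_apply, MvPolynomial.aeval_C, MvPolynomial.aeval_X, if_pos, Fin.succ_ne_zero,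
    ite_false, one_smul, map_add, finSuccEquiv_X_zero, finSuccEquiv_X_succ, algebraMap_eq]
  have h (i : Fin n) :
      (Polynomial.C (X (R := k) i) + Polynomial.X ^ ((2 + f.totalDegree) ^ i.succ.1)) ^ v i.succ ≠ 0 :=
    pow_ne_zero (v i.succ) (leadingCoeff_ne_zero.mp <| by simp [add_comm, leadingCoeff_X_pow_add_C])
  rw [natDegree_mul (by simp [ha]) (mul_ne_zero (by simp) (Finset.prod_ne_zero_iff.mpr
    (fun i _ ↦ h i))), natDegree_mul (by simp) (Finset.prod_ne_zero_iff.mpr (fun i _ ↦ h i)),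
    natDegree_prod _ _ (fun i _ ↦ h i), natDegree_finSuccEquiv, degreeOf_C]
  simpa only [natDegree_pow, zero_add, natDegree_X, mul_one, Fin.val_zero, pow_zero, one_mul,
    add_right_inj] using Finset.sum_congr rfl (fun i _ ↦ by
    rw [add_comm (Polynomial.C _), natDegree_X_pow_add_C, mul_comm])

/-- `T` maps different monomials of `f` to polynomials with different degrees in `X_0`. -/
lemma degreeOf_t_ne_of_ne (hv : v ∈ f.support) (hw : w ∈ f.support) (ne : v ≠ w) :
    (T f <| monomial v <| coeff v f).degreeOf 0 ≠
    (T f <| monomial w <| coeff w f).degreeOf 0 := by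
  rw [degreeOf_zero_t _ _ <| mem_support_iff.mp hv, degreeOf_zero_t _ _ <| mem_support_iff.mp hw]
  refine sum_r_mul_ne f v w (fun i ↦ ?_) (fun i ↦ ?_) ne <;>
  exact lt_of_le_of_lt ((monomial_le_degreeOf i ‹_›).trans (degreeOf_le_totalDegree f i))
    (by lia)

lemma leadingCoeff_finSuccEquiv_t :
    (finSuccEquiv k n ((T f) ((monomial v) (coeff v f)))).leadingCoeff =
    algebraMap k _ (coeff v f) := by
  rw [monomial_eq, Finsupp.prod_fintype]
  · simp only [map_mul, map_prod, leadingCoeff_mul, leadingCoeff_prod]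
    rw [AlgEquiv.ofAlgHom_apply, algHom_C, algebraMap_eq, finSuccEquiv_apply,
      eval₂Hom_C, coe_comp]
    simp only [AlgEquiv.ofAlgHom_apply, Function.comp_apply, leadingCoeff_C, map_pow,
      leadingCoeff_pow, algebraMap_eq]
    have : ∀ j, ((finSuccEquiv k n) ((T1 f) 1 (X j))).leadingCoeff = 1 := fun j ↦ by
      by_cases h : j = 0
      · simp [h, finSuccEquiv_apply]
      · simp only [aeval_eq_bind₁, bind₁_X_right, if_neg h, one_smul, map_add, map_pow]
        obtain ⟨i, rfl⟩ := Fin.exists_succ_eq.mpr h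
        simp [finSuccEquiv_X_succ, finSuccEquiv_X_zero, add_comm]
    simp only [this, one_pow, Finset.prod_const_one, mul_one]
  exact fun i ↦ pow_zero _

/-- `T` maps `f` into some polynomial in `X_0` such that the leading coefficient is invertible. -/
lemma T_leadingcoeff_isUnit (fne : f ≠ 0) :
    IsUnit (finSuccEquiv k n (T f f)).leadingCoeff := by
  obtain ⟨v, vin, vs⟩ := Finset.exists_max_image f.support
    (fun v ↦ (T f ((monomial v) (coeff v f))).degreeOf 0) (support_nonempty.mpr fne)
  set h := fun w ↦ (MvPolynomial.monomial w) (coeff w f)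
  simp only [← natDegree_finSuccEquiv] at vs
  replace vs : ∀ x ∈ f.support \ {v}, (finSuccEquiv k n ((T f) (h x))).degree <
      (finSuccEquiv k n ((T f) (h v))).degree := by
    intro x hx
    obtain ⟨h1, h2⟩ := Finset.mem_sdiff.mp hx
    apply degree_lt_degree <| lt_of_le_of_ne (vs x h1) ?_
    simpa only [natDegree_finSuccEquiv]
      using degreeOf_t_ne_of_ne f _ _ h1 vin <| ne_of_not_mem_cons h2
  have coeff : (finSuccEquiv k n ((T f) (h v + ∑ x ∈ f.support \ {v}, h x))).leadingCoeff =
      (finSuccEquiv k n ((T f) (h v))).leadingCoeff := by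
    simp only [map_add, map_sum]
    rw [add_comm]
    apply leadingCoeff_add_of_degree_lt <| (lt_of_le_of_lt <| degree_sum_le _ _) ?_
    have h2 : h v ≠ 0 := by simpa [h] using mem_support_iff.mp vin
    replace h2 : (finSuccEquiv k n ((T f) (h v))) ≠ 0 := fun eq ↦ h2 <|
      by simpa only [map_eq_zero_iff _ (AlgEquiv.injective _)] using eq
    exact (Finset.sup_lt_iff <| Ne.bot_lt (fun x ↦ h2 <| degree_eq_bot.mp x)).mpr vs
  nth_rw 2 [← f.support_sum_monomial_coeff]
  rw [Finset.sum_eq_add_sum_sdiff_singleton_of_mem vin h]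
  rw [leadingCoeff_finSuccEquiv_t] at coeff
  simpa only [coeff, algebraMap_eq] using (mem_support_iff.mp vin).isUnit.map MvPolynomial.C

end equivT
end MyNN
end

section
lemma exists_monic_equiv {k : Type} [Field k] {n : ℕ} (f : MvPolynomial (Fin (n + 1)) k)
    (hf : f ≠ 0) : ∃ (e : MvPolynomial (Fin (n + 1)) k ≃+* Polynomial (MvPolynomial (Fin n) k))
      (c : MvPolynomial (Fin n) k), IsUnit c ∧ (Polynomial.C c * e f).Monic := by
  have hu := MyNN.T_leadingcoeff_isUnit f hf
  obtain ⟨c, hc⟩ := hu.exists_left_inv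
  refine ⟨((MyNN.T f).trans (MvPolynomial.finSuccEquiv k n)).toRingEquiv, c,
    IsUnit.of_mul_eq_one _ hc, ?_⟩
  rw [Polynomial.Monic, Polynomial.leadingCoeff_mul, Polynomial.leadingCoeff_C]
  exact hc

lemma unmixed_nzd {k : Type} [Field k] {n : ℕ} (f g : MvPolynomial (Fin (n + 1)) k)
    (hf : f ≠ 0) (hfg : ∀ s, s * g ∈ Ideal.span {f} → s ∈ Ideal.span {f})
    (T : Ideal (MvPolynomial (Fin (n + 1)) k)) (hfT : f ∈ T)
    (hT : ∀ P : Ideal (MvPolynomial (Fin (n + 1)) k), P.IsPrime → T ≤ P → ¬ P.height ≤ 2) :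
    ∃ h ∈ T, ∀ s, s * h ∈ Ideal.span {f, g} → s ∈ Ideal.span {f, g} := by
  obtain ⟨e, c, hc, hm⟩ := exists_monic_equiv f hf
  have hC : IsUnit (Polynomial.C c) := hc.map Polynomial.C
  set F := Polynomial.C c * e f with hF
  have hmap : ∀ (I : Ideal (MvPolynomial (Fin (n + 1)) k)) s,
      s ∈ I.comap (e.symm : _ →+* _) ↔ e.symm s ∈ I := fun I s => Iff.rfl
  have h1 : ∀ s, s ∈ Ideal.span {F} ↔ e.symm s ∈ Ideal.span {f} := by
    intro s
    rw [hF, Ideal.span_singleton_mul_left_unit hC, Ideal.mem_span_singleton,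
      Ideal.mem_span_singleton]
    constructor
    · rintro ⟨t, rfl⟩; exact ⟨e.symm t, by simp⟩
    · rintro ⟨t, ht⟩; exact ⟨e t, by rw [← map_mul, ← ht]; simp⟩
  have h2 : ∀ s, s ∈ Ideal.span {F, e g} ↔ e.symm s ∈ Ideal.span {f, g} := by
    intro s
    rw [Ideal.mem_span_pair, Ideal.mem_span_pair]
    obtain ⟨c', hc'⟩ := hC.exists_left_inv
    constructor
    · rintro ⟨a, b, rfl⟩
      exact ⟨e.symm (a * Polynomial.C c), e.symm b, by simp [hF, mul_assoc]⟩
    · rintro ⟨a, b, hab⟩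
      refine ⟨e a * c', e b, ?_⟩
      have : e (a * f + b * g) = s := by rw [hab]; simp
      rw [← this, hF, map_add, map_mul, map_mul]
      congr 1
      calc _ = e a * (c' * Polynomial.C c) * e f := by ring
        _ = _ := by rw [hc', mul_one]
  obtain ⟨h, hh, hs⟩ := unmixed_core F (e g) hm (by
      intro s hs
      rw [h1] at hs ⊢
      apply hfg
      simpa using hs) (T.comap (e.symm : _ →+* _)) (by
      change e.symm F ∈ T
      rw [hF, map_mul]
      apply T.mul_mem_left
      simpa using hfT) (by
      intro P hP hTP
      have := hT (P.comap (e : _ →+* _)) inferInstance (by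
        intro t ht
        apply hTP
        change e.symm (e t) ∈ T
        simpa using ht)
      rwa [show (P.comap (e : _ →+* _)) = P.comap e from rfl, RingEquiv.height_comap] at this)
  refine ⟨e.symm h, hh, ?_⟩
  intro s hs'
  have := hs (e s) (by rw [h2]; simpa using hs')
  rw [h2] at this
  simpa using this
end

end

section

section
variable {k : Type} [Field k] {N : ℕ}

def linBasis (k : Type) [Field k] (N : ℕ) :
    Module.Basis (Fin N) k (homogeneousSubmodule (Fin N) k 1) := by
  refine Module.Basis.mk (v := fun i => ⟨X i, isHomogeneous_X k i⟩) ?_ ?_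
  · have : LinearIndependent k (fun i : Fin N => (X i : MvPolynomial (Fin N) k)) :=
      MvPolynomial.linearIndependent_X _ k
    exact LinearIndependent.of_comp (homogeneousSubmodule (Fin N) k 1).subtype this
  · rintro ⟨f, hf⟩ -
    have h1 : f ∈ Submodule.span k (Set.range (X : Fin N → MvPolynomial (Fin N) k)) := by
      rw [← MvPolynomial.homogeneousSubmodule_one_eq_span_X]; exact hf
    have h2 : (Submodule.span k (Set.range (X : Fin N → MvPolynomial (Fin N) k))) =
        (Submodule.span k (Set.range (fun i => (⟨X i, isHomogeneous_X k i⟩ :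
          homogeneousSubmodule (Fin N) k 1)))).map (Submodule.subtype _) := by
      rw [Submodule.map_span, ← Set.range_comp]; rfl
    rw [h2] at h1
    obtain ⟨g, hg, hgf⟩ := h1
    have : g = ⟨f, hf⟩ := Subtype.ext hgf
    rw [← this]; exact hg

lemma linBasis_apply (i : Fin N) : ((linBasis k N i : homogeneousSubmodule (Fin N) k 1) :
    MvPolynomial (Fin N) k) = X i := by
  simp [linBasis]

lemma exists_coord {m : ℕ} (l : Fin m → MvPolynomial (Fin N) k)
    (hl : ∀ i, (l i).IsHomogeneous 1) (hli : LinearIndependent k l) :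
    ∃ (φ : MvPolynomial (Fin N) k ≃ₐ[k] MvPolynomial (Fin N) k) (ι : Fin m ↪ Fin N),
      (∀ i, φ (X (ι i)) = l i) ∧ (∀ d f, f.IsHomogeneous d → (φ f).IsHomogeneous d) ∧
      (∀ d f, f.IsHomogeneous d → (φ.symm f).IsHomogeneous d) := by
  let V := homogeneousSubmodule (Fin N) k 1
  let l' : Fin m → V := fun i => ⟨l i, hl i⟩
  have hli' : LinearIndependent k l' := LinearIndependent.of_comp V.subtype hli
  let b := Module.Basis.sumExtend hli'
  have hb : ∀ i, b (Sum.inl i) = l' i := by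
    intro i
    simp [b, Module.Basis.sumExtend]
    rfl
  let e := b.indexEquiv (linBasis k N)
  let b' := b.reindex e
  let T : V ≃ₗ[k] V := (linBasis k N).equiv b' (Equiv.refl _)
  let F : MvPolynomial (Fin N) k →ₐ[k] MvPolynomial (Fin N) k := aeval (fun j => (T (linBasis k N j) : MvPolynomial (Fin N) k))
  let G : MvPolynomial (Fin N) k →ₐ[k] MvPolynomial (Fin N) k := aeval (fun j => (T.symm (linBasis k N j) : MvPolynomial (Fin N) k))
  have hF : ∀ v : V, F (v : MvPolynomial (Fin N) k) = (T v : MvPolynomial (Fin N) k) := by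
    intro v
    have : F.toLinearMap ∘ₗ V.subtype = V.subtype ∘ₗ T.toLinearMap := by
      apply (linBasis k N).ext
      intro i
      simp only [LinearMap.comp_apply, Submodule.subtype_apply, linBasis_apply]
      simp [F]
    exact LinearMap.congr_fun this v
  have hG : ∀ v : V, G (v : MvPolynomial (Fin N) k) = (T.symm v : MvPolynomial (Fin N) k) := by
    intro v
    have : G.toLinearMap ∘ₗ V.subtype = V.subtype ∘ₗ T.symm.toLinearMap := by
      apply (linBasis k N).ext
      intro i
      simp only [LinearMap.comp_apply, Submodule.subtype_apply, linBasis_apply]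
      simp [G]
    exact LinearMap.congr_fun this v
  let φ : MvPolynomial (Fin N) k ≃ₐ[k] MvPolynomial (Fin N) k := AlgEquiv.ofAlgHom F G (by
      ext1 i
      rw [AlgHom.comp_apply, ← linBasis_apply, hG, hF]; simp) (by
      ext1 i
      rw [AlgHom.comp_apply, ← linBasis_apply, hF, hG]; simp)
  refine ⟨φ, ⟨fun i => e (Sum.inl i), fun i j h => by simpa using h⟩, ?_, ?_, ?_⟩
  · intro i
    change F (X (e (Sum.inl i))) = l i
    rw [← linBasis_apply, hF]
    simp [T, b', hb, l']
  · intro d f hf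
    have := hf.aeval (fun j => (T (linBasis k N j) : MvPolynomial (Fin N) k)) (n := 1) (fun i => (T (linBasis k N i)).2)
    rw [one_mul] at this
    exact this
  · intro d f hf
    have := hf.aeval (fun j => (T.symm (linBasis k N j) : MvPolynomial (Fin N) k)) (n := 1) (fun i => (T.symm (linBasis k N i)).2)
    rw [one_mul] at this
    exact this

/-- kill the variables in `s` -/
def killVars (s : Set (Fin N)) : MvPolynomial (Fin N) k →ₐ[k] MvPolynomial {i // i ∉ s} k := by
  classical
  exact aeval (fun i => if h : i ∈ s then 0 else X ⟨i, h⟩)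

lemma killVars_X_mem (s : Set (Fin N)) (i : Fin N) (h : i ∈ s) :
    killVars (k := k) s (X i) = 0 := by
  simp [killVars, h]

lemma killVars_X_not (s : Set (Fin N)) (i : Fin N) (h : i ∉ s) :
    killVars (k := k) s (X i) = X ⟨i, h⟩ := by
  simp [killVars, h]

lemma killVars_rename (s : Set (Fin N)) (f : MvPolynomial {i // i ∉ s} k) :
    killVars s (rename Subtype.val f) = f := by
  have : (killVars (k := k) s).comp (rename Subtype.val) = AlgHom.id k _ := by
    ext1 i
    simp [killVars_X_not s i.1 i.2]
  exact AlgHom.congr_fun this f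

lemma sub_kill_mem (s : Set (Fin N)) (f : MvPolynomial (Fin N) k) :
    f - rename Subtype.val (killVars s f) ∈ Ideal.span (X '' s : Set (MvPolynomial (Fin N) k)) := by
  rw [← Ideal.Quotient.eq_zero_iff_mem, map_sub, sub_eq_zero]
  let q := Ideal.Quotient.mkₐ k (Ideal.span (X '' s : Set (MvPolynomial (Fin N) k)))
  have : q = (q.comp (rename Subtype.val)).comp (killVars s) := by
    ext1 i
    by_cases h : i ∈ s
    · simp only [AlgHom.comp_apply, killVars_X_mem s i h, map_zero]
      exact Ideal.Quotient.eq_zero_iff_mem.2 (Ideal.subset_span ⟨i, h, rfl⟩)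
    · simp [AlgHom.comp_apply, killVars_X_not s i h]
  exact AlgHom.congr_fun this f

lemma ker_killVars (s : Set (Fin N)) :
    RingHom.ker (killVars (k := k) s) = Ideal.span (X '' s : Set (MvPolynomial (Fin N) k)) := by
  apply le_antisymm
  · intro f hf
    have := sub_kill_mem s f
    rw [RingHom.mem_ker] at hf
    simpa [hf] using this
  · rw [Ideal.span_le]
    rintro _ ⟨i, hi, rfl⟩
    exact killVars_X_mem s i hi

/-- linear independence data -/
structure LI {m : ℕ} (l : Fin m → MvPolynomial (Fin N) k) : Prop where
  hom : ∀ i, (l i).IsHomogeneous 1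
  li : LinearIndependent k l

lemma LI.exists_ker {m : ℕ} {l : Fin m → MvPolynomial (Fin N) k} (h : LI l) (A : Set (Fin m)) :
    ∃ (s : Set (Fin N)) (ψ : MvPolynomial (Fin N) k →ₐ[k] MvPolynomial {i // i ∉ s} k),
      Function.Surjective ψ ∧ RingHom.ker ψ = Ideal.span (l '' A) ∧
      (∀ i ∉ A, ψ (l i) ≠ 0) := by
  obtain ⟨φ, ι, h1, -, -⟩ := exists_coord l h.hom h.li
  have h2 : ∀ i, φ.symm (l i) = X (ι i) := fun i => by rw [← h1]; simp
  refine ⟨ι '' A, (killVars (ι '' A)).comp φ.symm.toAlgHom, ?_, ?_, ?_⟩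
  · intro f
    exact ⟨φ (rename Subtype.val f), by simp [killVars_rename]⟩
  · have : Ideal.span (l '' A) = (Ideal.span (X '' (ι '' A))).map (φ : MvPolynomial (Fin N) k →+* MvPolynomial (Fin N) k) := by
      rw [Ideal.map_span]
      congr 1
      rw [Set.image_image, Set.image_image]
      apply Set.image_congr
      intro i _
      exact (h1 i).symm
    rw [this, ← ker_killVars]
    ext f
    rw [RingHom.mem_ker, Ideal.mem_map_iff_of_surjective _ (show Function.Surjective (φ : MvPolynomial (Fin N) k →+* MvPolynomial (Fin N) k) from φ.surjective)]
    constructor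
    · intro hf
      exact ⟨φ.symm f, hf, by simp⟩
    · rintro ⟨g, hg, rfl⟩
      simpa using hg
  · intro i hi
    have : ι i ∉ ι '' A := by
      rintro ⟨j, hj, e⟩
      exact hi (ι.injective e ▸ hj)
    simp only [AlgHom.comp_apply, AlgEquiv.coe_toAlgHom, h2]
    rw [killVars_X_not _ _ this]
    exact X_ne_zero _

lemma LI.prime {m : ℕ} {l : Fin m → MvPolynomial (Fin N) k} (h : LI l) (A : Set (Fin m)) :
    (Ideal.span (l '' A)).IsPrime := by
  obtain ⟨s, ψ, h1, h2, -⟩ := h.exists_ker A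
  rw [← h2]; exact RingHom.ker_isPrime _

lemma LI.not_mem {m : ℕ} {l : Fin m → MvPolynomial (Fin N) k} (h : LI l) {A : Set (Fin m)}
    {i : Fin m} (hi : i ∉ A) : l i ∉ Ideal.span (l '' A) := by
  obtain ⟨s, ψ, h1, h2, h3⟩ := h.exists_ker A
  rw [← h2]; exact h3 i hi

lemma ufd_of_surj {A B : Type} [CommRing A] [CommRing B] [IsDomain B] [UniqueFactorizationMonoid B]
    (ψ : A →+* B) (h1 : Function.Surjective ψ) (J : Ideal A) (h2 : RingHom.ker ψ = J) :
    UniqueFactorizationMonoid (A ⧸ J) := by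
  subst h2
  have e : B ≃* (A ⧸ RingHom.ker ψ) := (RingHom.quotientKerEquivOfSurjective h1).symm.toMulEquiv
  exact e.uniqueFactorizationMonoid inferInstance

lemma LI.ufd {m : ℕ} {l : Fin m → MvPolynomial (Fin N) k} (h : LI l) (A : Set (Fin m)) :
    UniqueFactorizationMonoid (MvPolynomial (Fin N) k ⧸ Ideal.span (l '' A)) := by
  obtain ⟨s, ψ, h1, h2, -⟩ := h.exists_ker A
  exact ufd_of_surj ψ.toRingHom h1 _ h2

lemma PD.eq {R : Type} [CommRing R] {n : ℕ} {I J : Ideal R} (h : PD R n (R ⧸ I)) (e : I = J) :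
    PD R n (R ⧸ J) := by subst e; exact h

lemma LI.pd {m : ℕ} {l : Fin m → MvPolynomial (Fin N) k} (h : LI l) (A : Finset (Fin m)) :
    PD (MvPolynomial (Fin N) k) A.card (MvPolynomial (Fin N) k ⧸ Ideal.span (l '' (A : Set (Fin m)))) := by
  classical
  induction A using Finset.induction_on with
  | empty =>
    exact PD.bot.eq (by simp)
  | insert i A hi ih =>
    rw [Finset.card_insert_of_notMem hi]
    have e : Ideal.span (l '' ((insert i A : Finset (Fin m)) : Set (Fin m))) =
      Ideal.span (l '' (A : Set (Fin m))) ⊔ Ideal.span {l i} := by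
      rw [Finset.coe_insert, Set.image_insert_eq, Ideal.span_insert, sup_comm]
    refine PD.eq (PD.nzd (Ideal.span (l '' (A : Set (Fin m)))) (l i) ?_ ih) e.symm
    intro r hr
    exact ((h.prime A).mem_or_mem hr).resolve_right (h.not_mem (by simpa using hi))

lemma idealHeight_prime {R : Type} [CommRing R] (p : Ideal R) [hp : p.IsPrime] :
    idealHeight p = p.height := by
  let e : PrimeSpectrum R ≃o {q : Ideal R // q.IsPrime} :=
    { toFun := fun q => ⟨q.asIdeal, q.isPrime⟩
      invFun := fun q => ⟨q.1, q.2⟩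
      left_inv := fun _ => rfl
      right_inv := fun _ => rfl
      map_rel_iff' := Iff.rfl }
  have h1 : p.height = Order.height (⟨p, hp⟩ : {q : Ideal R // q.IsPrime}) := by
    exact (PrimeSpectrum.height_eq_orderHeight ⟨p, hp⟩).trans (Order.height_orderIso e ⟨p, hp⟩).symm
  rw [h1]
  apply le_antisymm
  · exact iInf₂_le (⟨p, hp⟩ : {q : Ideal R // q.IsPrime}) (le_refl p)
  · refine le_iInf₂ ?_
    intro q hq
    exact Order.height_mono hq

lemma idealHeight_le {R : Type} [CommRing R] (I p : Ideal R) [hp : p.IsPrime] (h : I ≤ p) :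
    idealHeight I ≤ p.height := by
  rw [← idealHeight_prime p]
  refine le_iInf₂ ?_
  intro q hq
  exact iInf₂_le q (h.trans hq)

end

end

section

section
variable {k : Type} [Field k] {N : ℕ}

lemma hom_smul {d : ℕ} {x : MvPolynomial (Fin N) k} (c : k) (h : x.IsHomogeneous d) :
    (c • x).IsHomogeneous d := (homogeneousSubmodule (Fin N) k d).smul_mem c h

lemma LI.pair {x y : MvPolynomial (Fin N) k} : LI ![x, y] ↔
    x.IsHomogeneous 1 ∧ y.IsHomogeneous 1 ∧ ∀ a b : k, a • x + b • y = 0 → a = 0 ∧ b = 0 := by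
  constructor
  · rintro ⟨h1, h2⟩
    exact ⟨h1 0, h1 1, LinearIndependent.pair_iff.1 h2⟩
  · rintro ⟨h1, h2, h3⟩
    exact ⟨by intro i; fin_cases i <;> assumption, LinearIndependent.pair_iff.2 h3⟩

lemma LI.triple {x y z : MvPolynomial (Fin N) k} : LI ![x, y, z] ↔
    x.IsHomogeneous 1 ∧ y.IsHomogeneous 1 ∧ z.IsHomogeneous 1 ∧
      ∀ a b c : k, a • x + b • y + c • z = 0 → a = 0 ∧ b = 0 ∧ c = 0 := by
  constructor
  · rintro ⟨h1, h2⟩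
    refine ⟨h1 0, h1 1, h1 2, fun a b c h => ?_⟩
    rw [Fintype.linearIndependent_iff] at h2
    have := h2 ![a, b, c] (by simpa [Fin.sum_univ_succ, add_assoc] using h)
    exact ⟨this 0, this 1, this 2⟩
  · rintro ⟨h1, h2, h3, h4⟩
    refine ⟨by intro i; fin_cases i <;> assumption, ?_⟩
    rw [Fintype.linearIndependent_iff]
    intro g hg
    have := h4 (g 0) (g 1) (g 2) (by simpa [Fin.sum_univ_succ, add_assoc] using hg)
    intro i; fin_cases i
    exacts [this.1, this.2.1, this.2.2]

lemma LI.quad {x y z w : MvPolynomial (Fin N) k} : LI ![x, y, z, w] ↔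
    x.IsHomogeneous 1 ∧ y.IsHomogeneous 1 ∧ z.IsHomogeneous 1 ∧ w.IsHomogeneous 1 ∧
      ∀ a b c d : k, a • x + b • y + c • z + d • w = 0 → a = 0 ∧ b = 0 ∧ c = 0 ∧ d = 0 := by
  constructor
  · rintro ⟨h1, h2⟩
    refine ⟨h1 0, h1 1, h1 2, h1 3, fun a b c d h => ?_⟩
    rw [Fintype.linearIndependent_iff] at h2
    have := h2 ![a, b, c, d] (by simpa [Fin.sum_univ_succ, add_assoc] using h)
    exact ⟨this 0, this 1, this 2, this 3⟩
  · rintro ⟨h1, h2, h3, h4, h5⟩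
    refine ⟨by intro i; fin_cases i <;> assumption, ?_⟩
    rw [Fintype.linearIndependent_iff]
    intro g hg
    have := h5 (g 0) (g 1) (g 2) (g 3) (by simpa [Fin.sum_univ_succ, add_assoc] using hg)
    intro i; fin_cases i
    exacts [this.1, this.2.1, this.2.2.1, this.2.2.2]

lemma mem_span_smul (S : Ideal (MvPolynomial (Fin N) k)) {x : MvPolynomial (Fin N) k} (c : k)
    (h : x ∈ S) : c • x ∈ S := by
  rw [MvPolynomial.smul_eq_C_mul]; exact S.mul_mem_left _ h

lemma mem_of_smul (S : Ideal (MvPolynomial (Fin N) k)) {x : MvPolynomial (Fin N) k} {c : k}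
    (hc : c ≠ 0) (h : c • x ∈ S) : x ∈ S := by
  have := mem_span_smul S c⁻¹ h
  rwa [smul_smul, inv_mul_cancel₀ hc, one_smul] at this

lemma LI.change {x y : MvPolynomial (Fin N) k} (h : LI ![x, y]) (a b : k) (hab : a ≠ 0 ∨ b ≠ 0) :
    ∃ y', LI ![a • x + b • y, y'] ∧ Ideal.span {x, y} = Ideal.span {a • x + b • y, y'} := by
  obtain ⟨hx, hy, hli⟩ := LI.pair.1 h
  have ht := (hom_smul a hx).add (hom_smul b hy)
  by_cases ha : a = 0
  · have hb : b ≠ 0 := by tauto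
    refine ⟨x, LI.pair.2 ⟨ht, hx, ?_⟩, ?_⟩
    · intro c d e
      have := hli (c * a + d) (c * b) (by rw [← e]; module)
      have hc : c = 0 := by simpa [hb] using this.2
      subst hc; simpa using this.1
    · subst ha
      simp only [zero_smul, zero_add]
      apply le_antisymm <;> rw [Ideal.span_le] <;> rintro u (rfl | rfl)
      · exact Ideal.subset_span (by simp)
      · exact mem_of_smul _ hb (Ideal.subset_span (by simp))
      · exact mem_span_smul _ b (Ideal.subset_span (by simp))
      · exact Ideal.subset_span (by simp)
  · refine ⟨y, LI.pair.2 ⟨ht, hy, ?_⟩, ?_⟩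
    · intro c d e
      have := hli (c * a) (c * b + d) (by rw [← e]; module)
      have hc : c = 0 := by simpa [ha] using this.1
      subst hc; simpa using this.2
    · apply le_antisymm <;> rw [Ideal.span_le] <;> rintro u (rfl | rfl)
      · apply mem_of_smul _ ha
        have h1 : a • u + b • y ∈ Ideal.span {a • u + b • y, y} := Ideal.subset_span (by simp)
        have h2 : b • y ∈ Ideal.span {a • u + b • y, y} := mem_span_smul _ b (Ideal.subset_span (by simp))
        simpa using Ideal.sub_mem _ h1 h2
      · exact Ideal.subset_span (by simp)
      · exact Ideal.add_mem _ (mem_span_smul _ a (Ideal.subset_span (by simp)))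
          (mem_span_smul _ b (Ideal.subset_span (by simp)))
      · exact Ideal.subset_span (by simp)

lemma LI.dichotomy {x y z w : MvPolynomial (Fin N) k} (h1 : LI ![x, y]) (h2 : LI ![z, w])
    (hne : Ideal.span {x, y} ≠ Ideal.span {z, w}) :
    LI ![x, y, z, w] ∨ ∃ x' y' z', LI ![x', y', z'] ∧ Ideal.span {x, y} = Ideal.span {x', y'} ∧
      Ideal.span {z, w} = Ideal.span {x', z'} := by
  by_cases hq : LI ![x, y, z, w]
  · exact Or.inl hq
  right
  obtain ⟨hx, hy, hxy⟩ := LI.pair.1 h1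
  obtain ⟨hz, hw, hzw⟩ := LI.pair.1 h2
  rw [LI.quad] at hq
  push Not at hq
  obtain ⟨a, b, c, d, he, hnz⟩ := hq hx hy hz hw
  have hab : a ≠ 0 ∨ b ≠ 0 := by
    by_contra hcon
    push Not at hcon
    obtain ⟨rfl, rfl⟩ := hcon
    have := hzw c d (by simpa using he)
    exact hnz rfl rfl this.1 this.2
  have hcd : -c ≠ 0 ∨ -d ≠ 0 := by
    by_contra hcon
    push Not at hcon
    simp only [neg_eq_zero] at hcon
    obtain ⟨rfl, rfl⟩ := hcon
    have := hxy a b (by simpa using he)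
    exact hnz this.1 this.2 rfl rfl
  have ht : a • x + b • y = (-c) • z + (-d) • w := by
    rw [← sub_eq_zero, ← he]; module
  obtain ⟨y', hy1, hy2⟩ := h1.change a b hab
  obtain ⟨z', hz1, hz2⟩ := h2.change _ _ hcd
  rw [← ht] at hz1 hz2
  set t := a • x + b • y
  refine ⟨t, y', z', ?_, hy2, hz2⟩
  obtain ⟨_, hy', hty⟩ := LI.pair.1 hy1
  obtain ⟨ht1, hz', htz⟩ := LI.pair.1 hz1
  refine LI.triple.2 ⟨ht1, hy', hz', ?_⟩
  intro α β γ e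
  have hγ : γ = 0 := by
    by_contra hγ
    have hβ : β ≠ 0 := by
      rintro rfl
      exact hγ (htz α γ (by simpa using e)).2
    apply hne
    rw [hy2, hz2]
    apply le_antisymm <;> rw [Ideal.span_le] <;> rintro u (rfl | rfl)
    · exact Ideal.subset_span (by simp)
    · apply mem_of_smul _ hβ
      have : β • u = (-α) • t + (-γ) • z' := by rw [← sub_eq_zero, ← e]; module
      rw [this]
      exact Ideal.add_mem _ (mem_span_smul _ _ (Ideal.subset_span (by simp)))
          (mem_span_smul _ _ (Ideal.subset_span (by simp)))
    · exact Ideal.subset_span (by simp)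
    · apply mem_of_smul _ hγ
      have : γ • u = (-α) • t + (-β) • y' := by rw [← sub_eq_zero, ← e]; module
      rw [this]
      exact Ideal.add_mem _ (mem_span_smul _ _ (Ideal.subset_span (by simp)))
          (mem_span_smul _ _ (Ideal.subset_span (by simp)))
  subst hγ
  have := hty α β (by simpa using e)
  exact ⟨this.1, this.2, rfl⟩

end

end

section

section
variable {k : Type} [Field k] {N : ℕ}

lemma LI.le_height {m : ℕ} {l : Fin m → MvPolynomial (Fin N) k} (h : LI l) (A : Finset (Fin m)) :
    (A.card : ℕ∞) ≤ (Ideal.span (l '' (A : Set (Fin m)))).height := by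
  classical
  induction A using Finset.induction_on with
  | empty => simp
  | insert i A hi ih =>
    rw [Finset.card_insert_of_notMem hi]
    have := h.prime (A : Set (Fin m))
    have := h.prime ((insert i A : Finset (Fin m)) : Set (Fin m))
    have hlt : Ideal.span (l '' (A : Set (Fin m))) <
        Ideal.span (l '' ((insert i A : Finset (Fin m)) : Set (Fin m))) := by
      refine lt_of_le_of_ne (Ideal.span_mono (Set.image_mono (by simp))) ?_
      intro e
      refine h.not_mem (A := (A : Set (Fin m))) (i := i) (by simpa using hi) ?_
      rw [e]
      exact Ideal.subset_span ⟨i, by simp, rfl⟩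
    have := Ideal.height_add_one_le_of_lt_of_isPrime hlt
    rw [Nat.cast_add, Nat.cast_one]
    exact (add_le_add_left ih 1).trans this

lemma LI.height_le {m : ℕ} {l : Fin m → MvPolynomial (Fin N) k} (h : LI l) :
    (Ideal.span (Set.range l)).height ≤ m := by
  classical
  have : (Ideal.span (Set.range l)).IsPrime := by
    rw [← Set.image_univ]; exact h.prime _
  have := Ideal.height_le_card_of_mem_minimalPrimes_span_finset (p := Ideal.span (Set.range l))
    (s := Finset.univ.image l) (by
      have : ((Finset.univ.image l : Finset _) : Set (MvPolynomial (Fin N) k)) = Set.range l := by simp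
      rw [this, Ideal.minimalPrimes_eq_subsingleton_self]; rfl)
  refine this.trans ?_
  have : (Finset.univ.image l).card ≤ m := by
    simpa using Finset.card_image_le (s := Finset.univ) (f := l)
  exact_mod_cast this

lemma LI.height_eq {m : ℕ} {l : Fin m → MvPolynomial (Fin N) k} (h : LI l) :
    (Ideal.span (Set.range l)).height = m := by
  apply le_antisymm h.height_le
  have := h.le_height Finset.univ
  simpa using this

lemma linPrime_struct (p : Ideal (MvPolynomial (Fin N) k)) (hp : IsLinearPrime p)
    (hh : idealHeight p = 2) : ∃ x y, LI ![x, y] ∧ p = Ideal.span {x, y} := by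
  obtain ⟨hpp, S, hS, hpS⟩ := hp
  rw [idealHeight_prime p] at hh
  let W : Submodule k (MvPolynomial (Fin N) k) := Submodule.span k S
  have hW : W ≤ homogeneousSubmodule (Fin N) k 1 := Submodule.span_le.2 hS
  have : FiniteDimensional k (homogeneousSubmodule (Fin N) k 1) :=
    Module.Finite.of_basis (linBasis k N)
  have : FiniteDimensional k W := Submodule.finiteDimensional_of_le hW
  let b := Module.finBasis k W
  let l : Fin (Module.finrank k W) → MvPolynomial (Fin N) k := fun i => (b i : MvPolynomial (Fin N) k)
  have hl : LI l := ⟨fun i => hW (b i).2, b.linearIndependent.map' W.subtype (Submodule.ker_subtype W)⟩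
  have hspan : Submodule.span k (Set.range l) = W := by
    have := congrArg (Submodule.map W.subtype) b.span_eq
    rw [Submodule.map_span, ← Set.range_comp, Submodule.map_top, Submodule.range_subtype] at this
    exact this
  have key : ∀ (A B : Set (MvPolynomial (Fin N) k)), A ⊆ Submodule.span k B → Ideal.span A ≤ Ideal.span B := by
    intro A B h
    rw [Ideal.span_le]
    intro a ha
    exact Submodule.span_subset_span k (MvPolynomial (Fin N) k) B (h ha)
  have hp2 : p = Ideal.span (Set.range l) := by
    rw [hpS]
    apply le_antisymm
    · apply key; rw [hspan]; exact Submodule.subset_span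
    · apply key; rintro _ ⟨i, rfl⟩; exact (b i).2
  have hm : Module.finrank k W = 2 := by
    rw [hp2, hl.height_eq] at hh
    exact_mod_cast hh
  clear_value l
  revert l
  rw [hm]
  intro l hl _ hp2
  refine ⟨l 0, l 1, ?_, ?_⟩
  · have : ![l 0, l 1] = l := by ext1 i; fin_cases i <;> rfl
    rw [this]; exact hl
  · rw [hp2]; congr 1
    ext t; simp [Set.mem_range, Fin.exists_fin_two, eq_comm]

/-- consequences of `ht (f₁,f₂) = 2` -/
lemma ci_facts (f₁ f₂ : MvPolynomial (Fin N) k) (hh : idealHeight (Ideal.span {f₁, f₂}) = 2) :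
    f₁ ≠ 0 ∧ IsRelPrime f₁ f₂ := by
  have hP : ∀ P : Ideal (MvPolynomial (Fin N) k), P.IsPrime → P.height ≤ 1 → ¬ (f₁ ∈ P ∧ f₂ ∈ P) := by
    rintro P hP h1 ⟨h2, h3⟩
    have := idealHeight_le (Ideal.span {f₁, f₂}) P (by
      rw [Ideal.span_le]; rintro _ (rfl | rfl) <;> assumption)
    rw [hh] at this
    exact absurd (this.trans h1) (by decide)
  have hπ : ∀ π, Prime π → ¬ (π ∣ f₁ ∧ π ∣ f₂) := by
    intro π hπ ⟨h1, h2⟩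
    have : (Ideal.span {π} : Ideal (MvPolynomial (Fin N) k)).IsPrime :=
      (Ideal.span_singleton_prime hπ.ne_zero).2 hπ
    refine hP (Ideal.span {π}) this ?_ ⟨Ideal.mem_span_singleton.2 h1, Ideal.mem_span_singleton.2 h2⟩
    have := Ideal.height_le_card_of_mem_minimalPrimes_span_finset (p := Ideal.span {π})
      (s := {π}) (by
        rw [Finset.coe_singleton, Ideal.minimalPrimes_eq_subsingleton_self]; rfl)
    simpa using this
  have h0 : ¬ (f₁ = 0 ∧ f₂ = 0) := by
    rintro ⟨rfl, rfl⟩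
    exact hP ⊥ Ideal.isPrime_bot (by rw [Ideal.height_bot]; exact zero_le_one) ⟨by simp, by simp⟩
  have hne : f₁ ≠ 0 := by
    rintro rfl
    by_cases hu : IsUnit f₂
    · have htop : Ideal.span {(0 : MvPolynomial (Fin N) k), f₂} = ⊤ := by
        rw [Ideal.eq_top_iff_one]
        exact (Ideal.eq_top_iff_one _).1 (Ideal.eq_top_of_isUnit_mem _ (Ideal.subset_span (by simp)) hu)
      rw [htop] at hh
      have : idealHeight (⊤ : Ideal (MvPolynomial (Fin N) k)) = ⊤ := by
        rw [eq_top_iff]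
        refine le_iInf₂ ?_
        intro q hq
        exact absurd (top_le_iff.1 hq) q.2.ne_top
      rw [this] at hh
      exact absurd hh (by decide)
    · obtain ⟨π, h1, h2⟩ := WfDvdMonoid.exists_irreducible_factor hu (fun h => h0 ⟨rfl, h⟩)
      exact hπ π h1.prime ⟨dvd_zero _, h2⟩
  refine ⟨hne, ?_⟩
  rw [UniqueFactorizationMonoid.isRelPrime_iff_no_prime_factors hne]
  intro d h1 h2 h3
  exact hπ d h3 ⟨h1, h2⟩

lemma ci_nzd {R : Type} [CommRing R] [IsDomain R] [UniqueFactorizationMonoid R] {f₁ f₂ : R}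
    (h : IsRelPrime f₁ f₂) : ∀ s, s * f₂ ∈ Ideal.span {f₁} → s ∈ Ideal.span {f₁} := by
  intro s hs
  rw [Ideal.mem_span_singleton] at hs ⊢
  exact h.dvd_of_dvd_mul_right hs

lemma ci_syz {R : Type} [CommRing R] [IsDomain R] [UniqueFactorizationMonoid R] {f₁ f₂ : R}
    (h0 : f₁ ≠ 0) (h : IsRelPrime f₁ f₂) :
    ∀ u v, u * f₁ = v * f₂ → ∃ t, u = t * f₂ ∧ v = t * f₁ := by
  intro u v e
  obtain ⟨t, ht⟩ := h.dvd_of_dvd_mul_right (Dvd.intro_left u e)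
  refine ⟨t, ?_, by rw [ht]; ring⟩
  apply mul_right_cancel₀ h0
  rw [e, ht]; ring

lemma ci_pd {R : Type} [CommRing R] [IsDomain R] [UniqueFactorizationMonoid R] {f₁ f₂ : R}
    (h0 : f₁ ≠ 0) (h : IsRelPrime f₁ f₂) : PD R 2 (R ⧸ Ideal.span {f₁, f₂}) := by
  have h1 : PD R 1 (R ⧸ Ideal.span {f₁}) := by
    refine PD.eq (PD.nzd ⊥ f₁ ?_ PD.bot) (by simp)
    intro r hr
    simpa [h0] using hr
  refine PD.eq (PD.nzd (Ideal.span {f₁}) f₂ (ci_nzd h) h1) ?_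
  rw [Ideal.span_insert]

lemma prime_over_inf {R : Type} [CommRing R] {K₁ K₂ p₁ p₂ P : Ideal R} [IsNoetherianRing R]
    (h1 : K₁.radical = p₁) (h2 : K₂.radical = p₂)
    (hp1 : p₁.IsPrime) (hp2 : p₂.IsPrime) (hh1 : p₁.height = 2) (hh2 : p₂.height = 2)
    (hP : P.IsPrime) (hPK : K₁ ⊓ K₂ ≤ P) (hPh : P.height ≤ 2) : P = p₁ ∨ P = p₂ := by
  rcases hP.inf_le.1 hPK with h | h
  · left
    have : p₁ ≤ P := by rw [← h1]; exact hP.radical_le_iff.2 h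
    exact (Ideal.eq_of_le_of_height_le _ this (by rw [hh1]; exact hPh)).symm
  · right
    have : p₂ ≤ P := by rw [← h2]; exact hP.radical_le_iff.2 h
    exact (Ideal.eq_of_le_of_height_le _ this (by rw [hh2]; exact hPh)).symm
end

end

section

section

lemma mem_colon_single {R : Type} [CommRing R] (J : Ideal R) (s r : R) :
    r ∈ J.colon (Ideal.span {s} : Ideal R) ↔ r * s ∈ J := by
  rw [mem_colon']
  constructor
  · intro h; exact h s (Ideal.mem_span_singleton_self s)
  · intro h t ht
    obtain ⟨c, rfl⟩ := Ideal.mem_span_singleton.1 ht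
    rw [← mul_assoc]; exact J.mul_mem_right _ h

lemma mem_primaryComponent {R : Type} [CommRing R] (J P : Ideal R) [hP : P.IsPrime] (r : R) :
    r ∈ primaryComponent J P ↔ ∃ s ∉ P, r * s ∈ J := by
  constructor
  · intro h
    let Q : Ideal R :=
      { carrier := {r | ∃ s ∉ P, r * s ∈ J}
        zero_mem' := ⟨1, fun h => hP.ne_top ((Ideal.eq_top_iff_one _).2 h), by simp⟩
        add_mem' := by
          rintro a b ⟨s, hs, h1⟩ ⟨t, ht, h2⟩
          refine ⟨s * t, fun h => (hP.mem_or_mem h).elim hs ht, ?_⟩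
          have : (a + b) * (s * t) = (a * s) * t + (b * t) * s := by ring
          rw [this]
          exact J.add_mem (J.mul_mem_right _ h1) (J.mul_mem_right _ h2)
        smul_mem' := by
          rintro c a ⟨s, hs, h1⟩
          refine ⟨s, hs, ?_⟩
          rw [smul_eq_mul, mul_assoc]
          exact J.mul_mem_left _ h1 }
    have : primaryComponent J P ≤ Q := by
      refine iSup₂_le ?_
      intro s hs r hr
      exact ⟨s, hs, (mem_colon_single J s r).1 hr⟩
    exact this h
  · rintro ⟨s, hs, h⟩
    exact (le_iSup₂ (f := fun (s : R) (_ : s ∉ P) => Submodule.colon J (Ideal.span {s} : Ideal R)) s hs)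
      ((mem_colon_single J s r).2 h)

lemma exists_common {R : Type} [CommRing R] (J P K : Ideal R) [hP : P.IsPrime] (hfg : K.FG)
    (h : ∀ r ∈ K, ∃ s ∉ P, r * s ∈ J) : ∃ s ∉ P, ∀ r ∈ K, r * s ∈ J := by
  classical
  obtain ⟨S, rfl⟩ := hfg
  have h' : ∀ r : S, ∃ s ∉ P, (r : R) * s ∈ J := fun r => h r (Ideal.subset_span r.2)
  choose s hs1 hs2 using h'
  refine ⟨∏ r, s r, ?_, ?_⟩
  · intro hmem
    obtain ⟨r, -, hr⟩ := (hP.prod_mem_iff).1 hmem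
    exact hs1 r hr
  · intro r hr
    have : Ideal.span (S : Set R) ≤ J.colon (Ideal.span {∏ r, s r} : Ideal R) := by
      rw [Ideal.span_le]
      intro r hr
      refine (mem_colon_single _ _ _).2 ?_
      obtain ⟨c, hc⟩ := Finset.dvd_prod_of_mem s (Finset.mem_univ (⟨r, hr⟩ : S))
      rw [hc, ← mul_assoc]
      exact J.mul_mem_right _ (hs2 ⟨r, hr⟩)
    exact (mem_colon_single _ _ _).1 (this hr)

lemma le_unmixedPart {R : Type} [CommRing R] (J : Ideal R) : J ≤ unmixedPart J := by
  refine le_iInf₂ ?_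
  rintro p ⟨hp, -, -⟩ r hr
  exact (mem_primaryComponent J p r).2 ⟨1, fun h => hp.ne_top ((Ideal.eq_top_iff_one _).2 h), by simpa⟩

lemma colon_unmixed {k : Type} [Field k] {n : ℕ} (f₁ f₂ f₃ : MvPolynomial (Fin (n + 1)) k)
    (h0 : f₁ ≠ 0) (hrel : IsRelPrime f₁ f₂) (hh : idealHeight (Ideal.span {f₁, f₂, f₃}) = 2) :
    (Ideal.span {f₁, f₂}).colon (Ideal.span {f₃} : Ideal (MvPolynomial (Fin (n + 1)) k)) =
    (Ideal.span {f₁, f₂}).colon (unmixedPart (Ideal.span {f₁, f₂, f₃}) : Set _) := by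
  set I := Ideal.span {f₁, f₂, f₃} with hI
  set C : Ideal (MvPolynomial (Fin (n + 1)) k) := Ideal.span {f₁, f₂} with hC
  set K := unmixedPart I with hK
  have hIK : I ≤ K := le_unmixedPart I
  have hCI : C ≤ I := Ideal.span_mono (by intro t ht; simp at ht ⊢; tauto)
  apply le_antisymm
  swap
  · intro g hg
    rw [mem_colon'] at hg
    exact (mem_colon_single _ _ _).2 (hg f₃ (hIK (Ideal.subset_span (by simp))))
  intro g hg
  have hgI : ∀ i ∈ I, g * i ∈ C := by
    have : I ≤ C.colon (Ideal.span {g} : Ideal (MvPolynomial (Fin (n + 1)) k)) := by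
      rw [hI, Ideal.span_le]
      have hg' := (mem_colon_single _ _ _).1 hg
      rintro t (rfl | rfl | rfl)
      · exact (mem_colon_single _ _ _).2 (C.mul_mem_right _ (Ideal.subset_span (by simp)))
      · exact (mem_colon_single _ _ _).2 (C.mul_mem_right _ (Ideal.subset_span (by simp)))
      · exact (mem_colon_single _ _ _).2 (by rwa [mul_comm])
    intro i hi
    rw [mul_comm]
    exact (mem_colon_single _ _ _).1 (this hi)
  obtain ⟨h, hh1, hh2⟩ := unmixed_nzd f₁ f₂ h0 (ci_nzd hrel) (I.colon (K : Set _)) (by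
      rw [mem_colon']
      intro t _
      exact I.mul_mem_right _ (Ideal.subset_span (by simp))) (by
    intro P hP hTP hPh
    have hIP : I ≤ P := by
      refine le_trans ?_ hTP
      intro i hi
      rw [mem_colon']
      intro t _
      exact I.mul_mem_right _ hi
    have hPe : idealHeight P = idealHeight I := by
      rw [hh, idealHeight_prime P]
      refine le_antisymm hPh ?_
      rw [← hh]; exact idealHeight_le I P hIP
    have hKP : K ≤ primaryComponent I P := iInf₂_le P ⟨hP, hIP, hPe⟩
    obtain ⟨s, hs1, hs2⟩ := exists_common I P K (IsNoetherian.noetherian K)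
      (fun r hr => (mem_primaryComponent I P r).1 (hKP hr))
    apply hs1
    apply hTP
    rw [mem_colon']
    intro r hr
    rw [mul_comm]; exact hs2 r hr)
  rw [mem_colon'] at hh1 ⊢
  intro t ht
  apply hh2
  have := hgI _ (hh1 t ht)
  have e : g * t * h = g * (h * t) := by ring
  rw [e]; exact this
end

end

section

section
set_option linter.unusedSectionVars false

variable {k : Type} [Field k] {σ : Type} [Fintype σ]

/-- exponents of degree less than `n` -/
def expLT (σ : Type) [Fintype σ] (n : ℕ) : Finset (σ →₀ ℕ) := by
  classical
  exact (Finset.range n).biUnion (fun j => Finset.finsuppAntidiag Finset.univ j)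

lemma mem_expLT (n : ℕ) (x : σ →₀ ℕ) : x ∈ expLT σ n ↔ x.degree < n := by
  classical
  simp [expLT, Finset.mem_finsuppAntidiag, Finsupp.degree_eq_sum]

lemma card_expLT (n : ℕ) : (expLT σ (n + 1)).card = (n + Fintype.card σ).choose (Fintype.card σ) := by
  classical
  rw [← Nat.sum_range_multichoose, expLT, Finset.card_biUnion]
  · apply Finset.sum_congr rfl
    intro j _
    rw [Finset.card_finsuppAntidiag_nat_eq_multichoose, Finset.card_univ]
  · intro i _ j _ hij
    refine Finset.disjoint_left.2 ?_
    intro x hx hy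
    rw [Finset.mem_finsuppAntidiag] at hx hy
    exact hij (hx.1.symm.trans hy.1)

/-- low-degree coefficients -/
def lowCoeff (k : Type) [Field k] (σ : Type) [Fintype σ] (n : ℕ) :
    MvPolynomial σ k →ₗ[k] (expLT σ n → k) :=
  LinearMap.pi (fun x => MvPolynomial.lcoeff k x.1)

lemma lowCoeff_surj (n : ℕ) : Function.Surjective (lowCoeff k σ n) := by
  classical
  intro g
  refine ⟨∑ x : expLT σ n, monomial x.1 (g x), ?_⟩
  ext y
  simp only [lowCoeff, LinearMap.pi_apply, map_sum, lcoeff_apply, coeff_monomial]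
  rw [Finset.sum_eq_single y]
  · simp
  · intro b _ hb
    rw [if_neg]
    exact fun h => hb (Subtype.ext h)
  · simp

lemma lowCoeff_ker (n : ℕ) (p : MvPolynomial σ k) :
    lowCoeff k σ n p = 0 ↔ p ∈ (idealOfVars σ k) ^ n := by
  rw [mem_pow_idealOfVars_iff']
  constructor
  · intro h x hx
    exact congrFun h ⟨x, (mem_expLT n x).2 hx⟩
  · intro h
    ext x
    exact h x.1 ((mem_expLT n x.1).1 x.2)

def quotEquivOf {A V : Type} [CommRing A] [Algebra k A] [AddCommGroup V] [Module k V] (J : Ideal A)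
    (f : A →ₗ[k] V) (hs : Function.Surjective f) (hk : ∀ p, f p = 0 ↔ p ∈ J) : (A ⧸ J) ≃ₗ[k] V := by
  refine LinearEquiv.ofBijective ((J.restrictScalars k).liftQ f (fun p hp => (hk p).2 hp)) ⟨?_, ?_⟩
  · refine (injective_iff_map_eq_zero _).2 ?_
    intro a
    obtain ⟨p, rfl⟩ := Ideal.Quotient.mk_surjective a
    intro h
    exact Ideal.Quotient.eq_zero_iff_mem.2 ((hk p).1 h)
  · intro g
    obtain ⟨p, rfl⟩ := hs g
    exact ⟨Submodule.Quotient.mk p, rfl⟩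

def quotEquiv (n : ℕ) : (MvPolynomial σ k ⧸ (idealOfVars σ k) ^ n) ≃ₗ[k] (expLT σ n → k) :=
  quotEquivOf _ (lowCoeff k σ n) (lowCoeff_surj n) (lowCoeff_ker n)

lemma finrank_quot (n : ℕ) : Module.finrank k (MvPolynomial σ k ⧸ (idealOfVars σ k) ^ n) =
    (expLT σ n).card := by
  rw [(quotEquiv n).finrank_eq]; simp

instance finite_quot (n : ℕ) : Module.Finite k (MvPolynomial σ k ⧸ (idealOfVars σ k) ^ n) :=
  Module.Finite.equiv (quotEquiv n).symm

lemma finite_of_le {J J' : Ideal (MvPolynomial σ k)} (h : J ≤ J')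
    (hf : Module.Finite k (MvPolynomial σ k ⧸ J)) : Module.Finite k (MvPolynomial σ k ⧸ J') :=
  Module.Finite.of_surjective (Ideal.Quotient.factorₐ k h).toLinearMap (Ideal.Quotient.factor_surjective h)

lemma finrank_of_le {J J' : Ideal (MvPolynomial σ k)} (h : J ≤ J')
    (hf : Module.Finite k (MvPolynomial σ k ⧸ J)) :
    Module.finrank k (MvPolynomial σ k ⧸ J') ≤ Module.finrank k (MvPolynomial σ k ⧸ J) :=
  LinearMap.finrank_le_finrank_of_surjective (f := (Ideal.Quotient.factorₐ k h).toLinearMap)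
    (Ideal.Quotient.factor_surjective h)

lemma finite_hs (J : Ideal (MvPolynomial σ k)) (n : ℕ) :
    Module.Finite k (MvPolynomial σ k ⧸ (J ⊔ (idealOfVars σ k) ^ n)) :=
  finite_of_le le_sup_right (finite_quot n)

variable {N : ℕ}

lemma hs_mono {J J' : Ideal (MvPolynomial (Fin N) k)} (h : J ≤ J') (n : ℕ) :
    hilbertSamuelFn J' n ≤ hilbertSamuelFn J n :=
  finrank_of_le (sup_le_sup_right h _) (finite_hs J n)

/-- additivity along `0 → R/(J:u) → R/J → R/(J+u) → 0` -/
lemma finrank_colon (J : Ideal (MvPolynomial σ k)) (u : MvPolynomial σ k)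
    (hf : Module.Finite k (MvPolynomial σ k ⧸ J)) :
    Module.finrank k (MvPolynomial σ k ⧸ J) =
      Module.finrank k (MvPolynomial σ k ⧸ (J.colon (Ideal.span {u} : Ideal (MvPolynomial σ k)))) +
      Module.finrank k (MvPolynomial σ k ⧸ (J ⊔ Ideal.span {u})) := by
  let q : (MvPolynomial σ k ⧸ J) →ₗ[k] (MvPolynomial σ k ⧸ (J ⊔ Ideal.span {u})) :=
    (Ideal.Quotient.factorₐ k (le_sup_left : J ≤ J ⊔ Ideal.span {u})).toLinearMap
  have hq : Function.Surjective q := Ideal.Quotient.factor_surjective le_sup_left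
  rw [← LinearMap.finrank_range_add_finrank_ker q, LinearMap.range_eq_top.2 hq, finrank_top, add_comm]
  congr 1
  let i : MvPolynomial σ k →ₗ[k] (MvPolynomial σ k ⧸ J) :=
    (Ideal.Quotient.mkₐ k J).toLinearMap ∘ₗ (LinearMap.mulRight k u)
  have hi : ∀ r, i r = Ideal.Quotient.mk J (r * u) := fun r => rfl
  have hr : LinearMap.range i = LinearMap.ker q := by
    ext t
    obtain ⟨t, rfl⟩ := Ideal.Quotient.mk_surjective t
    have h1 : q (Ideal.Quotient.mk J t) = Ideal.Quotient.mk _ t := rfl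
    rw [LinearMap.mem_ker, h1, Ideal.Quotient.eq_zero_iff_mem, LinearMap.mem_range]
    constructor
    · rintro ⟨r, hr⟩
      rw [hi, Ideal.Quotient.eq] at hr
      have : t = -(r * u - t) + r * u := by ring
      rw [this]
      exact Ideal.add_mem _ (Ideal.neg_mem_iff _ |>.2 (Ideal.mem_sup_left hr))
        (Ideal.mem_sup_right (Ideal.mem_span_singleton'.2 ⟨r, rfl⟩))
    · intro h
      obtain ⟨a, ha, b, hb, rfl⟩ := Submodule.mem_sup.1 h
      obtain ⟨r, rfl⟩ := Ideal.mem_span_singleton'.1 hb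
      refine ⟨r, ?_⟩
      rw [hi, Ideal.Quotient.eq]
      have : r * u - (a + r * u) = - a := by ring
      rw [this]; exact J.neg_mem ha
  have hk : LinearMap.ker i = (J.colon (Ideal.span {u} : Ideal (MvPolynomial σ k))).restrictScalars k := by
    ext r
    rw [LinearMap.mem_ker, hi, Ideal.Quotient.eq_zero_iff_mem, Submodule.restrictScalars_mem,
      mem_colon_single]
  rw [← hr, ← (i.quotKerEquivRange).finrank_eq, hk]
  rfl

end

end

section

section
variable {k : Type} [Field k] {N : ℕ}

lemma linear_mem_vars {f : MvPolynomial (Fin N) k} (h : f.IsHomogeneous 1) :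
    f ∈ idealOfVars (Fin N) k := by
  have h1 : f ∈ Submodule.span k (Set.range (X : Fin N → MvPolynomial (Fin N) k)) := by
    rw [← MvPolynomial.homogeneousSubmodule_one_eq_span_X]; exact h
  exact Submodule.span_subset_span k (MvPolynomial (Fin N) k) _ h1

lemma map_vars_equiv (φ : MvPolynomial (Fin N) k ≃ₐ[k] MvPolynomial (Fin N) k)
    (h1 : ∀ d f, f.IsHomogeneous d → (φ f).IsHomogeneous d)
    (h2 : ∀ d f, f.IsHomogeneous d → (φ.symm f).IsHomogeneous d) :
    (idealOfVars (Fin N) k).map φ.symm.toAlgHom = idealOfVars (Fin N) k := by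
  apply le_antisymm
  · rw [idealOfVars, Ideal.map_span, Ideal.span_le]
    rintro _ ⟨_, ⟨i, rfl⟩, rfl⟩
    exact linear_mem_vars (h2 1 _ (isHomogeneous_X k i))
  · rw [idealOfVars, Ideal.span_le]
    rintro _ ⟨i, rfl⟩
    have := Ideal.mem_map_of_mem φ.symm.toAlgHom (linear_mem_vars (h1 1 _ (isHomogeneous_X k i)))
    simpa using this

lemma map_vars_kill (s : Set (Fin N)) :
    (idealOfVars (Fin N) k).map (killVars s) = idealOfVars {i // i ∉ s} k := by
  apply le_antisymm
  · rw [idealOfVars, Ideal.map_span, Ideal.span_le]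
    rintro _ ⟨_, ⟨i, rfl⟩, rfl⟩
    by_cases h : i ∈ s
    · rw [killVars_X_mem s i h]; exact Ideal.zero_mem _
    · rw [killVars_X_not s i h]; exact Ideal.subset_span ⟨_, rfl⟩
  · rw [idealOfVars, Ideal.span_le]
    rintro _ ⟨i, rfl⟩
    have := Ideal.mem_map_of_mem (killVars (k := k) s) (Ideal.subset_span ⟨i.1, rfl⟩ :
      (X i.1 : MvPolynomial (Fin N) k) ∈ idealOfVars (Fin N) k)
    rwa [killVars_X_not s i.1 i.2] at this

lemma killVars_surj (s : Set (Fin N)) : Function.Surjective (killVars (k := k) s) :=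
  fun f => ⟨_, killVars_rename s f⟩

lemma finrank_of_surj {A B : Type} [CommRing A] [CommRing B] [Algebra k A] [Algebra k B]
    (ψ : A →ₐ[k] B) (hs : Function.Surjective ψ) (J : Ideal A) :
    Module.finrank k (A ⧸ (RingHom.ker ψ ⊔ J)) = Module.finrank k (B ⧸ J.map ψ) := by
  let f : A →ₗ[k] (B ⧸ J.map ψ) := ((Ideal.Quotient.mkₐ k (J.map ψ)).comp ψ).toLinearMap
  refine (quotEquivOf _ f ?_ ?_).finrank_eq
  · exact (Ideal.Quotient.mk_surjective).comp hs
  · intro p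
    have : f p = Ideal.Quotient.mk (J.map ψ) (ψ p) := rfl
    rw [this, Ideal.Quotient.eq_zero_iff_mem, ← Ideal.mem_comap,
      Ideal.comap_map_of_surjective ψ hs, sup_comm]
    rfl

lemma hs_LI {m : ℕ} {l : Fin m → MvPolynomial (Fin N) k} (h : LI l) (n : ℕ) :
    hilbertSamuelFn (Ideal.span (Set.range l)) (n + 1) = (n + (N - m)).choose (N - m) := by
  classical
  obtain ⟨φ, ι, h1, h2, h3⟩ := exists_coord l h.hom h.li
  let ψ := (killVars (k := k) (Set.range ι)).comp φ.symm.toAlgHom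
  have hker : RingHom.ker ψ = Ideal.span (Set.range l) := by
    have : Ideal.span (Set.range l) =
        (Ideal.span (X '' (Set.range ι))).map (φ : MvPolynomial (Fin N) k →+* MvPolynomial (Fin N) k) := by
      rw [Ideal.map_span]
      congr 1
      rw [← Set.range_comp, ← Set.range_comp]
      congr 1
      ext1 i
      exact (h1 i).symm
    rw [this, ← ker_killVars]
    ext f
    rw [RingHom.mem_ker, Ideal.mem_map_iff_of_surjective _ (show Function.Surjective (φ : MvPolynomial (Fin N) k →+* MvPolynomial (Fin N) k) from φ.surjective)]
    constructor
    · intro hf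
      exact ⟨φ.symm f, hf, by simp⟩
    · rintro ⟨g, hg, rfl⟩
      simpa [ψ] using hg
  have hs : Function.Surjective ψ := (killVars_surj _).comp φ.symm.surjective
  have hmap : (idealOfVars (Fin N) k ^ (n + 1)).map ψ = idealOfVars {i // i ∉ Set.range ι} k ^ (n + 1) := by
    rw [Ideal.map_pow]
    congr 1
    rw [← map_vars_kill, ← map_vars_equiv φ h2 h3]
    rw [map_vars_equiv φ h2 h3]
    have := Ideal.map_map φ.symm.toAlgHom.toRingHom (killVars (k := k) (Set.range ι)).toRingHom (I := idealOfVars (Fin N) k)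
    refine this.symm.trans ?_
    exact congrArg (Ideal.map (killVars (k := k) (Set.range ι)).toRingHom) (map_vars_equiv φ h2 h3)
  have e := finrank_of_surj ψ hs (idealOfVars (Fin N) k ^ (n + 1))
  rw [hker, hmap, finrank_quot, card_expLT] at e
  have hc : Fintype.card {i // i ∉ Set.range ι} = N - m := by
    rw [Fintype.card_subtype_compl, Fintype.card_fin]
    congr 1
    have e := Fintype.card_congr (Equiv.ofInjective ι ι.injective)
    rw [Fintype.card_fin] at e
    exact (Fintype.card_congr (Equiv.refl _)).trans e.symm
  rw [hc] at e
  exact e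

lemma artin_rees_colon {R : Type} [CommRing R] [IsNoetherianRing R] (m p K : Ideal R)
    (hsat : ∀ r ∉ p, ∀ u, r * u ∈ K → u ∈ K) (u : R) (hu : u ∉ K) :
    ∃ c, ∀ n, (K ⊔ m ^ n).colon (Ideal.span {u} : Ideal R) ≤ p ⊔ m ^ (n - c) := by
  obtain ⟨c, hc⟩ := Ideal.exists_pow_inf_eq_pow_smul m (K ⊔ Ideal.span {u} : Submodule R R)
  refine ⟨c, fun n => ?_⟩
  rcases Nat.lt_or_ge n c with hn | hn
  · rw [Nat.sub_eq_zero_of_le hn.le, pow_zero, Ideal.one_eq_top, sup_top_eq]; exact le_top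
  intro r hr
  rw [mem_colon_single] at hr
  obtain ⟨κ, hκ, t, ht, e⟩ := Submodule.mem_sup.1 hr
  have ht2 : t ∈ (m ^ n • ⊤ ⊓ (K ⊔ Ideal.span {u}) : Submodule R R) := by
    refine ⟨by simpa using ht, ?_⟩
    have : t = -κ + r * u := by rw [← e]; ring
    rw [this]
    exact Ideal.add_mem _ (Ideal.mem_sup_left (K.neg_mem hκ))
      (Ideal.mem_sup_right (Ideal.mem_span_singleton'.2 ⟨r, rfl⟩))
  rw [hc n hn] at ht2
  have ht3 : t ∈ m ^ (n - c) * (K ⊔ Ideal.span {u}) := by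
    have h4 : m ^ (n - c) • (m ^ c • ⊤ ⊓ (K ⊔ Ideal.span {u}) : Submodule R R) ≤
      m ^ (n - c) • (K ⊔ Ideal.span {u} : Submodule R R) := Submodule.smul_mono le_rfl inf_le_right
    exact h4 ht2
  rw [Ideal.mul_sup] at ht3
  obtain ⟨κ', hκ', b, hb, rfl⟩ := Submodule.mem_sup.1 ht3
  obtain ⟨s, hs, rfl⟩ := Ideal.mem_mul_span_singleton.1 hb
  have h1 : (r - s) * u ∈ K := by
    have : (r - s) * u = κ + κ' := by rw [sub_mul, ← e]; ring
    rw [this]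
    exact K.add_mem hκ (Ideal.mul_le_right hκ')
  have h2 : r - s ∈ p := by
    by_contra hcon
    exact hu (hsat _ hcon u h1)
  have : r = (r - s) + s := by ring
  rw [this]
  exact Ideal.add_mem _ (Ideal.mem_sup_left h2) (Ideal.mem_sup_right hs)

/-- the Artin–Rees step -/
lemma hs_step (p K : Ideal (MvPolynomial (Fin N) k)) (hsat : ∀ r ∉ p, ∀ u, r * u ∈ K → u ∈ K)
    (u : MvPolynomial (Fin N) k) (hu : u ∉ K) :
    ∃ c, ∀ n, hilbertSamuelFn p (n - c) + hilbertSamuelFn (K ⊔ Ideal.span {u}) n ≤ hilbertSamuelFn K n := by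
  obtain ⟨c, hc⟩ := artin_rees_colon (idealOfVars (Fin N) k) p K hsat u hu
  refine ⟨c, fun n => ?_⟩
  have key := hc n
  have e := finrank_colon (K ⊔ idealOfVars (Fin N) k ^ n) u (finite_hs K n)
  have e1 : hilbertSamuelFn K n = Module.finrank k (MvPolynomial (Fin N) k ⧸ (K ⊔ idealOfVars (Fin N) k ^ n)) := rfl
  have e2 : hilbertSamuelFn (K ⊔ Ideal.span {u}) n = Module.finrank k
      (MvPolynomial (Fin N) k ⧸ (K ⊔ idealOfVars (Fin N) k ^ n ⊔ Ideal.span {u})) := by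
    rw [sup_right_comm]; rfl
  have e3 := finrank_of_le key (finite_of_le (by
    intro r hr
    rw [mem_colon_single]
    exact Ideal.mul_mem_right _ _ hr) (finite_hs K n))
  have e4 : hilbertSamuelFn p (n - c) = Module.finrank k
    (MvPolynomial (Fin N) k ⧸ (p ⊔ idealOfVars (Fin N) k ^ (n - c))) := rfl
  rw [e1, e2, e, e4]
  exact Nat.add_le_add_right e3 _

lemma exists_socle {R : Type} [CommRing R] {p K : Ideal R} {T : ℕ} (hT : p ^ T ≤ K) (hp : ¬ p ≤ K) :
    ∃ u ∈ p, u ∉ K ∧ ∀ v ∈ p, v * u ∈ K := by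
  classical
  have hex : ∃ T, p ^ T ≤ K := ⟨T, hT⟩
  have h1 := Nat.find_spec hex
  have h2 : ∀ t < Nat.find hex, ¬ p ^ t ≤ K := fun t ht => Nat.find_min hex ht
  set t := Nat.find hex
  have ht2 : 2 ≤ t := by
    by_contra hcon
    have : t = 0 ∨ t = 1 := by omega
    rcases this with h | h
    · rw [h, pow_zero, Ideal.one_eq_top, top_le_iff] at h1
      exact hp (by rw [h1]; exact le_top)
    · rw [h, pow_one] at h1; exact hp h1
  obtain ⟨s, hs⟩ : ∃ s, t = s + 2 := ⟨t - 2, by omega⟩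
  have h3 := h2 (s + 1) (by omega)
  obtain ⟨u, hu1, hu2⟩ := SetLike.not_le_iff_exists.1 h3
  refine ⟨u, Ideal.pow_le_self (by omega) hu1, hu2, fun v hv => h1 ?_⟩
  rw [hs, show s + 2 = (s + 1) + 1 by ring, pow_succ, mul_comm v u]
  exact Ideal.mul_mem_mul hu1 hv

lemma hs_tendsto {m : ℕ} {l : Fin m → MvPolynomial (Fin N) k} (h : LI l) (c : ℕ) :
    Tendsto (fun n : ℕ => (Nat.factorial (N - m) : ℝ) *
      (hilbertSamuelFn (Ideal.span (Set.range l)) (n - c) : ℝ) / (n : ℝ) ^ (N - m)) atTop (nhds 1) := by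
  set d := N - m with hd
  have hval : ∀ n : ℕ, (Nat.factorial d : ℝ) *
      (hilbertSamuelFn (Ideal.span (Set.range l)) (n + 1) : ℝ) = ((n + 1).ascFactorial d : ℝ) := by
    intro n
    rw [hs_LI h, Nat.ascFactorial_eq_factorial_mul_choose]
    push_cast
    rfl
  have hlim : ∀ a : ℝ, Tendsto (fun n : ℕ => (((n : ℝ) + a) / n) ^ d) atTop (nhds 1) := by
    intro a
    have h1 : Tendsto (fun n : ℕ => 1 + a / (n : ℝ)) atTop (nhds (1 + 0)) :=
      tendsto_const_nhds.add (tendsto_const_div_atTop_nhds_zero_nat a)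
    have h2 := h1.pow d
    simp only [add_zero, one_pow] at h2
    refine h2.congr' ?_
    filter_upwards [eventually_gt_atTop 0] with n hn
    have : (n : ℝ) ≠ 0 := by positivity
    congr 1
    field_simp
  refine tendsto_of_tendsto_of_tendsto_of_le_of_le' (hlim (-c)) (hlim d) ?_ ?_
  · filter_upwards [eventually_gt_atTop c] with n hn
    obtain ⟨j, rfl⟩ : ∃ j, n = c + (j + 1) := ⟨n - c - 1, by omega⟩
    rw [show c + (j + 1) - c = j + 1 by omega, hval, div_pow]
    gcongr
    have := Nat.pow_succ_le_ascFactorial (j + 1) d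
    have h2 : (((j + 1) ^ d : ℕ) : ℝ) ≤ ((j + 1).ascFactorial d : ℝ) := by exact_mod_cast this
    refine le_trans (le_of_eq ?_) h2
    push_cast; ring
  · filter_upwards [eventually_gt_atTop c] with n hn
    obtain ⟨j, rfl⟩ : ∃ j, n = c + (j + 1) := ⟨n - c - 1, by omega⟩
    rw [show c + (j + 1) - c = j + 1 by omega, hval, div_pow]
    gcongr
    have := Nat.ascFactorial_le_pow_add j d
    have h2 : ((j + 1).ascFactorial d : ℝ) ≤ (((j + d) ^ d : ℕ) : ℝ) := by exact_mod_cast this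
    refine h2.trans ?_
    push_cast
    gcongr
    linarith [(Nat.cast_nonneg c : (0 : ℝ) ≤ c)]
end

end

section

section
variable {k : Type} [Field k] {N : ℕ}

lemma no_three {x y : MvPolynomial (Fin N) k} (h : LI ![x, y]) (K : Ideal (MvPolynomial (Fin N) k))
    (he : HasMultiplicity K (N - 2) 2) (c₁ c₂ : ℕ)
    (hle : ∀ n, hilbertSamuelFn (Ideal.span {x, y}) (n - c₁) + (hilbertSamuelFn (Ideal.span {x, y}) (n - c₂)
      + hilbertSamuelFn (Ideal.span {x, y}) n) ≤ hilbertSamuelFn K n) : False := by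
  have hr : Set.range ![x, y] = {x, y} := by simp [Set.pair_comm]
  have h1 := hs_tendsto h c₁
  have h2 := hs_tendsto h c₂
  have h3 := hs_tendsto h 0
  rw [hr] at h1 h2 h3
  have h5 := le_of_tendsto_of_tendsto (h1.add (h2.add h3)) he (Eventually.of_forall (fun n => by
    have := hle n
    have h6 : ((hilbertSamuelFn (Ideal.span {x, y}) (n - c₁) : ℝ) + ((hilbertSamuelFn (Ideal.span {x, y}) (n - c₂) : ℝ)
      + (hilbertSamuelFn (Ideal.span {x, y}) n : ℝ))) ≤ (hilbertSamuelFn K n : ℝ) := by exact_mod_cast this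
    simp only [Nat.sub_zero]
    rw [← add_div, ← add_div, ← mul_add, ← mul_add]
    gcongr))
  norm_num at h5

lemma ne_of_mult {x y : MvPolynomial (Fin N) k} (h : LI ![x, y]) (K : Ideal (MvPolynomial (Fin N) k))
    (he : HasMultiplicity K (N - 2) 2) : K ≠ Ideal.span {x, y} := by
  rintro rfl
  have hr : Set.range ![x, y] = {x, y} := by simp [Set.pair_comm]
  have h3 := hs_tendsto h 0
  rw [hr] at h3
  have := tendsto_nhds_unique he h3
  norm_num at this

lemma sat_eq {x y : MvPolynomial (Fin N) k} (h : LI ![x, y]) (p K : Ideal (MvPolynomial (Fin N) k))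
    (hp : p = Ideal.span {x, y}) [hpp : p.IsPrime] (hK : K.IsPrimary) (hrad : K.radical = p)
    (he : HasMultiplicity K (N - 2) 2) (u : MvPolynomial (Fin N) k) (hup : u ∈ p) (hu : u ∉ K) :
    ∀ v ∈ p, ∃ s ∉ p, v * s ∈ K ⊔ Ideal.span {u} := by
  by_contra hcon
  have hKp : K ≤ p := by rw [← hrad]; exact Ideal.le_radical
  have hsat : ∀ r ∉ p, ∀ u, r * u ∈ K → u ∈ K := by
    intro r hr u hru
    rw [mul_comm] at hru
    refine ((Ideal.isPrimary_iff.1 hK).2 hru).resolve_right ?_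
    rw [hrad]; exact hr
  obtain ⟨c₁, h1⟩ := hs_step p K hsat u hu
  set K'' := primaryComponent (K ⊔ Ideal.span {u}) p with hK''
  have hm : ∀ r, r ∈ K'' ↔ ∃ s ∉ p, r * s ∈ K ⊔ Ideal.span {u} := fun r => mem_primaryComponent _ p r
  have h1p : (1 : MvPolynomial (Fin N) k) ∉ p := fun h => hpp.ne_top ((Ideal.eq_top_iff_one _).2 h)
  have hKup : K ⊔ Ideal.span {u} ≤ p := sup_le hKp (by rwa [Ideal.span_singleton_le_iff_mem])
  have hle : K ⊔ Ideal.span {u} ≤ K'' := fun r hr => (hm r).2 ⟨1, h1p, by simpa using hr⟩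
  have hK''p : K'' ≤ p := by
    intro r hr
    obtain ⟨s, hs, hrs⟩ := (hm r).1 hr
    exact (hpp.mem_or_mem (hKup hrs)).resolve_right hs
  have hsat'' : ∀ r ∉ p, ∀ u, r * u ∈ K'' → u ∈ K'' := by
    intro r hr v hrv
    obtain ⟨s, hs, hrs⟩ := (hm _).1 hrv
    refine (hm v).2 ⟨r * s, fun hh => (hpp.mem_or_mem hh).elim hr hs, ?_⟩
    have : v * (r * s) = r * v * s := by ring
    rwa [this]
  have hnle : ¬ p ≤ K'' := fun hh => hcon (fun v hv => (hm v).1 (hh hv))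
  obtain ⟨T, hT⟩ := Ideal.exists_pow_le_of_le_radical_of_fg (I := p) (J := K) (by rw [hrad])
    (IsNoetherian.noetherian p)
  obtain ⟨u', hu'1, hu'2, hu'3⟩ := exists_socle (hT.trans (le_sup_left.trans hle)) hnle
  obtain ⟨c₂, h2⟩ := hs_step p K'' hsat'' u' hu'2
  refine no_three h K he c₁ c₂ ?_
  intro n
  rw [← hp]
  have e1 := h1 n
  have e2 := h2 n
  have e3 := hs_mono hle n
  have e4 : hilbertSamuelFn p n ≤ hilbertSamuelFn (K'' ⊔ Ideal.span {u'}) n :=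
    hs_mono (sup_le hK''p (by rwa [Ideal.span_singleton_le_iff_mem])) n
  omega

lemma exists_KS {x y : MvPolynomial (Fin N) k} (h : LI ![x, y]) (p K : Ideal (MvPolynomial (Fin N) k))
    (hp : p = Ideal.span {x, y}) (hpp : p.IsPrime) (hK : K.IsPrimary) (hrad : K.radical = p)
    (he : HasMultiplicity K (N - 2) 2) : ∃ a b, KS p K x y a b := by
  have hKp : K ≤ p := by rw [← hrad]; exact Ideal.le_radical
  have hne : K ≠ p := by rw [hp]; exact ne_of_mult h K he
  obtain ⟨T, hT⟩ := Ideal.exists_pow_le_of_le_radical_of_fg (I := p) (J := K) (by rw [hrad])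
    (IsNoetherian.noetherian p)
  obtain ⟨u, hu1, hu2, hu3⟩ := exists_socle hT (fun hh => hne (le_antisymm hKp hh))
  have hsq : p * p ≤ K := by
    rw [Ideal.mul_le]
    intro v hv w hw
    obtain ⟨s, hs, hsv⟩ := sat_eq h p K hp hK hrad he u hu1 hu2 v hv
    have h1 : v * w * s ∈ K := by
      obtain ⟨κ, hκ, b, hb, e⟩ := Submodule.mem_sup.1 hsv
      obtain ⟨r, rfl⟩ := Ideal.mem_span_singleton'.1 hb
      have : v * w * s = κ * w + r * (w * u) := by
        have : v * w * s = (v * s) * w := by ring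
        rw [this, ← e]; ring
      rw [this]
      exact K.add_mem (K.mul_mem_right _ hκ) (K.mul_mem_left _ (hu3 w hw))
    refine ((Ideal.isPrimary_iff.1 hK).2 h1).resolve_right ?_
    rw [hrad]; exact hs
  refine KS_of_primary p K x y hp hK hrad hsq hne ?_
  intro hle
  have hx : x ∈ p := by rw [hp]; exact Ideal.subset_span (by simp)
  have hy : y ∈ p := by rw [hp]; exact Ideal.subset_span (by simp)
  have hxs : Ideal.span {x} = Ideal.span (![x, y] '' {0}) := by simp
  have hxp : (Ideal.span {x}).IsPrime := by rw [hxs]; exact h.prime _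
  have hyx : y ∉ Ideal.span {x} := by
    rw [hxs]; exact h.not_mem (A := {0}) (i := 1) (by simp)
  have hpp2 : ∀ t ∈ p * p, ∃ r, t - r * (y * y) ∈ Ideal.span {x} := by
    intro t ht
    have : p * p ≤ Ideal.span {x} ⊔ Ideal.span {y * y} := by
      rw [hp, Ideal.span_mul_span', Ideal.span_le]
      rintro _ ⟨a, (rfl | rfl), b, (rfl | rfl), rfl⟩
      · exact Ideal.mem_sup_left (Ideal.mul_mem_left _ _ (Ideal.mem_span_singleton_self _))
      · exact Ideal.mem_sup_left (Ideal.mul_mem_right _ _ (Ideal.mem_span_singleton_self _))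
      · exact Ideal.mem_sup_left (Ideal.mul_mem_left _ _ (Ideal.mem_span_singleton_self _))
      · exact Ideal.mem_sup_right (Ideal.mem_span_singleton_self _)
    obtain ⟨a, ha, b, hb, rfl⟩ := Submodule.mem_sup.1 (this ht)
    obtain ⟨r, rfl⟩ := Ideal.mem_span_singleton'.1 hb
    exact ⟨r, by simpa using ha⟩
  have hxK : x ∉ K := by
    intro hxK
    -- x ∈ p², degree reasons replaced by y-regularity
    have hys : Ideal.span {y} = Ideal.span (![x, y] '' {1}) := by simp
    have hyp : (Ideal.span {y}).IsPrime := by rw [hys]; exact h.prime _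
    have hxy : x ∉ Ideal.span {y} := by
      rw [hys]; exact h.not_mem (A := {1}) (i := 0) (by simp)
    have : p * p ≤ Ideal.span {y} ⊔ Ideal.span {x * x} := by
      rw [hp, Ideal.span_mul_span', Ideal.span_le]
      rintro _ ⟨a, (rfl | rfl), b, (rfl | rfl), rfl⟩
      · exact Ideal.mem_sup_right (Ideal.mem_span_singleton_self _)
      · exact Ideal.mem_sup_left (Ideal.mul_mem_left _ _ (Ideal.mem_span_singleton_self _))
      · exact Ideal.mem_sup_left (Ideal.mul_mem_right _ _ (Ideal.mem_span_singleton_self _))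
      · exact Ideal.mem_sup_left (Ideal.mul_mem_left _ _ (Ideal.mem_span_singleton_self _))
    obtain ⟨a, ha, b, hb, e⟩ := Submodule.mem_sup.1 (this (hle hxK))
    obtain ⟨r, rfl⟩ := Ideal.mem_span_singleton'.1 hb
    have h1 : (1 - r * x) * x ∈ Ideal.span {y} := by
      have : (1 - r * x) * x = a := by
        have : (1 - r * x) * x = x - r * (x * x) := by ring
        rw [this]; nth_rewrite 1 [← e]; ring
      rw [this]; exact ha
    have h2 := (hyp.mem_or_mem h1).resolve_right hxy
    have h3 : Ideal.span {y} ≤ p := by rwa [Ideal.span_singleton_le_iff_mem]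
    have h4 := p.add_mem (h3 h2) (p.mul_mem_left r hx)
    exact hpp.ne_top ((Ideal.eq_top_iff_one _).2 (by simpa using h4))
  obtain ⟨s, hs, hsy⟩ := sat_eq h p K hp hK hrad he x hx hxK y hy
  obtain ⟨κ, hκ, b, hb, e⟩ := Submodule.mem_sup.1 hsy
  obtain ⟨r, hr⟩ := hpp2 κ (hle hκ)
  have h1 : y * (s - r * y) ∈ Ideal.span {x} := by
    have : y * (s - r * y) = (κ - r * (y * y)) + b := by
      have : y * (s - r * y) = y * s - r * (y * y) := by ring
      rw [this, ← e]; ring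
    rw [this]; exact Ideal.add_mem _ hr hb
  have h2 := (hxp.mem_or_mem h1).resolve_left hyx
  have h3 : Ideal.span {x} ≤ p := by rwa [Ideal.span_singleton_le_iff_mem]
  have h4 := p.add_mem (h3 h2) (p.mul_mem_left r hy)
  exact hs (by simpa using h4)
end

end

section

section
variable {k : Type} [Field k] {N : ℕ}

lemma rename_flat {m : ℕ} (ι : Fin m ↪ Fin N) :
    (rename (R := k) ι).toRingHom.Flat := by
  classical
  let e : {i // i ∉ Set.range ι} ⊕ Fin m ≃ Fin N :=
    (Equiv.sumCongr (Equiv.refl _) (Equiv.ofInjective ι ι.injective)).trans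
      ((Equiv.sumComm _ _).trans (Equiv.Set.sumCompl (Set.range ι)))
  let E : MvPolynomial {i // i ∉ Set.range ι} (MvPolynomial (Fin m) k) ≃+* MvPolynomial (Fin N) k :=
    (sumRingEquiv k {i // i ∉ Set.range ι} (Fin m)).symm.trans (renameEquiv k e).toRingEquiv
  have h : (rename (R := k) ι).toRingHom = E.toRingHom.comp
      (algebraMap (MvPolynomial (Fin m) k) (MvPolynomial {i // i ∉ Set.range ι} (MvPolynomial (Fin m) k))) := by
    apply MvPolynomial.ringHom_ext
    · intro r
      simp [E, MvPolynomial.algebraMap_eq]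
    · intro i
      simp [E, MvPolynomial.algebraMap_eq, e]
      rfl
  rw [h]
  exact RingHom.Flat.comp (RingHom.flat_algebraMap_iff.2 inferInstance) (RingHom.Flat.of_bijective E.bijective)

lemma LI.flat {m : ℕ} {l : Fin m → MvPolynomial (Fin N) k} (h : LI l) :
    (aeval (R := k) l).toRingHom.Flat := by
  obtain ⟨φ, ι, h1, -, -⟩ := exists_coord l h.hom h.li
  have : (aeval (R := k) l).toRingHom = (φ.toRingEquiv.toRingHom).comp (rename (R := k) ι).toRingHom := by
    apply MvPolynomial.ringHom_ext
    · intro r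
      simpa using (φ.commutes r).symm
    · intro i
      simp [h1]
  rw [this]
  exact RingHom.Flat.comp (rename_flat ι) (RingHom.Flat.of_bijective φ.bijective)

/-- equational criterion for flat ring homs -/
lemma flat_rel {S R : Type} [CommRing S] [CommRing R] {θ : S →+* R} (hθ : θ.Flat) {n : ℕ}
    (s : Fin n → S) (r : Fin n → R) (h : ∑ i, θ (s i) * r i = 0) :
    ∃ (κ : ℕ) (a : Fin n → Fin κ → S) (y : Fin κ → R), (∀ i, r i = ∑ j, θ (a i j) * y j) ∧
      ∀ j, ∑ i, s i * a i j = 0 := by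
  let _ := θ.toAlgebra
  have hf : Module.Flat S R := hθ
  obtain ⟨κ, a, y, h1, h2⟩ := Module.Flat.isTrivialRelation_of_sum_smul_eq_zero (R := S) (M := R) (f := s) (x := r) (by
    simpa [Algebra.smul_def, RingHom.algebraMap_toAlgebra] using h)
  exact ⟨κ, a, y, by simpa [Algebra.smul_def, RingHom.algebraMap_toAlgebra] using h1, h2⟩


lemma flat_colon {S R : Type} [CommRing S] [IsNoetherianRing S] [CommRing R] {θ : S →+* R} (hθ : θ.Flat)
    (J M : Ideal S) (u : S) (hM : ∀ c, c * u ∈ J → c ∈ M) (r : R) (hr : r * θ u ∈ J.map θ) :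
    r ∈ M.map θ := by
  obtain ⟨n, g, hg⟩ := Submodule.fg_iff_exists_fin_generating_family.1 (IsNoetherian.noetherian J)
  change Ideal.span (Set.range g) = J at hg
  rw [← hg, Ideal.map_span, ← Set.range_comp, Ideal.mem_span_range_iff_exists_fun] at hr
  obtain ⟨c, hc⟩ := hr
  obtain ⟨κ, a, y, h1, h2⟩ := flat_rel hθ (Fin.cons u g : Fin (n + 1) → S) (Fin.cons r (fun i => - c i)) (by
    rw [Fin.sum_univ_succ]
    simp only [Fin.cons_zero, Fin.cons_succ, mul_neg, Finset.sum_neg_distrib]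
    rw [mul_comm, ← hc, ← sub_eq_add_neg, sub_eq_zero]
    exact Finset.sum_congr rfl fun i _ => mul_comm _ _)
  have h10 := h1 0
  rw [Fin.cons_zero] at h10
  rw [h10]
  refine Ideal.sum_mem _ fun j _ => Ideal.mul_mem_right _ _ (Ideal.mem_map_of_mem _ (hM _ ?_))
  have := h2 j
  rw [Fin.sum_univ_succ] at this
  simp only [Fin.cons_zero, Fin.cons_succ] at this
  rw [mul_comm, eq_neg_of_add_eq_zero_left this]
  refine J.neg_mem (Ideal.sum_mem _ fun i _ => Ideal.mul_mem_right _ _ ?_)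
  rw [← hg]; exact Ideal.subset_span ⟨i, rfl⟩

lemma vars_dich {σ : Type} (c : MvPolynomial σ k) : ∃ a : k, c - C a ∈ Ideal.span (Set.range (X : σ → MvPolynomial σ k)) := by
  induction c using MvPolynomial.induction_on with
  | C a => exact ⟨a, by simp⟩
  | add p q hp hq =>
    obtain ⟨a, ha⟩ := hp
    obtain ⟨b, hb⟩ := hq
    refine ⟨a + b, ?_⟩
    have := Ideal.add_mem _ ha hb
    rw [C_add]
    convert this using 1; ring
  | mul_X p i _ => exact ⟨0, by rw [C_0, sub_zero]; exact Ideal.mul_mem_left _ _ (Ideal.subset_span ⟨i, rfl⟩)⟩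

lemma LI.ext_pd {m : ℕ} {l : Fin m → MvPolynomial (Fin N) k} (h : LI l) (n : ℕ) (J : Ideal (MvPolynomial (Fin m) k))
    (hn : (Ideal.span (Set.range (X : Fin m → MvPolynomial (Fin m) k))) ^ n ≤ J) :
    PD (MvPolynomial (Fin N) k) m (MvPolynomial (Fin N) k ⧸ J.map (aeval (R := k) l).toRingHom) := by
  have hmap : (Ideal.span (Set.range (X : Fin m → MvPolynomial (Fin m) k))).map (aeval (R := k) l).toRingHom
      = Ideal.span (l '' (Finset.univ : Finset (Fin m))) := by
    rw [Ideal.map_span, ← Set.range_comp]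
    congr 1
    ext f
    simp
  have hpm : PD (MvPolynomial (Fin N) k) m (MvPolynomial (Fin N) k ⧸
      (Ideal.span (Set.range (X : Fin m → MvPolynomial (Fin m) k))).map (aeval (R := k) l).toRingHom) := by
    have := h.pd Finset.univ
    rw [Finset.card_univ, Fintype.card_fin] at this
    exact this.eq hmap.symm
  induction J using WellFoundedGT.induction with
  | ind J ih =>
    have hkey : ∀ u, u ∉ J → ∀ c, c * u ∈ J → (∀ v ∈ Ideal.span (Set.range (X : Fin m → MvPolynomial (Fin m) k)), v * u ∈ J) →
      c ∈ Ideal.span (Set.range (X : Fin m → MvPolynomial (Fin m) k)) := by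
      intro u hu c hc hv
      obtain ⟨a, ha⟩ := vars_dich c
      by_cases h0 : a = 0
      · simpa [h0] using ha
      · exfalso
        apply hu
        have h1 := hv _ ha
        have h2 := J.sub_mem hc h1
        have h3 := J.mul_mem_left (C a⁻¹) h2
        have : C a⁻¹ * (c * u - (c - C a) * u) = (C (a⁻¹ * a) : MvPolynomial (Fin m) k) * u := by
          rw [C_mul]; ring
        rw [this, inv_mul_cancel₀ h0] at h3
        simpa using h3
    by_cases hm : Ideal.span (Set.range (X : Fin m → MvPolynomial (Fin m) k)) ≤ J
    · by_cases h1 : (1 : MvPolynomial (Fin m) k) ∈ J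
      · have : J.map (aeval (R := k) l).toRingHom = ⊤ := by
          rw [Ideal.eq_top_iff_one]
          simpa using Ideal.mem_map_of_mem (aeval (R := k) l).toRingHom h1
        exact (PD.top m).eq this.symm
      · have : J = Ideal.span (Set.range (X : Fin m → MvPolynomial (Fin m) k)) := by
          refine le_antisymm (fun c hc => ?_) hm
          exact hkey 1 h1 c (by simpa using hc) (fun v hv => by simpa using hm hv)
        rw [this]; exact hpm
    · obtain ⟨u, -, hu2, hu3⟩ := exists_socle hn hm
      have hlt : J < J ⊔ Ideal.span {u} := by
        refine lt_of_le_of_ne le_sup_left fun e => hu2 ?_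
        rw [e]; exact Ideal.mem_sup_right (Ideal.mem_span_singleton_self u)
      have := ih _ hlt (hn.trans le_sup_left)
      rw [Ideal.map_sup, Ideal.map_span, Set.image_singleton] at this
      refine PD.colon _ _ (hpm.eq ?_) this
      ext r
      rw [mem_colon_single]
      constructor
      · intro hr
        refine (Ideal.map_le_iff_le_comap.2 ?_ : _ ≤ (J.map (aeval (R := k) l).toRingHom).colon
          (Ideal.span {(aeval (R := k) l).toRingHom u})) hr |> fun h => (mem_colon_single _ _ _).1 h
        intro v hv
        rw [Ideal.mem_comap, mem_colon_single, ← map_mul]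
        exact Ideal.mem_map_of_mem _ (hu3 v hv)
      · intro hr
        exact flat_colon h.flat J _ u (fun c hc => hkey u hu2 c hc hu3) r hr


lemma KS.change {R : Type} [CommRing R] {p K : Ideal R} {x y a b : R} [hp : p.IsPrime] (h : KS p K x y a b)
    {a' b' : R} (h1 : a' ∉ p ∨ b' ∉ p) (h2 : a' * b - b' * a ∈ p) : KS p K x y a' b' where
  hp := h.hp
  le := h.le
  sq := h.sq
  ab := h1
  iff u v := by
    rw [h.iff]
    constructor
    · intro hu
      rcases h.ab with ha | ha
      · refine (hp.mem_or_mem (?_ : a * (u * b' - v * a') ∈ p)).resolve_left ha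
        have := p.sub_mem (p.mul_mem_left a' hu) (p.mul_mem_left u h2)
        convert this using 1; ring
      · refine (hp.mem_or_mem (?_ : b * (u * b' - v * a') ∈ p)).resolve_left ha
        have := p.sub_mem (p.mul_mem_left b' hu) (p.mul_mem_left v h2)
        convert this using 1; ring
    · intro hu
      rcases h1 with ha | ha
      · refine (hp.mem_or_mem (?_ : a' * (u * b - v * a) ∈ p)).resolve_left ha
        have := p.add_mem (p.mul_mem_left a hu) (p.mul_mem_left u h2)
        convert this using 1; ring
      · refine (hp.mem_or_mem (?_ : b' * (u * b - v * a) ∈ p)).resolve_left ha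
        have := p.add_mem (p.mul_mem_left b hu) (p.mul_mem_left v h2)
        convert this using 1; ring

/-- an ideal generated by elements of the image of `θ` -/
def Extd {S R : Type} [CommRing S] [CommRing R] (θ : S →+* R) (K : Ideal R) : Prop :=
  K ≤ (K.comap θ).map θ

lemma KS.extd {S R : Type} [CommRing S] [CommRing R] {θ : S →+* R} (hθ : θ.Flat) {p K : Ideal R}
    {x y a b : S} (h : KS p K (θ x) (θ y) (θ a) (θ b)) : Extd θ K := by
  intro r hr
  have hrp := h.le hr
  rw [h.hp, Ideal.mem_span_pair] at hrp
  obtain ⟨u, v, rfl⟩ := hrp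
  have h1 := (h.iff u v).1 hr
  rw [h.hp, Ideal.mem_span_pair] at h1
  obtain ⟨s, t, hst⟩ := h1
  obtain ⟨κ, A, Y, h2, h3⟩ := flat_rel hθ ![b, -a, -x, -y] ![u, v, s, t] (by
    simp [Fin.sum_univ_succ]
    linear_combination -hst)
  have hu := h2 0
  have hv := h2 1
  simp only [Matrix.cons_val_zero, Matrix.cons_val_one] at hu hv
  have : u * θ x + v * θ y = ∑ j, θ (A 0 j * x + A 1 j * y) * Y j := by
    rw [hu, hv, Finset.sum_mul, Finset.sum_mul, ← Finset.sum_add_distrib]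
    refine Finset.sum_congr rfl fun j _ => ?_
    rw [map_add, map_mul, map_mul]; ring
  rw [this]
  refine Ideal.sum_mem _ fun j _ => Ideal.mul_mem_right _ _ (Ideal.mem_map_of_mem _ ?_)
  rw [Ideal.mem_comap, map_add, map_mul, map_mul, h.iff, h.hp, Ideal.mem_span_pair]
  refine ⟨θ (A 2 j), θ (A 3 j), ?_⟩
  have h4 := congrArg θ (h3 j)
  simp [Fin.sum_univ_succ] at h4
  linear_combination -h4

lemma Extd.span {S R : Type} [CommRing S] [CommRing R] (θ : S →+* R) (T : Set S) :
    Extd θ (Ideal.span (θ '' T)) := by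
  unfold Extd
  rw [← Ideal.map_span]
  exact Ideal.map_mono Ideal.le_comap_map

lemma LI.extd_pd {x y z w : MvPolynomial (Fin N) k} (h : LI ![x, y, z, w]) {A B : Ideal (MvPolynomial (Fin N) k)}
    (hA : Extd (aeval (R := k) ![x, y, z, w]).toRingHom A) (hB : Extd (aeval (R := k) ![x, y, z, w]).toRingHom B)
    (hx : x * x ∈ A) (hy : y * y ∈ A) (hz : z * z ∈ B) (hw : w * w ∈ B) :
    PD (MvPolynomial (Fin N) k) 4 (MvPolynomial (Fin N) k ⧸ (A ⊔ B)) := by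
  set θ := (aeval (R := k) ![x, y, z, w]).toRingHom with hθ
  have e : (A.comap θ ⊔ B.comap θ).map θ = A ⊔ B := by
    rw [Ideal.map_sup]
    exact le_antisymm (sup_le_sup Ideal.map_comap_le Ideal.map_comap_le) (sup_le_sup hA hB)
  have hrad : Ideal.span (Set.range (X : Fin 4 → MvPolynomial (Fin 4) k)) ≤ (A.comap θ ⊔ B.comap θ).radical := by
    rw [Ideal.span_le]
    rintro _ ⟨i, rfl⟩
    refine ⟨2, ?_⟩
    rw [pow_two]
    fin_cases i
    · refine Ideal.mem_sup_left ?_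
      rw [Ideal.mem_comap]; simpa [hθ] using hx
    · refine Ideal.mem_sup_left ?_
      rw [Ideal.mem_comap]; simpa [hθ] using hy
    · refine Ideal.mem_sup_right ?_
      rw [Ideal.mem_comap]; simpa [hθ] using hz
    · refine Ideal.mem_sup_right ?_
      rw [Ideal.mem_comap]; simpa [hθ] using hw
  obtain ⟨n, hn⟩ := Ideal.exists_pow_le_of_le_radical_of_fg hrad (IsNoetherian.noetherian _)
  exact (h.ext_pd n _ hn).eq e

end

end

section

section

lemma caseA4_abs {R : Type} [CommRing R] (p K K' P Q : Ideal R) [p.IsPrime] [UniqueFactorizationMonoid (R ⧸ p)]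
    {z w c d : R} (h : KS p K z w c d) (hQ : Q = K' ⊔ p) (hPQ : P * P ≤ Q)
    (hprim : ∀ s r, s * r ∈ Q → s ∈ P ∨ r ∈ Q)
    (hreg : ∀ r ∈ K', r ∈ p → ∃ u ∈ K', ∃ v ∈ K', r = u * z + v * w)
    (hpQ : PD R 4 (R ⧸ Q)) (hpP : PD R 4 (R ⧸ P)) : PD R 5 (R ⧸ (K' ⊔ K)) := by
  obtain ⟨v, -, hv⟩ := HH_struct p c d h.ab
  have hcomap : Submodule.comap (lin2 z w) (K' ⊔ K) = (Submodule.prod Q Q : Submodule R (R × R)) ⊔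
        LinearMap.range (LinearMap.toSpanSingleton R (R × R) v) := by
    apply le_antisymm
    · rintro ⟨s, t⟩ hst
      simp only [Submodule.mem_comap, lin2_apply, smul_eq_mul] at hst
      obtain ⟨k1, hk1, k2, hk2, e⟩ := Submodule.mem_sup.1 hst
      have hk1p : k1 ∈ p := by
        have : k1 = (s * z + t * w) - k2 := by rw [← e]; ring
        rw [this]
        refine p.sub_mem ?_ (h.le hk2)
        rw [h.hp, Ideal.mem_span_pair]; exact ⟨s, t, rfl⟩
      obtain ⟨s', hs', t', ht', e'⟩ := hreg k1 hk1 hk1p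
      have h2 : ((s - s', t - t') : R × R) ∈ HH p c d := by
        rw [mem_HH, ← h.iff]
        convert hk2 using 1
        linear_combination -e + e'
      rw [hv] at h2
      have h3 : ((s', t') : R × R) ∈ (Submodule.prod Q Q : Submodule R (R × R)) :=
        ⟨hQ ▸ Ideal.mem_sup_left hs', hQ ▸ Ideal.mem_sup_left ht'⟩
      have h4 : (Submodule.prod p p : Submodule R (R × R)) ≤ Submodule.prod Q Q :=
        Submodule.prod_mono (hQ ▸ le_sup_right) (hQ ▸ le_sup_right)
      have h5 := Submodule.add_mem _ (sup_le_sup_right h4 _ h2) (Submodule.mem_sup_left h3 (T := LinearMap.range (LinearMap.toSpanSingleton R (R × R) v)))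
      simpa using h5
    · have h1 : HH p c d ≤ Submodule.comap (lin2 z w) (K' ⊔ K) := by
        rintro ⟨s, t⟩ hst
        simp only [Submodule.mem_comap, lin2_apply, smul_eq_mul]
        exact Ideal.mem_sup_right ((h.iff s t).2 hst)
      rw [hv] at h1
      refine sup_le ?_ (le_sup_right.trans h1)
      rintro ⟨s, t⟩ ⟨hs, ht⟩
      simp only [hQ] at hs ht
      obtain ⟨s1, hs1, s2, hs2, rfl⟩ := Submodule.mem_sup.1 hs
      obtain ⟨t1, ht1, t2, ht2, rfl⟩ := Submodule.mem_sup.1 ht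
      have h2 := h1 (Submodule.mem_sup_left (show ((s2, t2) : R × R) ∈ Submodule.prod p p from ⟨hs2, ht2⟩))
      simp only [Submodule.mem_comap, lin2_apply, smul_eq_mul] at h2 ⊢
      have h3 := Ideal.add_mem _ (Ideal.mem_sup_left (T := K) (K'.add_mem (K'.mul_mem_right z hs1) (K'.mul_mem_right w ht1))) h2
      convert h3 using 1; ring
  refine PD.tower (R := R) (M := R) (N := R × R) (K' ⊔ K) Q (lin2 z w) ?_ ?_ (hpQ.mono (by omega))
  · rw [range_lin2, ← h.hp, hQ, sup_assoc, sup_eq_right.2 h.le]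
  rw [hcomap]
  refine PD.tower' (n := 4) (Submodule.prod Q Q) _ (LinearMap.toSpanSingleton R (R × R) v) rfl ?_
    ((PD_prod_quot Q hpQ).mono (by omega))
  have hmem : ∀ t, t ∈ Submodule.comap (LinearMap.toSpanSingleton R (R × R) v) (Submodule.prod Q Q) ↔
      t * v.1 ∈ Q ∧ t * v.2 ∈ Q := by
    intro t
    simp only [Submodule.mem_comap, LinearMap.toSpanSingleton_apply, Submodule.mem_prod,
      Prod.smul_fst, Prod.smul_snd, smul_eq_mul]
  by_cases h1 : v.1 ∈ P ∧ v.2 ∈ P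
  · by_cases h2 : v.1 ∈ Q ∧ v.2 ∈ Q
    · refine (PD.top 4).eq (I := ⊤) ?_
      ext t
      refine Iff.trans ?_ (hmem t).symm
      simp [Q.mul_mem_left t h2.1, Q.mul_mem_left t h2.2]
    · refine hpP.eq ?_
      ext t
      refine Iff.trans ?_ (hmem t).symm
      constructor
      · intro ht
        exact ⟨hPQ (Ideal.mul_mem_mul ht h1.1), hPQ (Ideal.mul_mem_mul ht h1.2)⟩
      · rintro ⟨ha, hb⟩
        by_contra ht
        exact h2 ⟨(hprim _ _ ha).resolve_left ht, (hprim _ _ hb).resolve_left ht⟩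
  · refine hpQ.eq ?_
    ext t
    refine Iff.trans ?_ (hmem t).symm
    constructor
    · intro ht
      exact ⟨Q.mul_mem_right _ ht, Q.mul_mem_right _ ht⟩
    · rintro ⟨ha, hb⟩
      by_contra ht
      exact h1 ⟨(hprim _ _ (mul_comm t v.1 ▸ ha)).resolve_right ht, (hprim _ _ (mul_comm t v.2 ▸ hb)).resolve_right ht⟩


lemma caseA4_lin0 {R : Type} [CommRing R] (p q P K : Ideal R) [hp : p.IsPrime] [UniqueFactorizationMonoid (R ⧸ p)]
    [hq : q.IsPrime] [hP : P.IsPrime] {x y z w c d : R} (h : KS p K z w c d)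
    (hqe : q = p ⊔ Ideal.span {x}) (hPe : P = q ⊔ Ideal.span {y}) (hx : x ∉ p) (hy : y ∉ q)
    (hpq : PD R 3 (R ⧸ q)) (hpP : PD R 4 (R ⧸ P)) : PD R 5 (R ⧸ (Ideal.span {x, y * y} ⊔ K)) := by
  have hQ1 : Ideal.span {x, y * y} ⊔ p = q ⊔ Ideal.span {y * y} := by
    rw [hqe, Ideal.span_insert, sup_comm p, sup_right_comm]
  have hxq : x ∈ q := hqe ▸ Ideal.mem_sup_right (Ideal.mem_span_singleton_self x)
  have hpleq : p ≤ q := hqe ▸ le_sup_left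
  have hqP : q ≤ P := hPe ▸ le_sup_left
  have hyP : y ∈ P := hPe ▸ Ideal.mem_sup_right (Ideal.mem_span_singleton_self y)
  refine caseA4_abs p K (Ideal.span {x, y * y}) P _ h rfl ?_ ?_ ?_ ?_ hpP
  · rw [hQ1, Ideal.mul_le]
    intro r hr s hs
    rw [hPe] at hr hs
    obtain ⟨r1, hr1, r2, hr2, rfl⟩ := Submodule.mem_sup.1 hr
    obtain ⟨s1, hs1, s2, hs2, rfl⟩ := Submodule.mem_sup.1 hs
    obtain ⟨r3, rfl⟩ := Ideal.mem_span_singleton'.1 hr2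
    obtain ⟨s3, rfl⟩ := Ideal.mem_span_singleton'.1 hs2
    have h1 : r1 * (s1 + s3 * y) + r3 * y * s1 ∈ q := q.add_mem (q.mul_mem_right _ hr1) (q.mul_mem_left _ hs1)
    have h2 : (r3 * s3) * (y * y) ∈ Ideal.span {y * y} := Ideal.mul_mem_left _ _ (Ideal.mem_span_singleton_self _)
    have := Submodule.add_mem_sup h1 h2
    convert this using 1; ring
  · intro s r hsr
    by_cases hs : s ∈ P
    · exact Or.inl hs
    right
    rw [hQ1] at hsr ⊢
    obtain ⟨q1, hq1, e1, he1, e⟩ := Submodule.mem_sup.1 hsr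
    obtain ⟨t, rfl⟩ := Ideal.mem_span_singleton'.1 he1
    have hr : r ∈ P := by
      refine (hP.mem_or_mem (?_ : s * r ∈ P)).resolve_left hs
      rw [← e]
      exact P.add_mem (hqP hq1) (P.mul_mem_left _ (P.mul_mem_left _ hyP))
    rw [hPe] at hr
    obtain ⟨r1, hr1, r2, hr2, rfl⟩ := Submodule.mem_sup.1 hr
    obtain ⟨r3, rfl⟩ := Ideal.mem_span_singleton'.1 hr2
    have h3 : s * r3 - t * y ∈ q := by
      refine (hq.mem_or_mem (?_ : (s * r3 - t * y) * y ∈ q)).resolve_right hy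
      have : (s * r3 - t * y) * y = q1 - s * r1 := by linear_combination -e
      rw [this]
      exact q.sub_mem hq1 (q.mul_mem_left _ hr1)
    have h4 : r3 ∈ P := by
      refine (hP.mem_or_mem (?_ : s * r3 ∈ P)).resolve_left hs
      have := P.add_mem (hqP h3) (P.mul_mem_left t hyP)
      simpa using this
    rw [hPe] at h4
    obtain ⟨r4, hr4, r5, hr5, rfl⟩ := Submodule.mem_sup.1 h4
    obtain ⟨r6, rfl⟩ := Ideal.mem_span_singleton'.1 hr5
    have h5 : r1 + r4 * y ∈ q := q.add_mem hr1 (q.mul_mem_right _ hr4)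
    have h6 : r6 * (y * y) ∈ Ideal.span {y * y} := Ideal.mul_mem_left _ _ (Ideal.mem_span_singleton_self _)
    have := Submodule.add_mem_sup h5 h6
    convert this using 1; ring
  · intro r hr hrp
    obtain ⟨α, β, rfl⟩ := Ideal.mem_span_pair.1 hr
    have h1 : β ∈ q := by
      refine (hq.mem_or_mem (?_ : β * (y * y) ∈ q)).resolve_right (fun h => hy ((hq.mem_or_mem h).elim id id))
      have := q.sub_mem (hpleq hrp) (q.mul_mem_left α hxq)
      convert this using 1; ring
    rw [hqe] at h1
    obtain ⟨b1, hb1, b2, hb2, rfl⟩ := Submodule.mem_sup.1 h1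
    obtain ⟨t, rfl⟩ := Ideal.mem_span_singleton'.1 hb2
    have h2 : α + t * (y * y) ∈ p := by
      refine (hp.mem_or_mem (?_ : (α + t * (y * y)) * x ∈ p)).resolve_right hx
      have := p.sub_mem hrp (p.mul_mem_right (y * y) hb1)
      convert this using 1; ring
    rw [h.hp] at h2 hb1
    obtain ⟨a1, a2, ha⟩ := Ideal.mem_span_pair.1 h2
    obtain ⟨c1, c2, hc⟩ := Ideal.mem_span_pair.1 hb1
    refine ⟨a1 * x + c1 * (y * y), Ideal.mem_span_pair.2 ⟨_, _, rfl⟩, a2 * x + c2 * (y * y), Ideal.mem_span_pair.2 ⟨_, _, rfl⟩, ?_⟩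
    linear_combination -x * ha - y * y * hc
  · rw [hQ1]
    refine PD.nzd q (y * y) (fun r hr => (hq.mem_or_mem hr).resolve_right (fun h => hy ((hq.mem_or_mem h).elim id id))) hpq

variable {k : Type} [Field k] {N : ℕ}

lemma caseA4_lin {x y z w c d : MvPolynomial (Fin N) k} (h : LI ![x, y, z, w]) {p K K' : Ideal (MvPolynomial (Fin N) k)}
    (hK : KS p K z w c d) (hK' : K' = Ideal.span {x, y * y}) :
    PD (MvPolynomial (Fin N) k) 5 (MvPolynomial (Fin N) k ⧸ (K' ⊔ K)) := by
  subst hK'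
  have e2 : Ideal.span (![x, y, z, w] '' (({2, 3} : Finset (Fin 4)) : Set (Fin 4))) = Ideal.span {z, w} := by
    congr 1; simp [Set.image_insert_eq]
  have e3 : Ideal.span (![x, y, z, w] '' (({0, 2, 3} : Finset (Fin 4)) : Set (Fin 4))) = Ideal.span {x, z, w} := by
    congr 1; simp [Set.image_insert_eq]
  have e4 : Ideal.span (![x, y, z, w] '' (({0, 1, 2, 3} : Finset (Fin 4)) : Set (Fin 4))) = Ideal.span {x, y, z, w} := by
    congr 1; simp [Set.image_insert_eq]
  have p2 : (Ideal.span {z, w}).IsPrime := e2 ▸ h.prime (({2, 3} : Finset (Fin 4)) : Set (Fin 4))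
  have p3 : (Ideal.span {x, z, w}).IsPrime := e3 ▸ h.prime (({0, 2, 3} : Finset (Fin 4)) : Set (Fin 4))
  have p4 : (Ideal.span {x, y, z, w}).IsPrime := e4 ▸ h.prime (({0, 1, 2, 3} : Finset (Fin 4)) : Set (Fin 4))
  have u2 : UniqueFactorizationMonoid (MvPolynomial (Fin N) k ⧸ Ideal.span {z, w}) := e2 ▸ h.ufd (({2, 3} : Finset (Fin 4)) : Set (Fin 4))
  have hx : x ∉ Ideal.span {z, w} := e2 ▸ h.not_mem (A := (({2, 3} : Finset (Fin 4)) : Set (Fin 4))) (i := 0) (by simp)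
  have hy : y ∉ Ideal.span {x, z, w} := e3 ▸ h.not_mem (A := (({0, 2, 3} : Finset (Fin 4)) : Set (Fin 4))) (i := 1) (by simp)
  have d3 := (h.pd {0, 2, 3}).eq e3
  have d4 := (h.pd {0, 1, 2, 3}).eq e4
  have hpe := hK.hp
  subst hpe
  refine caseA4_lin0 (Ideal.span {z, w}) (Ideal.span {x, z, w}) (Ideal.span {x, y, z, w}) K hK ?_ ?_ hx hy d3 d4
  · rw [Ideal.span_insert x, sup_comm]
  · rw [Set.insert_comm, Ideal.span_insert y, sup_comm]

end

end

section

section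
variable {k : Type} [Field k] {N : ℕ}
local notation "RR" => MvPolynomial (Fin N) k

attribute [local instance] MvPolynomial.gradedAlgebra

lemma hc_eq (f : RR) (i : ℕ) :
    ((DirectSum.decompose (homogeneousSubmodule (Fin N) k) f i : homogeneousSubmodule (Fin N) k i) : RR) =
      homogeneousComponent i f := decomposition.decompose'_apply f i

lemma hc_mul {a b : RR} {i : ℕ} (ha : a.IsHomogeneous i) (j : ℕ) :
    homogeneousComponent (i + j) (a * b) = a * homogeneousComponent j b := by
  rw [← hc_eq, ← hc_eq]
  exact DirectSum.coe_decompose_mul_add_of_left_mem (homogeneousSubmodule (Fin N) k) ha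

lemma hc_mul_lt {a b : RR} {i n : ℕ} (ha : a.IsHomogeneous i) (h : n < i) :
    homogeneousComponent n (a * b) = 0 := by
  rw [← hc_eq]
  exact DirectSum.coe_decompose_mul_of_left_mem_of_not_le (homogeneousSubmodule (Fin N) k) ha (by omega)

/-- homogeneous ideals -/
def HI (p : Ideal RR) : Prop := ∀ f ∈ p, ∀ n, homogeneousComponent n f ∈ p

lemma HI_span (S : Set RR) (h : ∀ f ∈ S, f.IsHomogeneous 1) : HI (Ideal.span S) := by
  intro f hf n
  exact homogeneousComponent_mem_of_mem (Ideal.homogeneous_span _ _ fun f hf => ⟨1, h f hf⟩) hf n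

lemma hom_pair {x y g : RR} (hx : x.IsHomogeneous 1) (hy : y.IsHomogeneous 1) {n : ℕ} (hg : g.IsHomogeneous (n + 1))
    (h : g ∈ Ideal.span {x, y}) : ∃ u v, u.IsHomogeneous n ∧ v.IsHomogeneous n ∧ g = u * x + v * y := by
  obtain ⟨u, v, e⟩ := Ideal.mem_span_pair.1 h
  refine ⟨homogeneousComponent n u, homogeneousComponent n v, homogeneousComponent_isHomogeneous _ _,
    homogeneousComponent_isHomogeneous _ _, ?_⟩
  have := congrArg (homogeneousComponent (1 + n)) e
  rw [map_add, mul_comm u, mul_comm v, hc_mul hx, hc_mul hy, add_comm 1 n, homogeneousComponent_eq_self hg] at this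
  rw [← this]; ring

lemma hom_triple {x y z g : RR} (hx : x.IsHomogeneous 1) (hy : y.IsHomogeneous 1) (hz : z.IsHomogeneous 1) {n : ℕ}
    (hg : g.IsHomogeneous (n + 1)) (h : g ∈ Ideal.span {x, y, z}) :
    ∃ u v t, u.IsHomogeneous n ∧ v.IsHomogeneous n ∧ t.IsHomogeneous n ∧ g = u * x + v * y + t * z := by
  rw [Ideal.span_insert] at h
  obtain ⟨g1, h1, g2, h2, e⟩ := Submodule.mem_sup.1 h
  obtain ⟨u, rfl⟩ := Ideal.mem_span_singleton'.1 h1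
  obtain ⟨v, t, rfl⟩ := Ideal.mem_span_pair.1 h2
  refine ⟨homogeneousComponent n u, homogeneousComponent n v, homogeneousComponent n t, homogeneousComponent_isHomogeneous _ _,
    homogeneousComponent_isHomogeneous _ _, homogeneousComponent_isHomogeneous _ _, ?_⟩
  have := congrArg (homogeneousComponent (1 + n)) e
  rw [map_add, map_add, mul_comm u, mul_comm v, mul_comm t, hc_mul hx, hc_mul hy, hc_mul hz, add_comm 1 n, homogeneousComponent_eq_self hg] at this
  rw [← this]; ring

lemma hom_zero {s : RR} (h : s.IsHomogeneous 0) : ∃ c : k, s = C c :=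
  ⟨coeff 0 s, by rw [← homogeneousComponent_zero, homogeneousComponent_eq_self h]⟩

/-- homogeneous primitive vector modulo `p` -/
structure HP (p : Ideal RR) (a b : RR) (e : ℕ) : Prop where
  ha : a.IsHomogeneous e
  hb : b.IsHomogeneous e
  ab : a ∉ p ∨ b ∉ p
  prim : ∀ n u v, u.IsHomogeneous n → v.IsHomogeneous n → u * b - v * a ∈ p →
    ∃ s, s.IsHomogeneous (n - e) ∧ (n < e → s = 0) ∧ u - s * a ∈ p ∧ v - s * b ∈ p
  full : ∀ u v, u * b - v * a ∈ p → ∃ s, u - s * a ∈ p ∧ v - s * b ∈ p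

lemma hc_low {p : Ideal RR} {e : ℕ} {t v : RR} (h : ∀ j < e, homogeneousComponent j v ∈ p) :
    homogeneousComponent e (t * v) - homogeneousComponent 0 t * homogeneousComponent e v ∈ p := by
  have hv : t * v = ∑ j ∈ Finset.range (v.totalDegree + 1 + e + 1), homogeneousComponent j v * t := by
    rw [← Finset.sum_mul, mul_comm]
    congr 1
    conv_lhs => rw [← sum_homogeneousComponent v]
    refine Finset.sum_subset (by intro i; simp; omega) ?_
    intro j _ hj
    exact homogeneousComponent_eq_zero _ _ (by simpa using hj)
  rw [hv, map_sum, ← Finset.sum_erase_add _ _ (show e ∈ Finset.range (v.totalDegree + 1 + e + 1) by simp)]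
  have h1 : homogeneousComponent e (homogeneousComponent e v * t) = homogeneousComponent 0 t * homogeneousComponent e v := by
    rw [mul_comm (homogeneousComponent 0 t)]
    exact hc_mul (homogeneousComponent_isHomogeneous e v) 0
  rw [h1, add_sub_cancel_right]
  refine Ideal.sum_mem _ fun j hj => ?_
  rcases lt_trichotomy j e with hje | hje | hje
  · obtain ⟨i, rfl⟩ := Nat.exists_eq_add_of_lt hje
    rw [add_assoc, hc_mul (homogeneousComponent_isHomogeneous j v)]
    exact Ideal.mul_mem_right _ _ (h j hje)
  · simp [hje] at hj
  · rw [hc_mul_lt (homogeneousComponent_isHomogeneous j v) hje]; exact p.zero_mem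

lemma exists_HP (p : Ideal RR) [hp : p.IsPrime] [UniqueFactorizationMonoid (RR ⧸ p)] (hh : HI p) {a b u₀ v₀ : RR} {n₀ : ℕ}
    (hab : a ∉ p ∨ b ∉ p) (hu : u₀.IsHomogeneous n₀) (hv : v₀.IsHomogeneous n₀) (huv : u₀ ∉ p ∨ v₀ ∉ p)
    (hrel : u₀ * b - v₀ * a ∈ p) : ∃ A B e, HP p A B e ∧ A * b - B * a ∈ p := by
  classical
  obtain ⟨v, hv0, hv1⟩ := HH_struct p a b hab
  have hst : ∀ u w, u * b - w * a ∈ p → ∃ t, u - t * v.1 ∈ p ∧ w - t * v.2 ∈ p := by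
    intro u w huw
    have : ((u, w) : RR × RR) ∈ HH p a b := huw
    rw [hv1] at this
    obtain ⟨y, hy, z, ⟨t, ht⟩, e⟩ := Submodule.mem_sup.1 this
    refine ⟨t, ?_, ?_⟩
    · have e1 := congrArg Prod.fst e
      rw [← ht] at e1
      simp only [Prod.fst_add, LinearMap.toSpanSingleton_apply, Prod.smul_fst, smul_eq_mul] at e1
      rw [← e1, add_sub_cancel_right]; exact hy.1
    · have e1 := congrArg Prod.snd e
      rw [← ht] at e1
      simp only [Prod.snd_add, LinearMap.toSpanSingleton_apply, Prod.smul_snd, smul_eq_mul] at e1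
      rw [← e1, add_sub_cancel_right]; exact hy.2
  have hvHH : v.1 * b - v.2 * a ∈ p := by
    have : v ∈ HH p a b := by
      rw [hv1]; exact Submodule.mem_sup_right ⟨1, by simp⟩
    exact this
  have hex : ∃ e, homogeneousComponent e v.1 ∉ p ∨ homogeneousComponent e v.2 ∉ p := by
    by_contra hcon
    push Not at hcon
    rcases hv0 with h | h
    · apply h; rw [← sum_homogeneousComponent v.1]; exact Ideal.sum_mem _ fun j _ => (hcon j).1
    · apply h; rw [← sum_homogeneousComponent v.2]; exact Ideal.sum_mem _ fun j _ => (hcon j).2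
  set e := Nat.find hex with he
  have hmin : ∀ j < e, homogeneousComponent j v.1 ∈ p ∧ homogeneousComponent j v.2 ∈ p := by
    intro j hj
    have := Nat.find_min hex hj
    push Not at this
    exact this
  set A := homogeneousComponent e v.1 with hA
  set B := homogeneousComponent e v.2 with hB
  have hAB : A ∉ p ∨ B ∉ p := Nat.find_spec hex
  have hAh : A.IsHomogeneous e := homogeneousComponent_isHomogeneous _ _
  have hBh : B.IsHomogeneous e := homogeneousComponent_isHomogeneous _ _
  -- transitivity of proportionality
  have trans : ∀ {a₁ b₁ a₂ b₂ a₃ b₃ : RR}, (a₂ ∉ p ∨ b₂ ∉ p) → a₁ * b₂ - b₁ * a₂ ∈ p → a₂ * b₃ - b₂ * a₃ ∈ p →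
      a₁ * b₃ - b₁ * a₃ ∈ p := by
    intro a₁ b₁ a₂ b₂ a₃ b₃ h h1 h2
    rcases h with h | h
    · refine (hp.mem_or_mem (?_ : a₂ * (a₁ * b₃ - b₁ * a₃) ∈ p)).resolve_left h
      have := p.add_mem (p.mul_mem_left a₃ h1) (p.mul_mem_left a₁ h2)
      convert this using 1; ring
    · refine (hp.mem_or_mem (?_ : b₂ * (a₁ * b₃ - b₁ * a₃) ∈ p)).resolve_left h
      have := p.add_mem (p.mul_mem_left b₃ h1) (p.mul_mem_left b₁ h2)
      convert this using 1; ring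
  have symm : ∀ {a₁ b₁ a₂ b₂ : RR}, a₁ * b₂ - b₁ * a₂ ∈ p → a₂ * b₁ - b₂ * a₁ ∈ p := by
    intro a₁ b₁ a₂ b₂ h
    have := p.neg_mem h
    convert this using 1; ring
  have h1 : v.1 * v₀ - v.2 * u₀ ∈ p := trans hab hvHH (symm hrel)
  have h2 : A * v₀ - B * u₀ ∈ p := by
    have := hh _ h1 (n₀ + e)
    rw [map_sub, mul_comm, mul_comm v.2, hc_mul hv, hc_mul hu] at this
    rw [mul_comm A, mul_comm B]; exact this
  have h3 : A * b - B * a ∈ p := trans huv h2 hrel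
  obtain ⟨t, ht1, ht2⟩ := hst A B h3
  have h4 : A - homogeneousComponent 0 t * A ∈ p := by
    have q1 := hh _ ht1 e
    rw [map_sub, homogeneousComponent_eq_self hAh] at q1
    have := p.add_mem q1 (hc_low (t := t) fun j hj => (hmin j hj).1)
    convert this using 1; ring
  have h5 : B - homogeneousComponent 0 t * B ∈ p := by
    have q1 := hh _ ht2 e
    rw [map_sub, homogeneousComponent_eq_self hBh] at q1
    have := p.add_mem q1 (hc_low (t := t) fun j hj => (hmin j hj).2)
    convert this using 1; ring
  have h6 : homogeneousComponent 0 t = 1 := by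
    obtain ⟨τ, hτ⟩ := hom_zero (homogeneousComponent_isHomogeneous 0 t)
    rw [hτ] at h4 h5 ⊢
    by_contra hne
    have hne' : 1 - τ ≠ 0 := fun h => hne (by rw [← C_1]; congr 1; linear_combination -h)
    have q : ∀ D : RR, D - C τ * D ∈ p → D ∈ p := by
      intro D hD
      refine mem_of_smul p hne' ?_
      rw [smul_eq_C_mul, C_sub, C_1]
      convert hD using 1; ring
    rcases hAB with h | h
    · exact h (q _ h4)
    · exact h (q _ h5)
  have hprim : ∀ n u v, u.IsHomogeneous n → v.IsHomogeneous n → u * B - v * A ∈ p →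
      ∃ s, s.IsHomogeneous (n - e) ∧ (n < e → s = 0) ∧ u - s * A ∈ p ∧ v - s * B ∈ p := by
    intro n u w hu hw huw
    obtain ⟨s, hs1, hs2⟩ := hst u w (trans hAB huw h3)
    have key : ∀ D E d, D.IsHomogeneous e → E.IsHomogeneous n → D - t * d ∈ p → E - s * d ∈ p →
        E - homogeneousComponent n (D * s) ∈ p := by
      intro D E d hD hE q1 q2
      have q3 : E * t - D * s ∈ p := by
        have := p.sub_mem (p.mul_mem_left t q2) (p.mul_mem_left s q1)
        convert this using 1; ring
      have q4 := hh _ q3 n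
      rw [map_sub] at q4
      have q5 : homogeneousComponent n (E * t) = E * homogeneousComponent 0 t := hc_mul hE 0
      rw [q5, h6, mul_one] at q4
      exact q4
    have k1 := key A u v.1 hAh hu ht1 hs1
    have k2 := key B w v.2 hBh hw ht2 hs2
    by_cases hn : n < e
    · rw [hc_mul_lt hAh hn] at k1
      rw [hc_mul_lt hBh hn] at k2
      exact ⟨0, isHomogeneous_zero _ _ _, fun _ => rfl, by simpa using k1, by simpa using k2⟩
    · obtain ⟨i, rfl⟩ := Nat.exists_eq_add_of_le (not_lt.1 hn)
      rw [hc_mul hAh] at k1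
      rw [hc_mul hBh] at k2
      refine ⟨homogeneousComponent i s, by rw [Nat.add_sub_cancel_left]; exact homogeneousComponent_isHomogeneous _ _,
        fun h => absurd h hn, by rw [mul_comm]; exact k1, by rw [mul_comm]; exact k2⟩
  refine ⟨A, B, e, ⟨hAh, hBh, hAB, hprim, ?_⟩, h3⟩
  intro u w huw
  have hcomp : ∀ n, ∃ s, homogeneousComponent n u - s * A ∈ p ∧ homogeneousComponent n w - s * B ∈ p := by
    intro n
    obtain ⟨s, -, -, q1, q2⟩ := hprim n (homogeneousComponent n u) (homogeneousComponent n w)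
      (homogeneousComponent_isHomogeneous _ _) (homogeneousComponent_isHomogeneous _ _) (by
        have := hh _ huw (e + n)
        rw [map_sub, mul_comm, mul_comm w, hc_mul hBh, hc_mul hAh] at this
        rw [mul_comm _ B, mul_comm _ A]; exact this)
    exact ⟨s, q1, q2⟩
  choose s hs1 hs2 using hcomp
  have hsum : ∀ f : RR, ∀ M, f.totalDegree < M → ∑ j ∈ Finset.range M, homogeneousComponent j f = f := by
    intro f M hM
    conv_rhs => rw [← sum_homogeneousComponent f]
    symm
    refine Finset.sum_subset (by intro i; simp; omega) ?_
    intro j _ hj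
    exact homogeneousComponent_eq_zero _ _ (by simpa using hj)
  refine ⟨∑ j ∈ Finset.range (u.totalDegree + w.totalDegree + 1), s j, ?_, ?_⟩
  · conv => enter [2, 1]; rw [← hsum u (u.totalDegree + w.totalDegree + 1) (by omega)]
    rw [Finset.sum_mul, ← Finset.sum_sub_distrib]
    exact Ideal.sum_mem _ fun j _ => hs1 j
  · conv => enter [2, 1]; rw [← hsum w (u.totalDegree + w.totalDegree + 1) (by omega)]
    rw [Finset.sum_mul, ← Finset.sum_sub_distrib]
    exact Ideal.sum_mem _ fun j _ => hs2 j

end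

end

section

section
variable {k : Type} [Field k] {N : ℕ}
local notation "RR" => MvPolynomial (Fin N) k

lemma LI.swap {x y z w : RR} (h : LI ![x, y, z, w]) : LI ![z, w, x, y] := by
  rw [LI.quad] at h ⊢
  obtain ⟨h1, h2, h3, h4, h5⟩ := h
  refine ⟨h3, h4, h1, h2, fun a b c d e => ?_⟩
  obtain ⟨q1, q2, q3, q4⟩ := h5 c d a b (by rw [← e]; abel)
  exact ⟨q3, q4, q1, q2⟩

lemma LI.facts {x y z w : RR} (h : LI ![x, y, z, w]) :
    (Ideal.span {x, y}).IsPrime ∧ (Ideal.span {x, y, z}).IsPrime ∧ (Ideal.span {x, y, z, w}).IsPrime ∧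
    UniqueFactorizationMonoid (RR ⧸ Ideal.span {x, y}) ∧ z ∉ Ideal.span {x, y} ∧ w ∉ Ideal.span {x, y, z} ∧
    PD RR 2 (RR ⧸ Ideal.span {x, y}) := by
  have e2 : Ideal.span (![x, y, z, w] '' (({0, 1} : Finset (Fin 4)) : Set (Fin 4))) = Ideal.span {x, y} := by
    congr 1; simp [Set.image_insert_eq]
  have e3 : Ideal.span (![x, y, z, w] '' (({0, 1, 2} : Finset (Fin 4)) : Set (Fin 4))) = Ideal.span {x, y, z} := by
    congr 1; simp [Set.image_insert_eq]
  have e4 : Ideal.span (![x, y, z, w] '' (({0, 1, 2, 3} : Finset (Fin 4)) : Set (Fin 4))) = Ideal.span {x, y, z, w} := by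
    congr 1; simp [Set.image_insert_eq]
  exact ⟨e2 ▸ h.prime _, e3 ▸ h.prime _, e4 ▸ h.prime _, e2 ▸ h.ufd _,
    e2 ▸ h.not_mem (A := (({0, 1} : Finset (Fin 4)) : Set (Fin 4))) (i := 2) (by simp),
    e3 ▸ h.not_mem (A := (({0, 1, 2} : Finset (Fin 4)) : Set (Fin 4))) (i := 3) (by simp),
    (h.pd {0, 1}).eq e2⟩

lemma LI.retract {x y z w : RR} (h : LI ![x, y, z, w]) :
    ∃ ρ : RR →ₐ[k] RR, ρ x = x ∧ ρ y = y ∧ ρ z = 0 ∧ ρ w = 0 := by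
  classical
  obtain ⟨φ, ι, h1, -, -⟩ := exists_coord _ h.hom h.li
  have h2 : ∀ i, φ.symm (![x, y, z, w] i) = X (ι i) := fun i => by rw [← h1]; simp
  refine ⟨(φ.toAlgHom.comp (aeval fun i => if i = ι 2 ∨ i = ι 3 then 0 else X i)).comp φ.symm.toAlgHom, ?_, ?_, ?_, ?_⟩
  · have := h2 0
    simp only [Matrix.cons_val_zero] at this
    simpa [this, ι.injective.eq_iff] using h1 0
  · have := h2 1
    simp at this
    simpa [this, ι.injective.eq_iff] using h1 1
  · have := h2 2
    simp at this
    simp [this]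
  · have := h2 3
    simp at this
    simp [this]

lemma LI.adj_zero {x y z w : RR} (h : LI ![x, y, z, w]) {E : RR} (hE : E ∈ Algebra.adjoin k {x, y})
    (hE2 : E ∈ Ideal.span {z, w}) : E = 0 := by
  obtain ⟨ρ, r1, r2, r3, r4⟩ := h.retract
  have h1 : ρ E = E := by
    have : Algebra.adjoin k {x, y} ≤ AlgHom.equalizer ρ (AlgHom.id k RR) := by
      rw [Algebra.adjoin_le_iff]
      rintro t (rfl | rfl)
      · exact r1
      · exact r2
    exact this hE
  obtain ⟨u, v, rfl⟩ := Ideal.mem_span_pair.1 hE2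
  rw [← h1]; simp [r3, r4]

lemma adj_range {x y z w : RR} {E : RR} (hE : E ∈ Algebra.adjoin k {x, y}) :
    ∃ E0, (aeval (R := k) ![x, y, z, w]).toRingHom E0 = E := by
  have : Algebra.adjoin k {x, y} ≤ (aeval (R := k) ![x, y, z, w]).range := by
    rw [Algebra.adjoin_le_iff]
    rintro t (rfl | rfl)
    · exact ⟨X 0, by simp⟩
    · exact ⟨X 1, by simp⟩
  exact this hE

/-- cubic forms in `(x,y) ∩ (z,w)` -/
structure Cub (x y z w f l₁ l₂ l₃ l₄ : RR) : Prop where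
  h₁ : l₁.IsHomogeneous 1
  h₂ : l₂.IsHomogeneous 1
  h₃ : l₃.IsHomogeneous 1
  h₄ : l₄.IsHomogeneous 1
  eq : f = x * z * l₁ + x * w * l₂ + y * z * l₃ + y * w * l₄

lemma Cub.swap {x y z w f l₁ l₂ l₃ l₄ : RR} (h : Cub x y z w f l₁ l₂ l₃ l₄) : Cub z w x y f l₁ l₃ l₂ l₄ :=
  ⟨h.h₁, h.h₃, h.h₂, h.h₄, by rw [h.eq]; ring⟩

lemma Cub.comb {x y z w f l₁ l₂ l₃ l₄ g m₁ m₂ m₃ m₄ : RR} (h : Cub x y z w f l₁ l₂ l₃ l₄)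
    (h' : Cub x y z w g m₁ m₂ m₃ m₄) (α β : k) :
    Cub x y z w (C α * f + C β * g) (C α * l₁ + C β * m₁) (C α * l₂ + C β * m₂) (C α * l₃ + C β * m₃) (C α * l₄ + C β * m₄) :=
  ⟨(h.h₁.C_mul α).add (h'.h₁.C_mul β), (h.h₂.C_mul α).add (h'.h₂.C_mul β), (h.h₃.C_mul α).add (h'.h₃.C_mul β),
    (h.h₄.C_mul α).add (h'.h₄.C_mul β), by rw [h.eq, h'.eq]; ring⟩

lemma exists_Cub {x y z w : RR} (h : LI ![x, y, z, w]) {f : RR} (hf : f.IsHomogeneous 3)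
    (h1 : f ∈ Ideal.span {x, y}) (h2 : f ∈ Ideal.span {z, w}) : ∃ l₁ l₂ l₃ l₄, Cub x y z w f l₁ l₂ l₃ l₄ := by
  obtain ⟨hx, hy, hz, hw, -⟩ := LI.quad.1 h
  obtain ⟨p2, q2, -, -, n1, n2, -⟩ := h.swap.facts
  obtain ⟨u, v, hu, hv, e⟩ := hom_pair hx hy hf h1
  have hle : Ideal.span {z, w} ≤ Ideal.span {z, w, x} := Ideal.span_mono (by intro t; simp; tauto)
  have hvq : v ∈ Ideal.span {z, w, x} := by
    refine (q2.mem_or_mem (?_ : v * y ∈ _)).resolve_right n2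
    have := Ideal.sub_mem _ (hle h2) (Ideal.mul_mem_left _ u (Ideal.subset_span (by simp : x ∈ ({z, w, x} : Set RR))))
    rw [e] at this
    convert this using 1; ring
  obtain ⟨l₃, l₄, t, hl₃, hl₄, ht, ev⟩ := hom_triple hz hw hx hv hvq
  have hu2 : u + t * y ∈ Ideal.span {z, w} := by
    refine (p2.mem_or_mem (?_ : (u + t * y) * x ∈ _)).resolve_right n1
    have h3 : (l₃ * z + l₄ * w) * y ∈ Ideal.span {z, w} := Ideal.mul_mem_right _ _ (Ideal.mem_span_pair.2 ⟨_, _, rfl⟩)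
    have := Ideal.sub_mem _ h2 h3
    rw [e, ev] at this
    convert this using 1; ring
  obtain ⟨l₁, l₂, hl₁, hl₂, eu⟩ := hom_pair hz hw (hu.add (ht.mul hy)) hu2
  refine ⟨l₁, l₂, l₃, l₄, hl₁, hl₂, hl₃, hl₄, ?_⟩
  rw [e]
  linear_combination x * eu + y * ev

/-- linear syzygies modulo `(x,y)` -/
lemma lin_syz {x y z w : RR} (h : LI ![x, y, z, w]) {l l' : RR} (hl : l.IsHomogeneous 1) (hl' : l'.IsHomogeneous 1)
    (h1 : z * l + w * l' ∈ Ideal.span {x, y}) : ∃ m m', m ∈ Algebra.adjoin k {x, y} ∧ m' ∈ Algebra.adjoin k {x, y} ∧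
      m.IsHomogeneous 1 ∧ m'.IsHomogeneous 1 ∧ z * l + w * l' = z * m + w * m' ∧
      l - m ∈ Ideal.span {z, w} ∧ l' - m' ∈ Ideal.span {z, w} := by
  obtain ⟨hx, hy, hz, hw, -⟩ := LI.quad.1 h
  obtain ⟨p1, q1, -, -, n1, n2, -⟩ := h.facts
  have hle : Ideal.span {x, y} ≤ Ideal.span {x, y, z} := Ideal.span_mono (by intro t; simp; tauto)
  have h2 : l' ∈ Ideal.span {x, y, z} := by
    refine (q1.mem_or_mem (?_ : w * l' ∈ _)).resolve_left n2
    have := Ideal.sub_mem _ (hle h1) (Ideal.mul_mem_right l _ (Ideal.subset_span (by simp : z ∈ ({x, y, z} : Set RR))))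
    convert this using 1; ring
  obtain ⟨u, v, t, hu, hv, ht, e⟩ := hom_triple hx hy hz hl' h2
  obtain ⟨u, rfl⟩ := hom_zero hu
  obtain ⟨v, rfl⟩ := hom_zero hv
  obtain ⟨t, rfl⟩ := hom_zero ht
  have h3 : l + C t * w ∈ Ideal.span {x, y} := by
    refine (p1.mem_or_mem (?_ : z * (l + C t * w) ∈ _)).resolve_left n1
    have h4 : (C u * x + C v * y) * w ∈ Ideal.span {x, y} := Ideal.mul_mem_right _ _ (Ideal.mem_span_pair.2 ⟨_, _, rfl⟩)
    have := Ideal.sub_mem _ h1 h4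
    rw [e] at this
    convert this using 1; ring
  obtain ⟨u', v', hu', hv', e'⟩ := hom_pair hx hy (hl.add (hw.C_mul t)) h3
  obtain ⟨u', rfl⟩ := hom_zero hu'
  obtain ⟨v', rfl⟩ := hom_zero hv'
  have hadj : ∀ a b : k, C a * x + C b * y ∈ Algebra.adjoin k {x, y} := by
    intro a b
    exact Subalgebra.add_mem _ (Subalgebra.mul_mem _ (Subalgebra.algebraMap_mem _ a) (Algebra.subset_adjoin (by simp)))
      (Subalgebra.mul_mem _ (Subalgebra.algebraMap_mem _ b) (Algebra.subset_adjoin (by simp)))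
  refine ⟨C u' * x + C v' * y, C u * x + C v * y, hadj _ _, hadj _ _, (hx.C_mul _).add (hy.C_mul _),
    (hx.C_mul _).add (hy.C_mul _), ?_, ?_, ?_⟩
  · linear_combination w * e + z * e'
  · rw [Ideal.mem_span_pair]; exact ⟨0, - C t, by linear_combination -e'⟩
  · rw [Ideal.mem_span_pair]; exact ⟨C t, 0, by linear_combination -e⟩

lemma Cub.z1 {x y z w f l₁ l₂ l₃ l₄ : RR} (h : LI ![x, y, z, w]) (hf : Cub x y z w f l₁ l₂ l₃ l₄)
    (h1 : z * l₁ + w * l₂ ∈ Ideal.span {x, y}) (h2 : z * l₃ + w * l₄ ∈ Ideal.span {x, y}) :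
    ∃ F G, F ∈ Algebra.adjoin k {x, y} ∧ G ∈ Algebra.adjoin k {x, y} ∧ F.IsHomogeneous 2 ∧ G.IsHomogeneous 2 ∧
      f = F * z + G * w ∧ F - (x * l₁ + y * l₃) ∈ Ideal.span {z, w} ∧ G - (x * l₂ + y * l₄) ∈ Ideal.span {z, w} := by
  obtain ⟨hx, hy, hz, hw, -⟩ := LI.quad.1 h
  obtain ⟨m₁, m₂, a1, a2, b1, b2, e1, c1, c2⟩ := lin_syz h hf.h₁ hf.h₂ h1
  obtain ⟨m₃, m₄, a3, a4, b3, b4, e2, c3, c4⟩ := lin_syz h hf.h₃ hf.h₄ h2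
  have hxA : x ∈ Algebra.adjoin k {x, y} := Algebra.subset_adjoin (by simp)
  have hyA : y ∈ Algebra.adjoin k {x, y} := Algebra.subset_adjoin (by simp)
  refine ⟨x * m₁ + y * m₃, x * m₂ + y * m₄, Subalgebra.add_mem _ (Subalgebra.mul_mem _ hxA a1) (Subalgebra.mul_mem _ hyA a3),
    Subalgebra.add_mem _ (Subalgebra.mul_mem _ hxA a2) (Subalgebra.mul_mem _ hyA a4), (hx.mul b1).add (hy.mul b3),
    (hx.mul b2).add (hy.mul b4), ?_, ?_, ?_⟩
  · rw [hf.eq]; linear_combination x * e1 + y * e2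
  · have := Ideal.add_mem _ (Ideal.mul_mem_left _ (-x) c1) (Ideal.mul_mem_left _ (-y) c3)
    convert this using 1; ring
  · have := Ideal.add_mem _ (Ideal.mul_mem_left _ (-x) c2) (Ideal.mul_mem_left _ (-y) c4)
    convert this using 1; ring

lemma Cub.zz {x y z w f l₁ l₂ l₃ l₄ : RR} (h : LI ![x, y, z, w]) (hf : Cub x y z w f l₁ l₂ l₃ l₄)
    (h1 : z * l₁ + w * l₂ ∈ Ideal.span {x, y}) (h2 : z * l₃ + w * l₄ ∈ Ideal.span {x, y})
    (h3 : x * l₁ + y * l₃ ∈ Ideal.span {z, w}) (h4 : x * l₂ + y * l₄ ∈ Ideal.span {z, w}) : f = 0 := by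
  obtain ⟨F, G, hF, hG, -, -, e, q1, q2⟩ := hf.z1 h h1 h2
  have := h.adj_zero hF (by simpa using Ideal.add_mem _ q1 h3)
  have := h.adj_zero hG (by simpa using Ideal.add_mem _ q2 h4)
  simp_all

lemma dvd_hom {f F : RR} (hf : f.IsHomogeneous 3) (hf0 : f ≠ 0) (hF : F.IsHomogeneous 2) (h : f ∣ F) : F = 0 := by
  by_contra h0
  obtain ⟨g, rfl⟩ := h
  have hg : g ≠ 0 := right_ne_zero_of_mul h0
  have := totalDegree_mul_of_isDomain hf0 hg
  rw [hF.totalDegree h0, hf.totalDegree hf0] at this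
  omega

/-- `f₁, f₂` cannot both satisfy `Z1` -/
lemma Cub.not_both {x y z w f l₁ l₂ l₃ l₄ g m₁ m₂ m₃ m₄ c d : RR} {K : Ideal RR} (h : LI ![x, y, z, w])
    (hf : Cub x y z w f l₁ l₂ l₃ l₄) (hg : Cub x y z w g m₁ m₂ m₃ m₄)
    (hK : KS (Ideal.span {z, w}) K z w c d) (hfK : f ∈ K) (hgK : g ∈ K)
    (hf3 : f.IsHomogeneous 3) (hf0 : f ≠ 0) (hrel : IsRelPrime f g)
    (h1 : z * l₁ + w * l₂ ∈ Ideal.span {x, y}) (h2 : z * l₃ + w * l₄ ∈ Ideal.span {x, y})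
    (h3 : z * m₁ + w * m₂ ∈ Ideal.span {x, y}) (h4 : z * m₃ + w * m₄ ∈ Ideal.span {x, y}) : False := by
  obtain ⟨F, G, hF, hG, dF, dG, ef, -, -⟩ := hf.z1 h h1 h2
  obtain ⟨F', G', hF', hG', -, -, eg, -, -⟩ := hg.z1 h h3 h4
  obtain ⟨p2, -⟩ := h.swap.facts
  have r1 : F * d - G * c ∈ Ideal.span {z, w} := (hK.iff _ _).1 (ef ▸ hfK)
  have r2 : F' * d - G' * c ∈ Ideal.span {z, w} := (hK.iff _ _).1 (eg ▸ hgK)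
  have r3 : F * G' - F' * G ∈ Ideal.span {z, w} := by
    rcases hK.ab with hc | hc
    · refine (p2.mem_or_mem (?_ : c * (F * G' - F' * G) ∈ _)).resolve_left hc
      have := Ideal.sub_mem _ (Ideal.mul_mem_left _ F' r1) (Ideal.mul_mem_left _ F r2)
      convert this using 1; ring
    · refine (p2.mem_or_mem (?_ : d * (F * G' - F' * G) ∈ _)).resolve_left hc
      have := Ideal.sub_mem _ (Ideal.mul_mem_left _ G' r1) (Ideal.mul_mem_left _ G r2)
      convert this using 1; ring
  have r4 := h.adj_zero (Subalgebra.sub_mem _ (Subalgebra.mul_mem _ hF hG') (Subalgebra.mul_mem _ hF' hG)) r3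
  have k1 : f ∣ F := hrel.dvd_of_dvd_mul_right (⟨F', by rw [ef, eg]; linear_combination w * r4⟩ : f ∣ F * g)
  have k2 : f ∣ G := hrel.dvd_of_dvd_mul_right (⟨G', by rw [ef, eg]; linear_combination -z * r4⟩ : f ∣ G * g)
  apply hf0
  rw [ef, dvd_hom hf3 hf0 dF k1, dvd_hom hf3 hf0 dG k2]; simp

end

end

section

section
variable {k : Type} [Field k] {N : ℕ}
local notation "RR" => MvPolynomial (Fin N) k

lemma C_not_mem {p : Ideal RR} (hp : p.IsPrime) {c : k} (hc : c ≠ 0) : (C c : RR) ∉ p := by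
  intro h
  apply hp.ne_top
  rw [Ideal.eq_top_iff_one]
  have := p.mul_mem_left (C c⁻¹) h
  rwa [← C_mul, inv_mul_cancel₀ hc, C_1] at this

lemma mem_span_pair_sq {R : Type} [CommRing R] {x y r : R} {K : Ideal R} (hK : K ≤ Ideal.span {x, y})
    (hv : ∀ v, v * y ∈ K → v ∈ Ideal.span {x, y}) (hx : x ∈ K) (hr : r ∈ K) : r ∈ Ideal.span {x, y * y} := by
  obtain ⟨s, v, rfl⟩ := Ideal.mem_span_pair.1 (hK hr)
  have h1 : v * y ∈ K := by
    have := K.sub_mem hr (K.mul_mem_left s hx)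
    simpa using this
  obtain ⟨s', t, rfl⟩ := Ideal.mem_span_pair.1 (hv v h1)
  exact Ideal.mem_span_pair.2 ⟨s + s' * y, t, by ring⟩

lemma caseE0 {x y z w c d : RR} {α β : k} {K₁ K₂ p₂ : Ideal RR} (h : LI ![x, y, z, w])
    (k1 : KS (Ideal.span {x, y}) K₁ x y (C α) (C β)) (k2 : KS p₂ K₂ z w c d) :
    PD RR 5 (RR ⧸ (K₁ ⊔ K₂)) := by
  obtain ⟨p1, -⟩ := h.facts
  obtain ⟨hx, hy, hz, hw, hli⟩ := LI.quad.1 h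
  have hne : α ≠ 0 ∨ β ≠ 0 := by
    rcases k1.ab with h0 | h0
    · left; rintro rfl; exact h0 (by simp)
    · right; rintro rfl; exact h0 (by simp)
  have h2 : LI ![x, y] := LI.pair.2 ⟨hx, hy, fun a b hab => by
    obtain ⟨q1, q2, -⟩ := hli a b 0 0 (by simpa using hab)
    exact ⟨q1, q2⟩⟩
  obtain ⟨y', hL, hs⟩ := h2.change α β hne
  obtain ⟨hx', hy', hli'⟩ := LI.pair.1 hL
  have hxK : α • x + β • y ∈ K₁ := by
    rw [smul_eq_C_mul, smul_eq_C_mul, k1.iff]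
    convert Ideal.zero_mem _ using 1; ring
  have hy'p : y' ∈ Ideal.span {x, y} := by rw [hs]; exact Ideal.subset_span (by simp)
  obtain ⟨u, v, hu, hv, ey⟩ := hom_pair hx hy (n := 0) hy' hy'p
  obtain ⟨u, rfl⟩ := hom_zero hu
  obtain ⟨v, rfl⟩ := hom_zero hv
  have hdet : u * β - v * α ≠ 0 := by
    intro h0
    have e1 := hli' u (-α) (by
      rw [ey]; simp only [smul_eq_C_mul, map_neg]
      have : (C u * C β - C v * C α : RR) = 0 := by rw [← C_mul, ← C_mul, ← C_sub, h0, C_0]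
      linear_combination y * this)
    have e2 := hli' v (-β) (by
      rw [ey]; simp only [smul_eq_C_mul, map_neg]
      have : (C u * C β - C v * C α : RR) = 0 := by rw [← C_mul, ← C_mul, ← C_sub, h0, C_0]
      linear_combination -x * this)
    rcases hne with h | h
    · exact h (by simpa using e1.2)
    · exact h (by simpa using e2.2)
  have hvK : ∀ r, r * y' ∈ K₁ → r ∈ Ideal.span {α • x + β • y, y'} := by
    intro r hr
    rw [← hs]
    have e : r * y' = (r * C u) * x + (r * C v) * y := by rw [ey]; ring
    rw [e, k1.iff] at hr
    refine (p1.mem_or_mem (?_ : C (u * β - v * α) * r ∈ _)).resolve_left (C_not_mem p1 hdet)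
    convert hr using 1
    rw [C_sub, C_mul, C_mul]; ring
  have hL4 : LI ![α • x + β • y, y', z, w] := by
    refine LI.quad.2 ⟨hx', hy', hz, hw, fun a b c' d' e => ?_⟩
    have e3 := hli (a * α + b * u) (a * β + b * v) c' d' (by
      rw [← e, ey]; simp only [smul_eq_C_mul, map_add, map_mul]; ring)
    obtain ⟨-, -, rfl, rfl⟩ := e3
    obtain ⟨q1, q2⟩ := hli' a b (by simpa using e)
    exact ⟨q1, q2, rfl, rfl⟩
  refine caseA4_lin hL4 k2 (le_antisymm ?_ ?_)
  · intro r hr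
    exact mem_span_pair_sq (hs ▸ k1.le) hvK hxK hr
  · rw [Ideal.span_le]
    rintro r (rfl | rfl)
    · exact hxK
    · exact k1.sq (Ideal.mul_mem_mul hy'p hy'p)

lemma no_comb {f g : RR} (hf : f.IsHomogeneous 3) (hf0 : f ≠ 0) (hrel : IsRelPrime f g) {α β : k}
    (h : α ≠ 0 ∨ β ≠ 0) : C α * f + C β * g ≠ 0 := by
  intro e
  by_cases hb : β = 0
  · subst hb
    have ha : α ≠ 0 := by tauto
    simp [ha, hf0] at e
  · have hd : f ∣ g := ⟨- (C β⁻¹ * C α), by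
      have : (C β⁻¹ * C β : RR) = 1 := by rw [← C_mul, inv_mul_cancel₀ hb, C_1]
      linear_combination C β⁻¹ * e - g * this⟩
    have hu : IsUnit f := hrel dvd_rfl hd
    have := (MvPolynomial.isUnit_iff_totalDegree_of_isReduced.1 hu).2
    rw [hf.totalDegree hf0] at this
    omega

lemma Cub.k1 {x y z w f l₁ l₂ l₃ l₄ a b : RR} {p K : Ideal RR} (hf : Cub x y z w f l₁ l₂ l₃ l₄)
    (hK : KS p K x y a b) (hfK : f ∈ K) :
    (z * l₁ + w * l₂) * b - (z * l₃ + w * l₄) * a ∈ p := by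
  rw [← hK.iff]
  convert hfK using 1
  rw [hf.eq]; ring

/-- generic decomposition modulo the square of `p` -/
lemma sq_dec {R : Type} [CommRing R] {x y a b u v s : R} {p : Ideal R} (hx : x ∈ p) (hy : y ∈ p)
    (h1 : u - s * a ∈ p) (h2 : v - s * b ∈ p) : (u * x + v * y) - s * (a * x + b * y) ∈ p * p := by
  have := Ideal.add_mem _ (Ideal.mul_mem_mul h1 hx) (Ideal.mul_mem_mul h2 hy)
  convert this using 1; ring

lemma caseE2 {x y z w f l₁ l₂ l₃ l₄ g m₁ m₂ m₃ m₄ A B c d : RR} {K₁ K₂ : Ideal RR} (h : LI ![x, y, z, w])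
    (hf : Cub x y z w f l₁ l₂ l₃ l₄) (hg : Cub x y z w g m₁ m₂ m₃ m₄)
    (k1 : KS (Ideal.span {x, y}) K₁ x y A B) (hp : HP (Ideal.span {x, y}) A B 2)
    (k2 : KS (Ideal.span {z, w}) K₂ z w c d) (hf1 : f ∈ K₁) (hg1 : g ∈ K₁) (hf2 : f ∈ K₂) (hg2 : g ∈ K₂)
    (hf3 : f.IsHomogeneous 3) (hf0 : f ≠ 0) (hrel : IsRelPrime f g) :
    PD RR 4 (RR ⧸ (K₁ ⊔ K₂)) := by
  obtain ⟨p1, -⟩ := h.facts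
  obtain ⟨p2, -⟩ := h.swap.facts
  obtain ⟨hx, hy, hz, hw, -⟩ := LI.quad.1 h
  have hxp : x ∈ Ideal.span {x, y} := Ideal.subset_span (by simp)
  have hyp : y ∈ Ideal.span {x, y} := Ideal.subset_span (by simp)
  obtain ⟨σ, hσ, -, s1, s2⟩ := hp.prim 2 _ _ ((hz.mul hf.h₁).add (hw.mul hf.h₂)) ((hz.mul hf.h₃).add (hw.mul hf.h₄)) (hf.k1 k1 hf1)
  obtain ⟨τ, hτ, -, t1, t2⟩ := hp.prim 2 _ _ ((hz.mul hg.h₁).add (hw.mul hg.h₂)) ((hz.mul hg.h₃).add (hw.mul hg.h₄)) (hg.k1 k1 hg1)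
  obtain ⟨σ, rfl⟩ := hom_zero hσ
  obtain ⟨τ, rfl⟩ := hom_zero hτ
  have hst : τ ≠ 0 ∨ -σ ≠ 0 := by
    by_contra hh
    push Not at hh
    obtain ⟨rfl, hh⟩ := hh
    rw [neg_eq_zero] at hh
    subst hh
    simp only [C_0, zero_mul, sub_zero] at s1 s2 t1 t2
    exact hf.not_both h hg k2 hf2 hg2 hf3 hf0 hrel s1 s2 t1 t2
  have hc := hf.comb hg τ (-σ)
  have hc2 : C τ * f + C (-σ) * g ∈ K₂ := K₂.add_mem (K₂.mul_mem_left _ hf2) (K₂.mul_mem_left _ hg2)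
  have hc0 := no_comb hf3 hf0 hrel hst
  obtain ⟨F, G, hF, hG, -, -, e, -, -⟩ := hc.z1 h (by
      have := Ideal.sub_mem _ (Ideal.mul_mem_left _ (C τ) s1) (Ideal.mul_mem_left _ (C σ) t1)
      convert this using 1; rw [C_neg]; ring) (by
      have := Ideal.sub_mem _ (Ideal.mul_mem_left _ (C τ) s2) (Ideal.mul_mem_left _ (C σ) t2)
      convert this using 1; rw [C_neg]; ring)
  have hFG : F ∉ Ideal.span {z, w} ∨ G ∉ Ideal.span {z, w} := by
    by_contra hh
    push Not at hh
    apply hc0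
    rw [e, h.adj_zero hF hh.1, h.adj_zero hG hh.2]; simp
  have k2' : KS (Ideal.span {z, w}) K₂ z w F G := k2.change hFG ((k2.iff _ _).1 (e ▸ hc2))
  have hE2 : Extd (aeval (R := k) ![x, y, z, w]).toRingHom K₂ := by
    obtain ⟨F0, rfl⟩ := adj_range (z := z) (w := w) hF
    obtain ⟨G0, rfl⟩ := adj_range (z := z) (w := w) hG
    have ez : (aeval (R := k) ![x, y, z, w]).toRingHom (X 2) = z := by simp
    have ew : (aeval (R := k) ![x, y, z, w]).toRingHom (X 3) = w := by simp
    refine KS.extd (p := Ideal.span {z, w}) (x := X 2) (y := X 3) (a := F0) (b := G0) h.flat ?_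
    rw [ez, ew]; exact k2'
  have hE1 : Extd (aeval (R := k) ![x, y, z, w]).toRingHom (Ideal.span {x, y} * Ideal.span {x, y}) := by
    have : Ideal.span {x, y} * Ideal.span {x, y} = Ideal.span ((aeval (R := k) ![x, y, z, w]).toRingHom '' {X 0 * X 0, X 0 * X 1, X 1 * X 0, X 1 * X 1}) := by
      rw [Ideal.span_pair_mul_span_pair]
      congr 1
      simp [Set.image_insert_eq]
    rw [this]
    exact Extd.span _ _
  have hAB : A * x + B * y ∈ Ideal.span {x, y} * Ideal.span {x, y} ⊔ K₂ := by
    have key : ∀ {q m₁ m₂ m₃ m₄ : RR} {ρ : k}, Cub x y z w q m₁ m₂ m₃ m₄ → q ∈ K₂ → ρ ≠ 0 →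
        z * m₁ + w * m₂ - C ρ * A ∈ Ideal.span {x, y} → z * m₃ + w * m₄ - C ρ * B ∈ Ideal.span {x, y} →
        A * x + B * y ∈ Ideal.span {x, y} * Ideal.span {x, y} ⊔ K₂ := by
      intro q m₁ m₂ m₃ m₄ ρ hq hqK hρ h1 h2
      have h3 := sq_dec hxp hyp h1 h2
      refine mem_of_smul _ hρ ?_
      rw [smul_eq_C_mul]
      have := Ideal.sub_mem _ (Ideal.mem_sup_right (S := Ideal.span {x, y} * Ideal.span {x, y}) hqK) (Ideal.mem_sup_left (T := K₂) h3)
      rw [hq.eq] at this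
      convert this using 1; ring
    rcases hst with h0 | h0
    · exact key hg hg2 h0 t1 t2
    · exact key hf hf2 (by simpa using h0) s1 s2
  have e1 : K₁ ⊔ K₂ = Ideal.span {x, y} * Ideal.span {x, y} ⊔ K₂ := by
    refine le_antisymm (sup_le ?_ le_sup_right) (sup_le_sup_right k1.sq _)
    intro r hr
    obtain ⟨u, v, rfl⟩ := Ideal.mem_span_pair.1 (k1.le hr)
    obtain ⟨s, q1, q2⟩ := hp.full u v ((k1.iff _ _).1 hr)
    have := Ideal.add_mem _ (Ideal.mem_sup_left (T := K₂) (sq_dec hxp hyp q1 q2)) (Ideal.mul_mem_left _ s hAB)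
    simpa using this
  rw [e1]
  exact h.extd_pd hE1 hE2 (Ideal.mul_mem_mul hxp hxp) (Ideal.mul_mem_mul hyp hyp)
    (k2.sq (Ideal.mul_mem_mul (Ideal.subset_span (by simp)) (Ideal.subset_span (by simp))))
    (k2.sq (Ideal.mul_mem_mul (Ideal.subset_span (by simp)) (Ideal.subset_span (by simp))))

end

end

section

section
variable {k : Type} [Field k] {N : ℕ}
local notation "RR" => MvPolynomial (Fin N) k

lemma hom_quad {x y z w g : RR} (hx : x.IsHomogeneous 1) (hy : y.IsHomogeneous 1) (hz : z.IsHomogeneous 1)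
    (hw : w.IsHomogeneous 1) (hg : g.IsHomogeneous 1) (h : g ∈ Ideal.span {x, y, z, w}) :
    ∃ a b c d : k, g = C a * x + C b * y + C c * z + C d * w := by
  rw [Ideal.span_insert] at h
  obtain ⟨g1, h1, g2, h2, e⟩ := Submodule.mem_sup.1 h
  obtain ⟨u, rfl⟩ := Ideal.mem_span_singleton'.1 h1
  rw [Ideal.span_insert] at h2
  obtain ⟨g1, h1, g3, h2, e'⟩ := Submodule.mem_sup.1 h2
  obtain ⟨v, rfl⟩ := Ideal.mem_span_singleton'.1 h1
  obtain ⟨t, s, rfl⟩ := Ideal.mem_span_pair.1 h2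
  subst e'
  have := congrArg (homogeneousComponent (1 + 0)) e
  rw [map_add, map_add, map_add, mul_comm u, mul_comm v, mul_comm t, mul_comm s, hc_mul hx, hc_mul hy, hc_mul hz,
    hc_mul hw, homogeneousComponent_eq_self hg] at this
  simp only [homogeneousComponent_zero] at this
  exact ⟨coeff 0 u, coeff 0 v, coeff 0 t, coeff 0 s, by rw [← this]; ring⟩

lemma span_swap (x y z w : RR) : Ideal.span {z, w, x, y} = Ideal.span {x, y, z, w} := by
  congr 1; ext t; simp; tauto

lemma syzP' {x y z w u v : RR} (h : LI ![x, y, z, w]) (huv : z * u + w * v ∈ Ideal.span {x, y}) :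
    v ∈ Ideal.span {x, y, z, w} := by
  obtain ⟨p1, q1, -, -, n1, n2, -⟩ := h.facts
  have hle : Ideal.span {x, y} ≤ Ideal.span {x, y, z} := Ideal.span_mono (by intro t; simp; tauto)
  have hle2 : Ideal.span {x, y, z} ≤ Ideal.span {x, y, z, w} := Ideal.span_mono (by intro t; simp; tauto)
  have hv : v ∈ Ideal.span {x, y, z} := by
    refine (q1.mem_or_mem (?_ : w * v ∈ _)).resolve_left n2
    have := Ideal.sub_mem _ (hle huv) (Ideal.mul_mem_right u _ (Ideal.subset_span (by simp : z ∈ ({x, y, z} : Set RR))))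
    convert this using 1; ring
  exact hle2 hv

lemma syzP {x y z w u v : RR} (h : LI ![x, y, z, w]) (huv : z * u + w * v ∈ Ideal.span {x, y}) :
    u ∈ Ideal.span {x, y, z, w} ∧ v ∈ Ideal.span {x, y, z, w} := by
  refine ⟨?_, syzP' h huv⟩
  have h' : LI ![x, y, w, z] := by
    rw [LI.quad] at h ⊢
    obtain ⟨h1, h2, h3, h4, h5⟩ := h
    refine ⟨h1, h2, h4, h3, fun a b c d e => ?_⟩
    obtain ⟨q1, q2, q3, q4⟩ := h5 a b d c (by rw [← e]; abel)
    exact ⟨q1, q2, q4, q3⟩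
  have := syzP' h' (u := v) (v := u) (by rwa [add_comm])
  have e : Ideal.span {x, y, w, z} = Ideal.span {x, y, z, w} := by congr 1; ext t; simp; tauto
  rwa [e] at this

/-- case (b): the vector `(A,B)` is not in `P` -/
lemma Cub.eta {x y z w f l₁ l₂ l₃ l₄ A B : RR} {K₁ : Ideal RR} (h : LI ![x, y, z, w])
    (hf : Cub x y z w f l₁ l₂ l₃ l₄)
    (k1 : KS (Ideal.span {x, y}) K₁ x y A B) (hp : HP (Ideal.span {x, y}) A B 1) (hf1 : f ∈ K₁)
    (hAB : A ∉ Ideal.span {x, y, z, w} ∨ B ∉ Ideal.span {x, y, z, w}) :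
    ∃ r s : k, l₁ - C r * A ∈ Ideal.span {x, y, z, w} ∧ l₂ - C s * A ∈ Ideal.span {x, y, z, w} ∧
      l₃ - C r * B ∈ Ideal.span {x, y, z, w} ∧ l₄ - C s * B ∈ Ideal.span {x, y, z, w} ∧
      (r = 0 → s = 0 → z * l₁ + w * l₂ ∈ Ideal.span {x, y} ∧ z * l₃ + w * l₄ ∈ Ideal.span {x, y}) := by
  obtain ⟨p1, -, P, -⟩ := h.facts
  obtain ⟨hx, hy, hz, hw, -⟩ := LI.quad.1 h
  have hzP : z ∈ Ideal.span {x, y, z, w} := Ideal.subset_span (by simp)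
  have hwP : w ∈ Ideal.span {x, y, z, w} := Ideal.subset_span (by simp)
  have hle : Ideal.span {x, y} ≤ Ideal.span {x, y, z, w} := Ideal.span_mono (by intro t; simp; tauto)
  obtain ⟨η, hη, -, s1, s2⟩ := hp.prim 2 _ _ ((hz.mul hf.h₁).add (hw.mul hf.h₂)) ((hz.mul hf.h₃).add (hw.mul hf.h₄)) (hf.k1 k1 hf1)
  have hηP : η ∈ Ideal.span {x, y, z, w} := by
    rcases hAB with h0 | h0
    · refine (P.mem_or_mem (?_ : η * A ∈ _)).resolve_right h0
      have := Ideal.sub_mem _ (Ideal.add_mem _ (Ideal.mul_mem_right l₁ _ hzP) (Ideal.mul_mem_right l₂ _ hwP)) (hle s1)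
      simpa using this
    · refine (P.mem_or_mem (?_ : η * B ∈ _)).resolve_right h0
      have := Ideal.sub_mem _ (Ideal.add_mem _ (Ideal.mul_mem_right l₃ _ hzP) (Ideal.mul_mem_right l₄ _ hwP)) (hle s2)
      simpa using this
  obtain ⟨a, b, r, s, e⟩ := hom_quad hx hy hz hw hη hηP
  have hab : C a * x + C b * y ∈ Ideal.span {x, y} := Ideal.mem_span_pair.2 ⟨_, _, rfl⟩
  obtain ⟨a1, a2⟩ := syzP h (u := l₁ - C r * A) (v := l₂ - C s * A) (by
    have := Ideal.add_mem _ s1 (Ideal.mul_mem_right A _ hab)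
    rw [e] at this
    convert this using 1; ring)
  obtain ⟨a3, a4⟩ := syzP h (u := l₃ - C r * B) (v := l₄ - C s * B) (by
    have := Ideal.add_mem _ s2 (Ideal.mul_mem_right B _ hab)
    rw [e] at this
    convert this using 1; ring)
  refine ⟨r, s, a1, a2, a3, a4, ?_⟩
  rintro rfl rfl
  rw [C_0, zero_mul, zero_mul, add_zero, add_zero] at e
  rw [← e] at hab
  constructor
  · have := Ideal.add_mem _ s1 (Ideal.mul_mem_right A _ hab)
    simpa using this
  · have := Ideal.add_mem _ s2 (Ideal.mul_mem_right B _ hab)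
    simpa using this

lemma C_zero_of_mul {P : Ideal RR} (hP : P.IsPrime) {A B : RR} (hAB : A ∉ P ∨ B ∉ P) {r : k}
    (h1 : C r * A ∈ P) (h2 : C r * B ∈ P) : r = 0 := by
  by_contra hr
  rcases hAB with h0 | h0
  · exact ((hP.mem_or_mem h1).resolve_right h0 |> C_not_mem hP hr)
  · exact ((hP.mem_or_mem h2).resolve_right h0 |> C_not_mem hP hr)

lemma Cub.allP {x y z w f l₁ l₂ l₃ l₄ A B : RR} {K₁ : Ideal RR} (h : LI ![x, y, z, w])
    (hf : Cub x y z w f l₁ l₂ l₃ l₄)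
    (k1 : KS (Ideal.span {x, y}) K₁ x y A B) (hp : HP (Ideal.span {x, y}) A B 1) (hf1 : f ∈ K₁)
    (hAB : A ∉ Ideal.span {x, y, z, w} ∨ B ∉ Ideal.span {x, y, z, w})
    (h1 : l₁ ∈ Ideal.span {x, y, z, w}) (h2 : l₂ ∈ Ideal.span {x, y, z, w})
    (h3 : l₃ ∈ Ideal.span {x, y, z, w}) (h4 : l₄ ∈ Ideal.span {x, y, z, w}) :
    z * l₁ + w * l₂ ∈ Ideal.span {x, y} ∧ z * l₃ + w * l₄ ∈ Ideal.span {x, y} := by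
  obtain ⟨-, -, P, -⟩ := h.facts
  obtain ⟨r, s, a1, a2, a3, a4, a5⟩ := hf.eta h k1 hp hf1 hAB
  refine a5 (C_zero_of_mul P hAB ?_ ?_) (C_zero_of_mul P hAB ?_ ?_)
  · simpa using Ideal.sub_mem _ h1 a1
  · simpa using Ideal.sub_mem _ h3 a3
  · simpa using Ideal.sub_mem _ h2 a2
  · simpa using Ideal.sub_mem _ h4 a4

/-- rank one matrices modulo `P` -/
lemma det_P {R : Type} [CommRing R] {P : Ideal R} {l₁ l₂ l₃ l₄ r s A B : R} (h1 : l₁ - r * A ∈ P) (h2 : l₂ - s * A ∈ P)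
    (h3 : l₃ - r * B ∈ P) (h4 : l₄ - s * B ∈ P) : l₁ * l₄ - l₂ * l₃ ∈ P := by
  have := P.sub_mem (P.add_mem (P.mul_mem_right l₄ h1) (P.mul_mem_left (r * A) h4))
    (P.add_mem (P.mul_mem_right l₃ h2) (P.mul_mem_left (s * A) h3))
  convert this using 1; ring

lemma det_mu {R : Type} [CommRing R] {P : Ideal R} (hP : P.IsPrime) {l₁ l₂ l₃ l₄ μ cx cy dx dy : R}
    (h1 : l₁ - μ * cx ∈ P) (h3 : l₃ - μ * cy ∈ P) (h2 : l₂ - μ * dx ∈ P) (h4 : l₄ - μ * dy ∈ P)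
    (hd : l₁ * l₄ - l₂ * l₃ ∈ P) (hdet : cx * dy - cy * dx ∉ P) : l₁ ∈ P ∧ l₂ ∈ P ∧ l₃ ∈ P ∧ l₄ ∈ P := by
  have h5 : μ ∈ P := by
    have h6 : (cx * dy - cy * dx) * (μ * μ) ∈ P := by
      have := P.sub_mem hd (P.sub_mem (P.add_mem (P.mul_mem_right l₄ h1) (P.mul_mem_left (μ * cx) h4))
        (P.add_mem (P.mul_mem_right l₃ h2) (P.mul_mem_left (μ * dx) h3)))
      convert this using 1; ring
    exact ((hP.mem_or_mem ((hP.mem_or_mem h6).resolve_left hdet))).elim id id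
  refine ⟨?_, ?_, ?_, ?_⟩
  · simpa using P.add_mem h1 (P.mul_mem_right cx h5)
  · simpa using P.add_mem h2 (P.mul_mem_right dx h5)
  · simpa using P.add_mem h3 (P.mul_mem_right cy h5)
  · simpa using P.add_mem h4 (P.mul_mem_right dy h5)

lemma caseB1 {x y z w f l₁ l₂ l₃ l₄ g m₁ m₂ m₃ m₄ A B c d : RR} {K₁ K₂ : Ideal RR} (h : LI ![x, y, z, w])
    (hf : Cub x y z w f l₁ l₂ l₃ l₄) (hg : Cub x y z w g m₁ m₂ m₃ m₄)
    (k1 : KS (Ideal.span {x, y}) K₁ x y A B) (hp : HP (Ideal.span {x, y}) A B 1)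
    (k2 : KS (Ideal.span {z, w}) K₂ z w c d) (hp2 : HP (Ideal.span {z, w}) c d 1)
    (hf1 : f ∈ K₁) (hg1 : g ∈ K₁) (hf2 : f ∈ K₂) (hg2 : g ∈ K₂)
    (hf3 : f.IsHomogeneous 3) (hf0 : f ≠ 0) (hrel : IsRelPrime f g)
    (hAB : A ∉ Ideal.span {x, y, z, w} ∨ B ∉ Ideal.span {x, y, z, w})
    (hc : c ∈ Ideal.span {x, y, z, w}) (hd : d ∈ Ideal.span {x, y, z, w}) : False := by
  obtain ⟨p1, -, P, -⟩ := h.facts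
  obtain ⟨p2, -⟩ := h.swap.facts
  obtain ⟨hx, hy, hz, hw, -⟩ := LI.quad.1 h
  obtain ⟨cx, cy, cz, cw, ec⟩ := hom_quad hx hy hz hw hp2.ha hc
  obtain ⟨dx, dy, dz, dw, ed⟩ := hom_quad hx hy hz hw hp2.hb hd
  have hc2 : C cz * z + C cw * w ∈ Ideal.span {z, w} := Ideal.mem_span_pair.2 ⟨_, _, rfl⟩
  have hd2 : C dz * z + C dw * w ∈ Ideal.span {z, w} := Ideal.mem_span_pair.2 ⟨_, _, rfl⟩
  have hCC : ∀ t : k, (C t : RR) ∈ Ideal.span {z, w} → t = 0 := fun t ht => by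
    by_contra h0; exact C_not_mem p2 h0 ht
  have hprim : ∀ u v : k, C u * d - C v * c ∈ Ideal.span {z, w} → u = 0 ∧ v = 0 := by
    intro u v huv
    obtain ⟨s, -, hs, q1, q2⟩ := hp2.prim 0 _ _ (isHomogeneous_C _ u) (isHomogeneous_C _ v) huv
    rw [hs (by norm_num), zero_mul, sub_zero] at q1 q2
    exact ⟨hCC _ q1, hCC _ q2⟩
  have hdet : cx * dy - cy * dx ≠ 0 := by
    intro h0
    have h1 : (C cx * C dy - C cy * C dx : RR) = 0 := by rw [← C_mul, ← C_mul, ← C_sub, h0, C_0]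
    obtain ⟨rfl, rfl⟩ := hprim cx dx (by
      have := Ideal.sub_mem _ (Ideal.mul_mem_left _ (C cx) hd2) (Ideal.mul_mem_left _ (C dx) hc2)
      convert this using 1
      rw [ec, ed]; linear_combination y * h1)
    obtain ⟨rfl, rfl⟩ := hprim cy dy (by
      have := Ideal.sub_mem _ (Ideal.mul_mem_left _ (C cy) hd2) (Ideal.mul_mem_left _ (C dy) hc2)
      convert this using 1
      rw [ec, ed]; linear_combination -x * h1)
    rcases hp2.ab with h2 | h2
    · apply h2; rw [ec]; simpa using hc2
    · apply h2; rw [ed]; simpa using hd2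
  have hdet' : (C cx * C dy - C cy * C dx : RR) ∉ Ideal.span {x, y, z, w} := by
    rw [← C_mul, ← C_mul, ← C_sub]; exact C_not_mem P hdet
  have key : ∀ {f l₁ l₂ l₃ l₄ : RR}, Cub x y z w f l₁ l₂ l₃ l₄ → f ∈ K₁ → f ∈ K₂ →
      z * l₁ + w * l₂ ∈ Ideal.span {x, y} ∧ z * l₃ + w * l₄ ∈ Ideal.span {x, y} := by
    intro f l₁ l₂ l₃ l₄ hf hf1 hf2
    obtain ⟨μ, -, -, s1, s2⟩ := hp2.prim 2 _ _ ((hx.mul hf.h₁).add (hy.mul hf.h₃)) ((hx.mul hf.h₂).add (hy.mul hf.h₄))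
      (hf.swap.k1 k2 hf2)
    obtain ⟨a1, a3⟩ := syzP h.swap (u := l₁ - μ * C cx) (v := l₃ - μ * C cy) (by
      have := Ideal.add_mem _ s1 (Ideal.mul_mem_left _ μ hc2)
      rw [ec] at this
      convert this using 1; ring)
    obtain ⟨a2, a4⟩ := syzP h.swap (u := l₂ - μ * C dx) (v := l₄ - μ * C dy) (by
      have := Ideal.add_mem _ s2 (Ideal.mul_mem_left _ μ hd2)
      rw [ed] at this
      convert this using 1; ring)
    rw [span_swap] at a1 a2 a3 a4
    obtain ⟨r, s, b1, b2, b3, b4, -⟩ := hf.eta h k1 hp hf1 hAB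
    obtain ⟨c1, c2, c3, c4⟩ := det_mu P a1 a3 a2 a4 (det_P b1 b2 b3 b4) hdet'
    exact hf.allP h k1 hp hf1 hAB c1 c2 c3 c4
  obtain ⟨u1, u2⟩ := key hf hf1 hf2
  obtain ⟨u3, u4⟩ := key hg hg1 hg2
  exact hf.not_both h hg k2 hf2 hg2 hf3 hf0 hrel u1 u2 u3 u4

lemma rat_P {R : Type} [CommRing R] {P : Ideal R} (hP : P.IsPrime) {l₁ l₂ l₃ l₄ r s m n A B c d : R}
    (hAB : A ∉ P ∨ B ∉ P) (h1 : l₁ - r * A ∈ P) (h2 : l₂ - s * A ∈ P)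
    (h3 : l₃ - r * B ∈ P) (h4 : l₄ - s * B ∈ P) (h1' : l₁ - m * c ∈ P) (h3' : l₃ - n * c ∈ P)
    (h2' : l₂ - m * d ∈ P) (h4' : l₄ - n * d ∈ P) : r * d - s * c ∈ P := by
  rcases hAB with h0 | h0
  · refine (hP.mem_or_mem (?_ : A * (r * d - s * c) ∈ P)).resolve_left h0
    have := P.sub_mem (P.mul_mem_left d (P.sub_mem h1' h1)) (P.mul_mem_left c (P.sub_mem h2' h2))
    convert this using 1; ring
  · refine (hP.mem_or_mem (?_ : B * (r * d - s * c) ∈ P)).resolve_left h0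
    have := P.sub_mem (P.mul_mem_left d (P.sub_mem h3' h3)) (P.mul_mem_left c (P.sub_mem h4' h4))
    convert this using 1; ring

lemma comb_P {R : Type} [CommRing R] {P : Ideal R} {l m r r' a b A : R} (h1 : l - r * A ∈ P) (h2 : m - r' * A ∈ P)
    (e : a * r + b * r' = 0) : a * l + b * m ∈ P := by
  have := P.add_mem (P.mul_mem_left a h1) (P.mul_mem_left b h2)
  convert this using 1; linear_combination A * e

lemma caseB2 {x y z w f l₁ l₂ l₃ l₄ g m₁ m₂ m₃ m₄ A B c d : RR} {K₁ K₂ : Ideal RR} (h : LI ![x, y, z, w])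
    (hf : Cub x y z w f l₁ l₂ l₃ l₄) (hg : Cub x y z w g m₁ m₂ m₃ m₄)
    (k1 : KS (Ideal.span {x, y}) K₁ x y A B) (hp : HP (Ideal.span {x, y}) A B 1)
    (k2 : KS (Ideal.span {z, w}) K₂ z w c d) (hp2 : HP (Ideal.span {z, w}) c d 1)
    (hf1 : f ∈ K₁) (hg1 : g ∈ K₁) (hf2 : f ∈ K₂) (hg2 : g ∈ K₂)
    (hf3 : f.IsHomogeneous 3) (hf0 : f ≠ 0) (hrel : IsRelPrime f g)
    (hAB : A ∉ Ideal.span {x, y, z, w} ∨ B ∉ Ideal.span {x, y, z, w})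
    (hcd : c ∉ Ideal.span {x, y, z, w} ∨ d ∉ Ideal.span {x, y, z, w}) : False := by
  obtain ⟨p1, -, P, -⟩ := h.facts
  obtain ⟨r, s, b1, b2, b3, b4, -⟩ := hf.eta h k1 hp hf1 hAB
  obtain ⟨r', s', b1', b2', b3', b4', -⟩ := hg.eta h k1 hp hg1 hAB
  have hcd' := hcd
  rw [← span_swap] at hcd'
  obtain ⟨m, n, c1, c3, c2, c4, -⟩ := hf.swap.eta h.swap k2 hp2 hf2 hcd'
  obtain ⟨m', n', c1', c3', c2', c4', -⟩ := hg.swap.eta h.swap k2 hp2 hg2 hcd'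
  rw [span_swap] at c1 c2 c3 c4 c1' c2' c3' c4'
  have d1 := rat_P P hAB b1 b2 b3 b4 c1 c3 c2 c4
  have d2 := rat_P P hAB b1' b2' b3' b4' c1' c3' c2' c4'
  have hdet : r * s' - s * r' = 0 := by
    refine C_zero_of_mul P hcd ?_ ?_
    · have := Ideal.sub_mem _ (Ideal.mul_mem_left _ (C r') d1) (Ideal.mul_mem_left _ (C r) d2)
      convert this using 1
      simp only [C_sub, C_mul]; ring
    · have := Ideal.sub_mem _ (Ideal.mul_mem_left _ (C s') d1) (Ideal.mul_mem_left _ (C s) d2)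
      convert this using 1
      simp only [C_sub, C_mul]; ring
  have hex : ∃ α β : k, (α ≠ 0 ∨ β ≠ 0) ∧ α * r + β * r' = 0 ∧ α * s + β * s' = 0 := by
    by_cases h1 : r = 0 ∧ r' = 0
    · obtain ⟨rfl, rfl⟩ := h1
      by_cases h2 : s = 0 ∧ s' = 0
      · obtain ⟨rfl, rfl⟩ := h2
        exact ⟨1, 0, by simp, by simp, by simp⟩
      · exact ⟨s', -s, by rw [neg_ne_zero]; tauto, by ring, by ring⟩
    · exact ⟨r', -r, by rw [neg_ne_zero]; tauto, by ring, by linear_combination -hdet⟩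
  obtain ⟨α, β, h0, e1, e2⟩ := hex
  have e1' : (C α * C r + C β * C r' : RR) = 0 := by rw [← C_mul, ← C_mul, ← C_add, e1, C_0]
  have e2' : (C α * C s + C β * C s' : RR) = 0 := by rw [← C_mul, ← C_mul, ← C_add, e2, C_0]
  have hc := hf.comb hg α β
  have g1 := comb_P b1 b1' e1'
  have g2 := comb_P b2 b2' e2'
  have g3 := comb_P b3 b3' e1'
  have g4 := comb_P b4 b4' e2'
  obtain ⟨u1, u2⟩ := hc.allP h k1 hp (K₁.add_mem (K₁.mul_mem_left _ hf1) (K₁.mul_mem_left _ hg1)) hAB g1 g2 g3 g4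
  rw [← span_swap] at g1 g2 g3 g4
  obtain ⟨u3, u4⟩ := hc.swap.allP h.swap k2 hp2 (K₂.add_mem (K₂.mul_mem_left _ hf2) (K₂.mul_mem_left _ hg2)) hcd' g1 g3 g2 g4
  exact no_comb hf3 hf0 hrel h0 (hc.zz h u1 u2 u3 u4)

lemma quad_range {x y z w A : RR} (h : LI ![x, y, z, w]) (hA : A.IsHomogeneous 1) (hAP : A ∈ Ideal.span {x, y, z, w}) :
    ∃ A0, (aeval (R := k) ![x, y, z, w]).toRingHom A0 = A := by
  obtain ⟨hx, hy, hz, hw, -⟩ := LI.quad.1 h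
  obtain ⟨a, b, c, d, rfl⟩ := hom_quad hx hy hz hw hA hAP
  exact ⟨C a * X 0 + C b * X 1 + C c * X 2 + C d * X 3, by simp [algebraMap_eq]⟩

lemma caseE1 {x y z w f l₁ l₂ l₃ l₄ g m₁ m₂ m₃ m₄ A B c d : RR} {K₁ K₂ : Ideal RR} (h : LI ![x, y, z, w])
    (hf : Cub x y z w f l₁ l₂ l₃ l₄) (hg : Cub x y z w g m₁ m₂ m₃ m₄)
    (k1 : KS (Ideal.span {x, y}) K₁ x y A B) (hp : HP (Ideal.span {x, y}) A B 1)
    (k2 : KS (Ideal.span {z, w}) K₂ z w c d) (hp2 : HP (Ideal.span {z, w}) c d 1)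
    (hf1 : f ∈ K₁) (hg1 : g ∈ K₁) (hf2 : f ∈ K₂) (hg2 : g ∈ K₂)
    (hf3 : f.IsHomogeneous 3) (hf0 : f ≠ 0) (hrel : IsRelPrime f g) :
    PD RR 4 (RR ⧸ (K₁ ⊔ K₂)) := by
  by_cases hAB : A ∉ Ideal.span {x, y, z, w} ∨ B ∉ Ideal.span {x, y, z, w}
  · by_cases hcd : c ∉ Ideal.span {x, y, z, w} ∨ d ∉ Ideal.span {x, y, z, w}
    · exact (caseB2 h hf hg k1 hp k2 hp2 hf1 hg1 hf2 hg2 hf3 hf0 hrel hAB hcd).elim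
    · push Not at hcd
      exact (caseB1 h hf hg k1 hp k2 hp2 hf1 hg1 hf2 hg2 hf3 hf0 hrel hAB hcd.1 hcd.2).elim
  · push Not at hAB
    by_cases hcd : c ∉ Ideal.span {x, y, z, w} ∨ d ∉ Ideal.span {x, y, z, w}
    · rw [← span_swap] at hcd hAB
      exact (caseB1 h.swap hf.swap hg.swap k2 hp2 k1 hp hf2 hg2 hf1 hg1 hf3 hf0 hrel hcd hAB.1 hAB.2).elim
    · push Not at hcd
      have ex : (aeval (R := k) ![x, y, z, w]).toRingHom (X 0) = x := by simp
      have ey : (aeval (R := k) ![x, y, z, w]).toRingHom (X 1) = y := by simp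
      have ez : (aeval (R := k) ![x, y, z, w]).toRingHom (X 2) = z := by simp
      have ew : (aeval (R := k) ![x, y, z, w]).toRingHom (X 3) = w := by simp
      have hE1 : Extd (aeval (R := k) ![x, y, z, w]).toRingHom K₁ := by
        obtain ⟨F0, e1⟩ := quad_range h hp.ha hAB.1
        obtain ⟨G0, e2⟩ := quad_range h hp.hb hAB.2
        refine KS.extd (p := Ideal.span {x, y}) (x := X 0) (y := X 1) (a := F0) (b := G0) h.flat ?_
        rw [ex, ey, e1, e2]; exact k1
      have hE2 : Extd (aeval (R := k) ![x, y, z, w]).toRingHom K₂ := by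
        obtain ⟨F0, e1⟩ := quad_range h hp2.ha hcd.1
        obtain ⟨G0, e2⟩ := quad_range h hp2.hb hcd.2
        refine KS.extd (p := Ideal.span {z, w}) (x := X 2) (y := X 3) (a := F0) (b := G0) h.flat ?_
        rw [ez, ew, e1, e2]; exact k2
      exact h.extd_pd hE1 hE2
        (k1.sq (Ideal.mul_mem_mul (Ideal.subset_span (by simp)) (Ideal.subset_span (by simp))))
        (k1.sq (Ideal.mul_mem_mul (Ideal.subset_span (by simp)) (Ideal.subset_span (by simp))))
        (k2.sq (Ideal.mul_mem_mul (Ideal.subset_span (by simp)) (Ideal.subset_span (by simp))))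
        (k2.sq (Ideal.mul_mem_mul (Ideal.subset_span (by simp)) (Ideal.subset_span (by simp))))

lemma exists_side {x y z w f l₁ l₂ l₃ l₄ g m₁ m₂ m₃ m₄ a b c d : RR} {K₁ K₂ : Ideal RR} (h : LI ![x, y, z, w])
    (hf : Cub x y z w f l₁ l₂ l₃ l₄) (hg : Cub x y z w g m₁ m₂ m₃ m₄)
    (k1 : KS (Ideal.span {x, y}) K₁ x y a b) (k2 : KS (Ideal.span {z, w}) K₂ z w c d)
    (hf1 : f ∈ K₁) (hg1 : g ∈ K₁) (hf2 : f ∈ K₂) (hg2 : g ∈ K₂)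
    (hf3 : f.IsHomogeneous 3) (hf0 : f ≠ 0) (hrel : IsRelPrime f g) :
    ∃ A B e, HP (Ideal.span {x, y}) A B e ∧ KS (Ideal.span {x, y}) K₁ x y A B ∧ e ≤ 2 := by
  obtain ⟨p1, -, -, ufd, -⟩ := h.facts
  obtain ⟨hx, hy, hz, hw, -⟩ := LI.quad.1 h
  have hh : HI (Ideal.span {x, y}) := HI_span _ (by rintro t (rfl | rfl) <;> assumption)
  have key : ∀ {f l₁ l₂ l₃ l₄ : RR}, Cub x y z w f l₁ l₂ l₃ l₄ → f ∈ K₁ →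
      (z * l₁ + w * l₂ ∉ Ideal.span {x, y} ∨ z * l₃ + w * l₄ ∉ Ideal.span {x, y}) →
      ∃ A B e, HP (Ideal.span {x, y}) A B e ∧ KS (Ideal.span {x, y}) K₁ x y A B ∧ e ≤ 2 := by
    intro f l₁ l₂ l₃ l₄ hf hf1 hn
    have u1 := (hz.mul hf.h₁).add (hw.mul hf.h₂)
    have u2 := (hz.mul hf.h₃).add (hw.mul hf.h₄)
    obtain ⟨A, B, e, hp, hr⟩ := exists_HP _ hh k1.ab u1 u2 hn (hf.k1 k1 hf1)
    have kk := k1.change hp.ab hr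
    refine ⟨A, B, e, hp, kk, ?_⟩
    by_contra he
    obtain ⟨s, -, hs, q1, q2⟩ := hp.prim 2 _ _ u1 u2 (hf.k1 kk hf1)
    rw [hs (by omega), zero_mul, sub_zero] at q1 q2
    tauto
  by_cases h1 : z * l₁ + w * l₂ ∉ Ideal.span {x, y} ∨ z * l₃ + w * l₄ ∉ Ideal.span {x, y}
  · exact key hf hf1 h1
  by_cases h2 : z * m₁ + w * m₂ ∉ Ideal.span {x, y} ∨ z * m₃ + w * m₄ ∉ Ideal.span {x, y}
  · exact key hg hg1 h2
  push Not at h1 h2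
  exact (hf.not_both h hg k2 hf2 hg2 hf3 hf0 hrel h1.1 h1.2 h2.1 h2.2).elim

lemma caseA4 {x y z w f g a b c d : RR} {K₁ K₂ : Ideal RR} (h : LI ![x, y, z, w])
    (k1 : KS (Ideal.span {x, y}) K₁ x y a b) (k2 : KS (Ideal.span {z, w}) K₂ z w c d)
    (hf1 : f ∈ K₁) (hg1 : g ∈ K₁) (hf2 : f ∈ K₂) (hg2 : g ∈ K₂)
    (hf3 : f.IsHomogeneous 3) (hg3 : g.IsHomogeneous 3) (hf0 : f ≠ 0) (hrel : IsRelPrime f g) :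
    PD RR 4 (RR ⧸ (K₁ ⊓ K₂)) := by
  obtain ⟨l₁, l₂, l₃, l₄, hf⟩ := exists_Cub h hf3 (k1.le hf1) (k2.le hf2)
  obtain ⟨m₁, m₂, m₃, m₄, hg⟩ := exists_Cub h hg3 (k1.le hg1) (k2.le hg2)
  obtain ⟨A, B, e, hp, k1', he⟩ := exists_side h hf hg k1 k2 hf1 hg1 hf2 hg2 hf3 hf0 hrel
  obtain ⟨A', B', e', hp', k2', he'⟩ := exists_side h.swap hf.swap hg.swap k2 k1 hf2 hg2 hf1 hg1 hf3 hf0 hrel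
  obtain ⟨-, -, -, u1, -, -, d1⟩ := h.facts
  obtain ⟨-, -, -, u2, -, -, d2⟩ := h.swap.facts
  have p1 := h.facts.1
  have p2 := h.swap.facts.1
  have main : PD RR 5 (RR ⧸ (K₁ ⊔ K₂)) := by
    obtain rfl | he0 := Nat.eq_zero_or_pos e
    · obtain ⟨α, rfl⟩ := hom_zero hp.ha
      obtain ⟨β, rfl⟩ := hom_zero hp.hb
      exact caseE0 h k1' k2
    obtain rfl | he0' := Nat.eq_zero_or_pos e'
    · obtain ⟨α, rfl⟩ := hom_zero hp'.ha
      obtain ⟨β, rfl⟩ := hom_zero hp'.hb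
      exact (caseE0 h.swap k2' k1).eq (sup_comm _ _)
    obtain rfl | he1 : e = 2 ∨ e = 1 := by omega
    · exact (caseE2 h hf hg k1' hp k2 hf1 hg1 hf2 hg2 hf3 hf0 hrel).mono (by norm_num)
    obtain rfl | he1' : e' = 2 ∨ e' = 1 := by omega
    · exact ((caseE2 h.swap hf.swap hg.swap k2' hp' k1 hf2 hg2 hf1 hg1 hf3 hf0 hrel).mono (by norm_num)).eq (sup_comm _ _)
    subst he1 he1'
    exact (caseE1 h hf hg k1' hp k2' hp' hf1 hg1 hf2 hg2 hf3 hf0 hrel).mono (by norm_num)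
  exact PD.inf K₁ K₂ ((k1.pd d1).mono (by norm_num)) ((k2.pd d2).mono (by norm_num)) main

end

end

section
variable {k : Type} [Field k] {N : ℕ}
local notation "RR" => MvPolynomial (Fin N) k

lemma LI.prime_head {m : ℕ} {l : Fin m → RR} (h : LI l) (i : Fin m) : Prime (l i) := by
  have h1 := h.prime {i}
  rw [Set.image_singleton] at h1
  exact (Ideal.span_singleton_prime (h.li.ne_zero i)).1 h1

lemma LI.not_dvd {m : ℕ} {l : Fin m → RR} (h : LI l) {i j : Fin m} (hij : j ≠ i) : ¬ l i ∣ l j := by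
  rw [← Ideal.mem_span_singleton]
  have := h.not_mem (A := {i}) (i := j) (by simpa using hij)
  rwa [Set.image_singleton] at this

lemma LI.facts3 {x y z : RR} (h : LI ![x, y, z]) :
    (Ideal.span {x, y}).IsPrime ∧ (Ideal.span {x, z}).IsPrime ∧ (Ideal.span {x, y} ⊔ Ideal.span {x, z}).IsPrime ∧
    UniqueFactorizationMonoid (RR ⧸ Ideal.span {x, y}) ∧ UniqueFactorizationMonoid (RR ⧸ Ideal.span {x, z}) ∧
    UniqueFactorizationMonoid (RR ⧸ (Ideal.span {x, y} ⊔ Ideal.span {x, z})) ∧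
    PD RR 2 (RR ⧸ Ideal.span {x, y}) ∧ PD RR 2 (RR ⧸ Ideal.span {x, z}) ∧
    PD RR 3 (RR ⧸ (Ideal.span {x, y} ⊔ Ideal.span {x, z})) ∧
    z ∉ Ideal.span {x, y} ∧ y ∉ Ideal.span {x, z} := by
  have e2 : Ideal.span (![x, y, z] '' (({0, 1} : Finset (Fin 3)) : Set (Fin 3))) = Ideal.span {x, y} := by
    congr 1; simp [Set.image_insert_eq]
  have e3 : Ideal.span (![x, y, z] '' (({0, 2} : Finset (Fin 3)) : Set (Fin 3))) = Ideal.span {x, z} := by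
    congr 1; simp [Set.image_insert_eq]
  have e4 : Ideal.span (![x, y, z] '' (({0, 1, 2} : Finset (Fin 3)) : Set (Fin 3))) =
      Ideal.span {x, y} ⊔ Ideal.span {x, z} := by
    rw [← Ideal.span_union]
    congr 1; simp [Set.image_insert_eq]; ext t; simp; tauto
  exact ⟨e2 ▸ h.prime _, e3 ▸ h.prime _, e4 ▸ h.prime _, e2 ▸ h.ufd _, e3 ▸ h.ufd _, e4 ▸ h.ufd _,
    (h.pd {0, 1}).eq e2, (h.pd {0, 2}).eq e3, (h.pd {0, 1, 2}).eq e4,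
    e2 ▸ h.not_mem (A := (({0, 1} : Finset (Fin 3)) : Set (Fin 3))) (i := 2) (by simp),
    e3 ▸ h.not_mem (A := (({0, 2} : Finset (Fin 3)) : Set (Fin 3))) (i := 1) (by simp)⟩

lemma final3 {x y z a b c d f₁ f₂ : RR} {K₁ K₂ L : Ideal RR} (h : LI ![x, y, z])
    (k1 : KS (Ideal.span {x, y}) K₁ x y a b) (k2 : KS (Ideal.span {x, z}) K₂ x z c d)
    (hf0 : f₁ ≠ 0) (hrel : IsRelPrime f₁ f₂) (h1 : f₁ ∈ K₁ ⊓ K₂) (h2 : f₂ ∈ K₁ ⊓ K₂)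
    (hL : L = K₁ ⊓ K₂ ∨ L = (Ideal.span {f₁, f₂}).colon ((K₁ ⊓ K₂ : Ideal RR) : Set RR)) : PD RR 4 (RR ⧸ L) := by
  obtain ⟨i1, i2, i3, u1, u2, u3, d1, d2, d3, hz, hy⟩ := h.facts3
  have px : Prime x := h.prime_head 0
  have hxyz : ¬ x ∣ y * z := by
    intro hd
    rcases px.dvd_or_dvd hd with h0 | h0
    · exact h.not_dvd (i := 0) (j := 1) (by decide) h0
    · exact h.not_dvd (i := 0) (j := 2) (by decide) h0
  have hD : PD RR 2 (RR ⧸ Ideal.span {x, y * z}) := ci_pd px.ne_zero (px.irreducible.isRelPrime_iff_not_dvd.2 hxyz)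
  rcases hL with rfl | rfl
  · exact caseA3 _ _ K₁ K₂ x y z a b c d d1 d2 d3 hD k1 k2 hz hy
  · exact caseB3 _ _ K₁ K₂ x y z a b c d f₁ f₂ d1 d2 d3 hD k1 k2 hz hy px hxyz (ci_syz hf0 hrel)
      (fun hh => px.not_isUnit (hrel hh.1 hh.2)) h1 h2 (ci_pd hf0 hrel)

lemma final4 {x y z w a b c d f₁ f₂ : RR} {K₁ K₂ L : Ideal RR} (h : LI ![x, y, z, w])
    (k1 : KS (Ideal.span {x, y}) K₁ x y a b) (k2 : KS (Ideal.span {z, w}) K₂ z w c d)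
    (hf₁ : f₁.IsHomogeneous 3) (hf₂ : f₂.IsHomogeneous 3)
    (hf0 : f₁ ≠ 0) (hrel : IsRelPrime f₁ f₂) (h1 : f₁ ∈ K₁ ⊓ K₂) (h2 : f₂ ∈ K₁ ⊓ K₂)
    (hL : L = K₁ ⊓ K₂ ∨ L = (Ideal.span {f₁, f₂}).colon ((K₁ ⊓ K₂ : Ideal RR) : Set RR)) : PD RR 4 (RR ⧸ L) := by
  rcases hL with rfl | rfl
  · exact caseA4 h k1 k2 h1.1 h2.1 h1.2 h2.2 hf₁ hf₂ hf0 hrel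
  · obtain ⟨i1, i3, i4, u1, nz, nw, d1⟩ := h.facts
    obtain ⟨i2, -, -, u2, -, -, d2⟩ := h.swap.facts
    have px : Prime x := h.prime_head 0
    have pz : Prime z := h.prime_head 2
    have hxy : ¬ x ∣ y := h.not_dvd (i := 0) (j := 1) (by decide)
    have hzw : ¬ z ∣ w := h.not_dvd (i := 2) (j := 3) (by decide)
    have hC : PD RR 2 (RR ⧸ Ideal.span {f₁, f₂}) := ci_pd hf0 hrel
    have L1 := linkage_one x y f₁ f₂ px hxy (ci_syz hf0 hrel) (fun hh => px.not_isUnit (hrel hh.1 hh.2)) _ K₁ a b k1 h1.1 h2.1 hC d1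
    have L2 := linkage_one z w f₁ f₂ pz hzw (ci_syz hf0 hrel) (fun hh => pz.not_isUnit (hrel hh.1 hh.2)) _ K₂ c d k2 h1.2 h2.2 hC d2
    have e1 : Ideal.ofList [x] = Ideal.span {x} := by simp [Ideal.ofList]
    have e2 : Ideal.ofList [x, y] = Ideal.span {x, y} := by
      unfold Ideal.ofList; congr 1; ext t; simp
    have e3 : Ideal.ofList [x, y, z] = Ideal.span {x, y, z} := by
      unfold Ideal.ofList; congr 1; ext t; simp
    have l1 : Ideal.span {x, y} ≤ Ideal.span {x, y, z, w} := Ideal.span_mono (by intro t; simp; tauto)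
    have l2 : Ideal.span {z, w} ≤ Ideal.span {x, y, z, w} := Ideal.span_mono (by intro t; simp; tauto)
    have hr : ∀ r ∈ [x, y, z, w], r ∈ (K₁ ⊔ K₂).radical := by
      have q1 : ∀ r ∈ Ideal.span {x, y}, r ∈ (K₁ ⊔ K₂).radical := fun r hr =>
        ⟨2, Ideal.mem_sup_left (by rw [pow_two]; exact k1.sq (Ideal.mul_mem_mul hr hr))⟩
      have q2 : ∀ r ∈ Ideal.span {z, w}, r ∈ (K₁ ⊔ K₂).radical := fun r hr =>
        ⟨2, Ideal.mem_sup_right (by rw [pow_two]; exact k2.sq (Ideal.mul_mem_mul hr hr))⟩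
      intro r hr
      simp only [List.mem_cons, List.not_mem_nil, or_false] at hr
      rcases hr with rfl | rfl | rfl | rfl
      · exact q1 _ (Ideal.subset_span (by simp))
      · exact q1 _ (Ideal.subset_span (by simp))
      · exact q2 _ (Ideal.subset_span (by simp))
      · exact q2 _ (Ideal.subset_span (by simp))
    refine (caseB4 f₁ f₂ x y z w K₁ K₂ ?_ ?_ (ci_nzd hrel) (Ideal.mem_sup_left h1.1) (Ideal.mem_sup_left h2.1)
      ?_ ?_ ?_ ?_ hr hC L1 L2).mono (by norm_num)
    · intro ht
      apply i4.ne_top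
      rw [eq_top_iff, ← ht]
      exact sup_le (k1.le.trans l1) (k2.le.trans l2)
    · intro s hs; exact (mul_eq_zero.1 hs).resolve_right hf0
    · intro s hs; exact (mul_eq_zero.1 hs).resolve_right px.ne_zero
    · rw [e1]; intro s hs
      rw [Ideal.mem_span_singleton] at hs ⊢
      exact (px.dvd_or_dvd hs).resolve_right hxy
    · rw [e2]; intro s hs; exact (i1.mem_or_mem hs).resolve_right nz
    · rw [e3]; intro s hs; exact (i3.mem_or_mem hs).resolve_right nw

end

theorem statement_14
    {k : Type} [Field k] [IsAlgClosed k] {N : ℕ}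
    (f₁ f₂ f₃ : MvPolynomial (Fin N) k)
    (hf₁ : f₁.IsHomogeneous 3) (hf₂ : f₂.IsHomogeneous 3) (hf₃ : f₃.IsHomogeneous 3)
    (hIht : idealHeight (Ideal.span {f₁, f₂, f₃}) = 2)
    (hht₁₂ : idealHeight (Ideal.span {f₁, f₂}) = 2)
    (hht₁₃ : idealHeight (Ideal.span {f₁, f₃}) = 2)
    (hht₂₃ : idealHeight (Ideal.span {f₂, f₃}) = 2)
    (p₁ p₂ : Ideal (MvPolynomial (Fin N) k))
    (hp₁ : IsLinearPrime p₁) (hp₂ : IsLinearPrime p₂)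
    (hpht₁ : idealHeight p₁ = 2) (hpht₂ : idealHeight p₂ = 2) (hne : p₁ ≠ p₂)
    (K₁ K₂ : Ideal (MvPolynomial (Fin N) k))
    (hK₁primary : K₁.IsPrimary) (hK₁rad : K₁.radical = p₁)
    (hK₁e : HasMultiplicity K₁ (N - 2) 2)
    (hK₂primary : K₂.IsPrimary) (hK₂rad : K₂.radical = p₂)
    (hK₂e : HasMultiplicity K₂ (N - 2) 2)
    (hK : K₁ ⊓ K₂ = unmixedPart (Ideal.span {f₁, f₂, f₃}) ∨ K₁ ⊓ K₂ = Submodule.colon (Ideal.span {f₁, f₂}) (Ideal.span {f₃})) :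
    pdQuotLE (Ideal.span {f₁, f₂, f₃}) 5 := by
  obtain ⟨hf0, hrel⟩ := ci_facts f₁ f₂ hht₁₂
  obtain _ | n := N
  · exfalso
    have h1 := hf₁.totalDegree hf0
    rw [eq_C_of_isEmpty f₁, totalDegree_C] at h1
    omega
  obtain ⟨x, y, hxy, e1⟩ := linPrime_struct p₁ hp₁ hpht₁
  obtain ⟨z, w, hzw, e2⟩ := linPrime_struct p₂ hp₂ hpht₂
  have hmem : f₁ ∈ K₁ ⊓ K₂ ∧ f₂ ∈ K₁ ⊓ K₂ := by
    rcases hK with h | h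
    · rw [h]
      exact ⟨le_unmixedPart _ (Ideal.subset_span (by simp)), le_unmixedPart _ (Ideal.subset_span (by simp))⟩
    · rw [h]
      refine ⟨(mem_colon_single _ _ _).2 ?_, (mem_colon_single _ _ _).2 ?_⟩
      · exact Ideal.mul_mem_right _ _ (Ideal.subset_span (by simp))
      · exact Ideal.mul_mem_right _ _ (Ideal.subset_span (by simp))
  have hL : Submodule.colon (Ideal.span {f₁, f₂}) (Ideal.span {f₃} : Ideal (MvPolynomial (Fin (n + 1)) k)) = K₁ ⊓ K₂ ∨
      Submodule.colon (Ideal.span {f₁, f₂}) (Ideal.span {f₃} : Ideal (MvPolynomial (Fin (n + 1)) k)) =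
        (Ideal.span {f₁, f₂}).colon ((K₁ ⊓ K₂ : Ideal (MvPolynomial (Fin (n + 1)) k)) : Set (MvPolynomial (Fin (n + 1)) k)) := by
    rcases hK with h | h
    · right; rw [h]; exact colon_unmixed f₁ f₂ f₃ hf0 hrel hIht
    · left; exact h.symm
  have main : PD (MvPolynomial (Fin (n + 1)) k) 4 (MvPolynomial (Fin (n + 1)) k ⧸
      (Submodule.colon (Ideal.span {f₁, f₂}) (Ideal.span {f₃} : Ideal (MvPolynomial (Fin (n + 1)) k)) : Ideal _)) := by
    rcases LI.dichotomy hxy hzw (by rwa [← e1, ← e2]) with h4 | ⟨x', y', z', h3, s1, s2⟩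
    · obtain ⟨a, b, k1⟩ := exists_KS hxy p₁ K₁ e1 hp₁.1 hK₁primary hK₁rad hK₁e
      obtain ⟨c, d, k2⟩ := exists_KS hzw p₂ K₂ e2 hp₂.1 hK₂primary hK₂rad hK₂e
      rw [e1] at k1
      rw [e2] at k2
      exact final4 h4 k1 k2 hf₁ hf₂ hf0 hrel hmem.1 hmem.2 hL
    · obtain ⟨hx, hy, hz, hli⟩ := LI.triple.1 h3
      have l1 : LI ![x', y'] := LI.pair.2 ⟨hx, hy, fun a b hab => by
        obtain ⟨q1, q2, -⟩ := hli a b 0 (by simpa using hab)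
        exact ⟨q1, q2⟩⟩
      have l2 : LI ![x', z'] := LI.pair.2 ⟨hx, hz, fun a b hab => by
        obtain ⟨q1, -, q2⟩ := hli a 0 b (by simpa using hab)
        exact ⟨q1, q2⟩⟩
      obtain ⟨a, b, k1⟩ := exists_KS l1 p₁ K₁ (e1.trans s1) hp₁.1 hK₁primary hK₁rad hK₁e
      obtain ⟨c, d, k2⟩ := exists_KS l2 p₂ K₂ (e2.trans s2) hp₂.1 hK₂primary hK₂rad hK₂e
      rw [e1.trans s1] at k1
      rw [e2.trans s2] at k2
      exact final3 h3 k1 k2 hf0 hrel hmem.1 hmem.2 hL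
  refine pdQuotLE_of_PD _ 5 ((PD.colon' _ f₃ main ((ci_pd hf0 hrel).mono (by norm_num))).eq ?_)
  rw [← Ideal.span_union]
  congr 1; ext t; simp; tauto

end
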